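/- Let q ≥ 121 be an odd prime power and let E be an elliptic curve defined over F_q with j-invariant j(E) ≠ 0. Then the 6-elliptic code associated to E is non-extendable; equivalently, φ₆(E(F_q)) is a complete (n; 6, 4)-set in P⁵(F_q): for every point Q ∈ P⁵(F_q) \ φ₆(E(F_q)) there is a hyperplane through Q meeting φ₆(E(F_q)) in 6 distinct points. -/

import Mathlib

set_option linter.unusedSectionVars false

namespace NMDS

open WeierstrassCurve

variable {F : Type} [Field F] [Fintype F] [DecidableEq F]

/-- `ψ_i(X,Y)`: `Y^s` if `i = 3s` (`s ≥ 1`), `X·Y^s` if `i = 3s+2` (`s ≥ 0`),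
`X²·Y^s` if `i = 3s+4` (`s ≥ 0`). -/
def psi (i : ℕ) (X Y : F) : F :=
  if i % 3 = 0 then Y ^ (i / 3)
  else if i % 3 = 2 then X * Y ^ (i / 3)
  else X ^ 2 * Y ^ ((i - 4) / 3)

/-- The coordinate vector of `φ_k(P)`: `(1, ψ₂(P), …, ψ_k(P))` for an affine point `P`,
and `(0, …, 0, 1)` for the point at infinity. -/
def phiVec (W : WeierstrassCurve F) (k : ℕ) : W.toAffine.Point → (Fin k → F)
  | .zero => fun j => if (j : ℕ) = k - 1 then 1 else 0
  | .some (x := x) (y := y) _ => fun j => if (j : ℕ) = 0 then 1 else psi ((j : ℕ) + 1) x y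

lemma phiVec_ne_zero (W : WeierstrassCurve F) {k : ℕ} (hk : 0 < k)
    (P : W.toAffine.Point) : phiVec W k P ≠ 0 := by
  cases P with
  | zero =>
    intro h
    have := congrFun h ⟨k - 1, by omega⟩
    simp [phiVec] at this
  | some h' =>
    intro h
    have := congrFun h ⟨0, hk⟩
    simp [phiVec] at this

/-- The image of a rational point of `E` in `P^{k-1}(F_q)` under `φ_k`. -/
noncomputable def phiProj (W : WeierstrassCurve F) {k : ℕ} (hk : 0 < k)
    (P : W.toAffine.Point) : Projectivization F (Fin k → F) :=
  Projectivization.mk F (phiVec W k P) (phiVec_ne_zero W hk P)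

/-- The `k`-elliptic code associated to `E`, relative to an enumeration `e` of the `n`
rational points of `E`: the span of the rows of the `k × n` matrix whose `j`-th column
is `φ_k(P_j)`. -/
def ellipticCode (W : WeierstrassCurve F) (k : ℕ) {n : ℕ}
    (e : Fin n ≃ W.toAffine.Point) : Submodule F (Fin n → F) :=
  Submodule.span F (Set.range fun i : Fin k => fun j : Fin n => phiVec W k (e j) i)

/-- The minimum distance (= minimum weight) of a linear code. -/
noncomputable def minDist {n : ℕ} (C : Submodule F (Fin n → F)) : ℕ :=
  sInf {d | ∃ x ∈ C, x ≠ 0 ∧ hammingNorm x = d}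

/-- The standard inner product with `y` as a linear map. -/
def dotLin {n : ℕ} (y : Fin n → F) : (Fin n → F) →ₗ[F] F where
  toFun x := ∑ i, x i * y i
  map_add' a b := by simp [add_mul, Finset.sum_add_distrib]
  map_smul' c a := by simp [Finset.mul_sum, mul_assoc]

/-- The dual code: all vectors orthogonal to every codeword. -/
def dualCode {n : ℕ} (C : Submodule F (Fin n → F)) : Submodule F (Fin n → F) :=
  ⨅ y ∈ C, LinearMap.ker (dotLin y)

/-- The Singleton defect `s(C) = n - k + 1 - d` of a code of length `n`. -/
noncomputable def singletonDefect {n : ℕ} (C : Submodule F (Fin n → F)) : ℤ :=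
  (n : ℤ) + 1 - Module.finrank F C - minDist C

/-- A code is MDS if its Singleton defect is zero. -/
noncomputable def IsMDS {n : ℕ} (C : Submodule F (Fin n → F)) : Prop :=
  singletonDefect C = 0

/-- A code is near-MDS if both it and its dual have Singleton defect one. -/
noncomputable def IsNMDS {n : ℕ} (C : Submodule F (Fin n → F)) : Prop :=
  singletonDefect C = 1 ∧ singletonDefect (dualCode C) = 1

/-- An `[n,k,d]_q` code `C` is `h`-extendable if there is an `[n+h,k,d+h]_q` code `C'`
whose projection on the first `n` coordinates is `C`. -/
noncomputable def IsHExtendable {n : ℕ} (h : ℕ) (C : Submodule F (Fin n → F)) : Prop :=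
  ∃ C' : Submodule F (Fin (n + h) → F),
    Module.finrank F C' = Module.finrank F C ∧
    minDist C' = minDist C + h ∧
    Submodule.map (LinearMap.funLeft F F (Fin.castAdd h)) C' = C

/-- The point `p` of `P^{k-1}(F_q)` lies on the hyperplane with coefficient vector `a`. -/
def OnHyp {k : ℕ} (a : Fin k → F) (p : Projectivization F (Fin k → F)) : Prop :=
  ∑ i, a i * p.rep i = 0

/-- An `(·; k, k-2)`-set in `P^{k-1}(F_q)`: no `k+1` of its points lie on a common hyperplane,
i.e. every hyperplane contains at most `k` of its points. -/
def IsArcSet (k : ℕ) (S : Set (Projectivization F (Fin k → F))) : Prop :=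
  ∀ a : Fin k → F, a ≠ 0 → Set.ncard {p ∈ S | OnHyp a p} ≤ k

/-- A complete `(·; k, k-2)`-set: maximal with respect to set-theoretical inclusion. -/
def IsCompleteArcSet (k : ℕ) (S : Set (Projectivization F (Fin k → F))) : Prop :=
  IsArcSet k S ∧ ∀ T, IsArcSet k T → S ⊆ T → T = S

/-- Evaluation of the homogeneous cubic of a Weierstrass curve:
`Y²Z + a₁XYZ + a₃YZ² - X³ - a₂X²Z - a₄XZ² - a₆Z³`. -/
def cubicEval {R : Type*} [CommRing R] (W : WeierstrassCurve R) (x y z : R) : R :=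
  y ^ 2 * z + W.a₁ * x * y * z + W.a₃ * y * z ^ 2
    - (x ^ 3 + W.a₂ * x ^ 2 * z + W.a₄ * x * z ^ 2 + W.a₆ * z ^ 3)

/-- The gradient of the homogeneous cubic of a Weierstrass curve. -/
def gradEval {R : Type*} [CommRing R] (W : WeierstrassCurve R) (x y z : R) : Fin 3 → R :=
  ![W.a₁ * y * z - (3 * x ^ 2 + 2 * W.a₂ * x * z + W.a₄ * z ^ 2),
    2 * y * z + W.a₁ * x * z + W.a₃ * z ^ 2,
    y ^ 2 + W.a₁ * x * y + 2 * W.a₃ * y * z - (W.a₂ * x ^ 2 + 2 * W.a₄ * x * z + 3 * W.a₆ * z ^ 2)]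

/-- The point `p` of `P²(F_q)` lies on the plane cubic `E`. -/
def OnCurve (W : WeierstrassCurve F) (p : Projectivization F (Fin 3 → F)) : Prop :=
  cubicEval W (p.rep 0) (p.rep 1) (p.rep 2) = 0

/-- A line of `P²(F_q)`, given by its coefficient vector `l`, is a tangent of `E`:
it touches the curve at some point (over the algebraic closure) with multiplicity at
least two, i.e. it is the tangent line of the cubic at a contact point. -/
def IsTangentLine (W : WeierstrassCurve F) (l : Fin 3 → F) : Prop :=
  ∃ v : Fin 3 → AlgebraicClosure F, v ≠ 0 ∧
    cubicEval (W.baseChange (AlgebraicClosure F)) (v 0) (v 1) (v 2) = 0 ∧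
    (∑ i, algebraMap F (AlgebraicClosure F) (l i) * v i) = 0 ∧
    ∃ t : AlgebraicClosure F, t ≠ 0 ∧
      gradEval (W.baseChange (AlgebraicClosure F)) (v 0) (v 1) (v 2) =
        t • fun i => algebraMap F (AlgebraicClosure F) (l i)

/-- A line of `P²(F_q)` intersects `E` in three distinct `F_q`-rational points. -/
def IsThreeSecant (W : WeierstrassCurve F) (l : Fin 3 → F) : Prop :=
  ∃ u v w : Projectivization F (Fin 3 → F), u ≠ v ∧ u ≠ w ∧ v ≠ w ∧
    OnCurve W u ∧ OnCurve W v ∧ OnCurve W w ∧ OnHyp l u ∧ OnHyp l v ∧ OnHyp l w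

section Stepanov
open Polynomial

variable {F : Type} [Field F] [Fintype F]

/-- Sixteen times the cubic Taylor expansion of a square root, cleared of denominators. -/
def sqrtTaylor {R : Type*} [CommRing R] (D D₁ D₂ D₃ w : R) : R :=
  16 * D ^ 3 + 8 * D₁ * D ^ 2 * w + (8 * D * D₂ - 2 * D₁ ^ 2) * D * w ^ 2
    + (8 * D ^ 2 * D₃ - 4 * D * D₁ * D₂ + D₁ ^ 3) * w ^ 3

lemma sqrtTaylor_sq {R : Type*} [CommRing R] (D D₁ D₂ D₃ w : R) :
    w ^ 4 ∣ sqrtTaylor D D₁ D₂ D₃ w ^ 2 * D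
      - 256 * D ^ 6 * (D + D₁ * w + D₂ * w ^ 2 + D₃ * w ^ 3) := by
  refine ⟨D * ((2 * (8 * D₁ * D ^ 2) * (8 * D ^ 2 * D₃ - 4 * D * D₁ * D₂ + D₁ ^ 3)
    + ((8 * D * D₂ - 2 * D₁ ^ 2) * D) ^ 2)
    + 2 * ((8 * D * D₂ - 2 * D₁ ^ 2) * D) * (8 * D ^ 2 * D₃ - 4 * D * D₁ * D₂ + D₁ ^ 3) * w
    + (8 * D ^ 2 * D₃ - 4 * D * D₁ * D₂ + D₁ ^ 3) ^ 2 * w ^ 2), ?_⟩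
  unfold sqrtTaylor
  ring

lemma sqrtTaylor_sub_dvd {R : Type*} [CommRing R] (D D₁ D₂ D₃ w w' : R) :
    w - w' ∣ sqrtTaylor D D₁ D₂ D₃ w - sqrtTaylor D D₁ D₂ D₃ w' := by
  refine ⟨8 * D₁ * D ^ 2 + (8 * D * D₂ - 2 * D₁ ^ 2) * D * (w + w')
    + (8 * D ^ 2 * D₃ - 4 * D * D₁ * D₂ + D₁ ^ 3) * (w ^ 2 + w * w' + w' ^ 2), ?_⟩
  unfold sqrtTaylor
  ring

lemma two_ne_zero_of_odd (hodd : Odd (Fintype.card F)) : (2 : F) ≠ 0 := by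
  have h : ringChar F ≠ 2 := by
    intro h
    have := FiniteField.even_card_iff_char_two.1 h
    rw [Nat.odd_iff] at hodd
    omega
  exact Ring.two_ne_zero h

lemma X_pow_card_sub_eq (t : F) :
    (X : F[X]) ^ Fintype.card F = (X - C t) ^ Fintype.card F + C t := by
  obtain ⟨p, hp⟩ := CharP.exists F
  have := hp
  obtain ⟨n, hpr, hc⟩ := FiniteField.card F p
  have : Fact p.Prime := ⟨hpr⟩
  rw [hc, sub_pow_char_pow, ← C_pow, ← hc, FiniteField.pow_card]
  ring

lemma sub_dvd_pow_card_sub (D : F[X]) (t : F) :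
    (X - C t) ^ Fintype.card F ∣ D ^ Fintype.card F - C (D.eval t) := by
  obtain ⟨p, hp⟩ := CharP.exists F
  have := hp
  obtain ⟨n, hpr, hc⟩ := FiniteField.card F p
  have : Fact p.Prime := ⟨hpr⟩
  have : D ^ Fintype.card F - C (D.eval t) = (D - C (D.eval t)) ^ Fintype.card F := by
    rw [hc, sub_pow_char_pow, ← C_pow, ← hc, FiniteField.pow_card]
  rw [this]
  exact pow_dvd_pow_of_dvd (X_sub_C_dvd_sub_C_eval) _

/-- The auxiliary polynomial of the Stepanov argument. -/
noncomputable def stepanovAux (D D₁ D₂ D₃ : F[X]) : F[X] :=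
  16 * D ^ ((Fintype.card F - 1) / 2) * D ^ 3
    - sqrtTaylor D D₁ D₂ D₃ (X ^ Fintype.card F - X)

lemma stepanovAux_dvd (hodd : Odd (Fintype.card F)) (hq : 4 ≤ Fintype.card F)
    (D D₁ D₂ D₃ : F[X])
    (hT : ∀ t : F, (X - C t) ^ 4 ∣
      C (D.eval t) - (D - D₁ * (X - C t) + D₂ * (X - C t) ^ 2 - D₃ * (X - C t) ^ 3))
    (t : F) (h0 : D.eval t ≠ 0) (hs : IsSquare (D.eval t)) :
    (X - C t) ^ 4 ∣ stepanovAux D D₁ D₂ D₃ := by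
  have h2 := two_ne_zero_of_odd hodd
  set q := Fintype.card F with hqdef
  have h24 : ringChar F ≠ 2 := by
    intro h
    have := FiniteField.even_card_iff_char_two.1 h
    rw [Nat.odd_iff] at hodd
    omega
  set u : F[X] := X - C t with hu
  set T := sqrtTaylor D D₁ D₂ D₃ (X ^ q - X) with hTdef
  set T0 := sqrtTaylor D D₁ D₂ D₃ (-u) with hT0
  have hTT : u ^ 4 ∣ T - T0 := by
    have h1 := sqrtTaylor_sub_dvd D D₁ D₂ D₃ (X ^ q - X) (-u)
    refine dvd_trans ?_ h1
    have : (X : F[X]) ^ q - X - (-u) = u ^ q := by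
      rw [hqdef, X_pow_card_sub_eq t, hu]; ring
    rw [this]
    exact pow_dvd_pow _ hq
  have hsq : u ^ 4 ∣ T0 ^ 2 * D - 256 * D ^ 6 * C (D.eval t) := by
    have h1 := sqrtTaylor_sq D D₁ D₂ D₃ (-u)
    rw [show (-u) ^ 4 = u ^ 4 by ring] at h1
    have h3 := hT t
    have h4 : T0 ^ 2 * D - 256 * D ^ 6 * C (D.eval t)
      = (T0 ^ 2 * D - 256 * D ^ 6 * (D + D₁ * (-u) + D₂ * (-u) ^ 2 + D₃ * (-u) ^ 3))
        - 256 * D ^ 6 * (C (D.eval t) - (D - D₁ * u + D₂ * u ^ 2 - D₃ * u ^ 3)) := by ring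
    rw [h4]
    exact dvd_sub h1 (Dvd.dvd.mul_left h3 _)
  have hH : u ^ 4 ∣ (D ^ ((q - 1) / 2)) ^ 2 * D - C (D.eval t) := by
    have h1 : (D ^ ((q - 1) / 2)) ^ 2 * D = D ^ q := by
      rw [← pow_mul, ← pow_succ]
      congr 1
      obtain ⟨k, hk⟩ := hodd
      omega
    rw [h1]
    exact dvd_trans (pow_dvd_pow _ hq) (sub_dvd_pow_card_sub D t)
  have hprod : u ^ 4 ∣ stepanovAux D D₁ D₂ D₃ *
      ((16 * D ^ ((q - 1) / 2) * D ^ 3 + T) * D) := by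
    have : stepanovAux D D₁ D₂ D₃ * ((16 * D ^ ((q - 1) / 2) * D ^ 3 + T) * D)
      = 256 * D ^ 6 * ((D ^ ((q - 1) / 2)) ^ 2 * D - C (D.eval t))
        - (T0 ^ 2 * D - 256 * D ^ 6 * C (D.eval t)) - (T - T0) * ((T + T0) * D) := by
      unfold stepanovAux
      rw [← hqdef, ← hTdef]
      ring
    rw [this]
    exact dvd_sub (dvd_sub (Dvd.dvd.mul_left hH _) hsq) (Dvd.dvd.mul_right hTT _)
  have hprime : Prime u := prime_X_sub_C t
  refine hprime.pow_dvd_of_dvd_mul_right 4 ?_ hprod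
  rw [hu, dvd_iff_isRoot, IsRoot.def]
  have hXq : (t ^ q - t) = 0 := by rw [hqdef, FiniteField.pow_card]; ring
  have hchi : (D.eval t) ^ ((q - 1) / 2) = 1 := by
    have := (FiniteField.isSquare_iff h24 h0).1 hs
    rw [← hqdef] at this
    rw [← this]
    congr 1
    obtain ⟨k, hk⟩ := hodd
    omega
  have : eval t ((16 * D ^ ((q - 1) / 2) * D ^ 3 + T) * D) = 32 * (D.eval t) ^ 4 := by
    rw [hTdef]
    simp only [sqrtTaylor, eval_mul, eval_add, eval_pow, eval_sub, eval_X, eval_ofNat, hXq, hchi]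
    ring
  rw [this]
  have h32 : (32 : F) ≠ 0 := by
    have : (32 : F) = 2 ^ 5 := by norm_num
    rw [this]; exact pow_ne_zero _ h2
  exact mul_ne_zero h32 (pow_ne_zero _ h0)

lemma card_le_of_pow_dvd {G : F[X]} (hG : G ≠ 0) (s : Finset F) (m : ℕ)
    (h : ∀ t ∈ s, (X - C t) ^ m ∣ G) : m * s.card ≤ G.natDegree := by
  have hd : ∏ t ∈ s, (X - C t) ^ m ∣ G := by
    refine Finset.prod_dvd_of_coprime ?_ h
    intro a _ b _ hab
    exact (pairwise_coprime_X_sub_C (Function.injective_id) hab).pow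
  have := natDegree_le_of_dvd hd hG
  rw [natDegree_prod_of_monic _ _ (fun t _ => (monic_X_sub_C t).pow m)] at this
  simpa [mul_comm] using this

lemma sextic_taylor (d : Fin 7 → F) (t : F) :
    (X - C t) ^ 4 ∣
      (∑ i : Fin 7, C (d i) * (C t) ^ (i : ℕ) : F[X])
      - ((∑ i : Fin 7, C (d i) * X ^ (i : ℕ))
        - (C (d 1) + 2 * C (d 2) * X + 3 * C (d 3) * X ^ 2 + 4 * C (d 4) * X ^ 3
          + 5 * C (d 5) * X ^ 4 + 6 * C (d 6) * X ^ 5) * (X - C t)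
        + (C (d 2) + 3 * C (d 3) * X + 6 * C (d 4) * X ^ 2 + 10 * C (d 5) * X ^ 3
          + 15 * C (d 6) * X ^ 4) * (X - C t) ^ 2
        - (C (d 3) + 4 * C (d 4) * X + 10 * C (d 5) * X ^ 2 + 20 * C (d 6) * X ^ 3)
          * (X - C t) ^ 3) := by
  refine ⟨C (d 4) + C (d 5) * (4 * X + C t)
    + C (d 6) * (10 * X ^ 2 + 4 * X * C t + C t ^ 2), ?_⟩
  simp only [Fin.sum_univ_succ, Fin.sum_univ_zero, Fin.val_succ, Fin.val_zero]
  simp only [show (Fin.succ (0 : Fin 6)) = 1 from rfl,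
    show (Fin.succ (Fin.succ (0 : Fin 5))) = 2 from rfl,
    show (Fin.succ (Fin.succ (Fin.succ (0 : Fin 4)))) = 3 from rfl,
    show (Fin.succ (Fin.succ (Fin.succ (Fin.succ (0 : Fin 3))))) = 4 from rfl,
    show (Fin.succ (Fin.succ (Fin.succ (Fin.succ (Fin.succ (0 : Fin 2)))))) = 5 from rfl,
    show (Fin.succ (Fin.succ (Fin.succ (Fin.succ (Fin.succ (Fin.succ (0 : Fin 1))))))) = 6 from rfl]
  ring

lemma natDegree_stepanovAux_le {D D₁ D₂ D₃ : F[X]} (hD : D.natDegree ≤ 6)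
    (h₁ : D₁.natDegree ≤ 5) (h₂ : D₂.natDegree ≤ 4) (h₃ : D₃.natDegree ≤ 3)
    (hq : 4 ≤ Fintype.card F) :
    (stepanovAux D D₁ D₂ D₃).natDegree ≤ 3 * Fintype.card F + 15 := by
  unfold stepanovAux sqrtTaylor
  set q := Fintype.card F
  have hw : ((X : F[X]) ^ q - X).natDegree ≤ q := by
    compute_degree
    omega
  have hp := natDegree_pow_le_of_le ((q - 1) / 2) hD
  have a1 : (16 * D ^ ((q - 1) / 2) * D ^ 3).natDegree ≤ 3 * q + 15 := by
    refine (natDegree_mul_le_of_le (natDegree_mul_le_of_le (natDegree_ofNat 16).le hp)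
      (natDegree_pow_le_of_le 3 hD)).trans ?_
    omega
  have a2 : (16 * D ^ 3).natDegree ≤ 3 * q + 15 := by
    refine (natDegree_mul_le_of_le (natDegree_ofNat 16).le
      (natDegree_pow_le_of_le 3 hD)).trans ?_
    omega
  have a3 : (8 * D₁ * D ^ 2 * (X ^ q - X)).natDegree ≤ 3 * q + 15 := by
    refine (natDegree_mul_le_of_le (natDegree_mul_le_of_le (natDegree_mul_le_of_le
      (natDegree_ofNat 8).le h₁) (natDegree_pow_le_of_le 2 hD)) hw).trans ?_
    omega
  have b2 : (8 * D * D₂ - 2 * D₁ ^ 2).natDegree ≤ 10 :=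
    natDegree_sub_le_of_le (natDegree_mul_le_of_le (natDegree_mul_le_of_le
      (natDegree_ofNat 8).le hD) h₂) (natDegree_mul_le_of_le (natDegree_ofNat 2).le
      (natDegree_pow_le_of_le 2 h₁))
  have a4 : ((8 * D * D₂ - 2 * D₁ ^ 2) * D * (X ^ q - X) ^ 2).natDegree ≤ 3 * q + 15 := by
    refine (natDegree_mul_le_of_le (natDegree_mul_le_of_le b2 hD)
      (natDegree_pow_le_of_le 2 hw)).trans ?_
    omega
  have b3 : (8 * D ^ 2 * D₃ - 4 * D * D₁ * D₂ + D₁ ^ 3).natDegree ≤ 15 := by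
    refine natDegree_add_le_of_degree_le (natDegree_sub_le_of_le
      (natDegree_mul_le_of_le (natDegree_mul_le_of_le (natDegree_ofNat 8).le
        (natDegree_pow_le_of_le 2 hD)) h₃)
      (natDegree_mul_le_of_le (natDegree_mul_le_of_le (natDegree_mul_le_of_le
        (natDegree_ofNat 4).le hD) h₁) h₂))
      (natDegree_pow_le_of_le 3 h₁)
  have a5 : ((8 * D ^ 2 * D₃ - 4 * D * D₁ * D₂ + D₁ ^ 3) * (X ^ q - X) ^ 3).natDegree
      ≤ 3 * q + 15 := by
    refine (natDegree_mul_le_of_le b3 (natDegree_pow_le_of_le 3 hw)).trans ?_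
    omega
  exact (natDegree_sub_le_of_le a1 (natDegree_add_le_of_degree_le (natDegree_add_le_of_degree_le
    (natDegree_add_le_of_degree_le a2 a3) a4) a5)).trans (max_self _).le

lemma coeff_stepanovAux_of_sextic {D D₁ D₂ D₃ : F[X]} (hD : D.natDegree ≤ 6)
    (h₁ : D₁.natDegree ≤ 5) (h₂ : D₂.natDegree ≤ 4) (h₃ : D₃.natDegree ≤ 3) (c : F)
    (c0 : D.coeff 6 = c) (c1 : D₁.coeff 5 = 6 * c) (c2 : D₂.coeff 4 = 15 * c)
    (c3 : D₃.coeff 3 = 20 * c) (hq : 4 ≤ Fintype.card F) (hodd : Odd (Fintype.card F)) :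
    (stepanovAux D D₁ D₂ D₃).coeff (3 * Fintype.card F + 15)
      = 16 * c ^ 3 * (c ^ ((Fintype.card F - 1) / 2) - 1) := by
  unfold stepanovAux sqrtTaylor
  set q := Fintype.card F
  have hw : ((X : F[X]) ^ q - X).natDegree ≤ q := by
    compute_degree
    omega
  have hwc : ((X : F[X]) ^ q - X).coeff q = 1 := by
    rw [coeff_sub, coeff_X_pow_self, coeff_X_of_ne_one (by omega), sub_zero]
  have hp := natDegree_pow_le_of_le ((q - 1) / 2) hD
  have e1 : (16 * D ^ ((q - 1) / 2) * D ^ 3).coeff (3 * q + 15)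
      = 16 * (c ^ ((q - 1) / 2) * c ^ 3) := by
    have : (q - 1) / 2 * 6 + 3 * 6 = 3 * q + 15 := by
      obtain ⟨k, hk⟩ := hodd
      omega
    rw [mul_assoc, ← this, ← C_ofNat, coeff_C_mul,
      coeff_mul_add_eq_of_natDegree_le hp (natDegree_pow_le_of_le 3 hD),
      coeff_pow_of_natDegree_le hD, coeff_pow_of_natDegree_le hD, c0]
  have e2 : (16 * D ^ 3).coeff (3 * q + 15) = 0 := by
    refine coeff_eq_zero_of_natDegree_lt (lt_of_le_of_lt (natDegree_mul_le_of_le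
      (natDegree_ofNat 16).le (natDegree_pow_le_of_le 3 hD)) ?_)
    omega
  have e3 : (8 * D₁ * D ^ 2 * (X ^ q - X)).coeff (3 * q + 15) = 0 := by
    refine coeff_eq_zero_of_natDegree_lt (lt_of_le_of_lt (natDegree_mul_le_of_le
      (natDegree_mul_le_of_le (natDegree_mul_le_of_le
      (natDegree_ofNat 8).le h₁) (natDegree_pow_le_of_le 2 hD)) hw) ?_)
    omega
  have b2 : (8 * D * D₂ - 2 * D₁ ^ 2).natDegree ≤ 10 :=
    natDegree_sub_le_of_le (natDegree_mul_le_of_le (natDegree_mul_le_of_le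
      (natDegree_ofNat 8).le hD) h₂) (natDegree_mul_le_of_le (natDegree_ofNat 2).le
      (natDegree_pow_le_of_le 2 h₁))
  have e4 : ((8 * D * D₂ - 2 * D₁ ^ 2) * D * (X ^ q - X) ^ 2).coeff (3 * q + 15) = 0 := by
    refine coeff_eq_zero_of_natDegree_lt (lt_of_le_of_lt (natDegree_mul_le_of_le
      (natDegree_mul_le_of_le b2 hD) (natDegree_pow_le_of_le 2 hw)) ?_)
    omega
  have b3a : (D ^ 2 * D₃).natDegree ≤ 15 :=
    natDegree_mul_le_of_le (natDegree_pow_le_of_le 2 hD) h₃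
  have b3b : (D * D₁ * D₂).natDegree ≤ 15 :=
    natDegree_mul_le_of_le (natDegree_mul_le_of_le hD h₁) h₂
  have b3c : (D₁ ^ 3).natDegree ≤ 15 := natDegree_pow_le_of_le 3 h₁
  have b3 : (8 * D ^ 2 * D₃ - 4 * D * D₁ * D₂ + D₁ ^ 3).natDegree ≤ 15 := by
    refine natDegree_add_le_of_degree_le (natDegree_sub_le_of_le
      (natDegree_mul_le_of_le (natDegree_mul_le_of_le (natDegree_ofNat 8).le
        (natDegree_pow_le_of_le 2 hD)) h₃)
      (natDegree_mul_le_of_le (natDegree_mul_le_of_le (natDegree_mul_le_of_le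
        (natDegree_ofNat 4).le hD) h₁) h₂))
      (natDegree_pow_le_of_le 3 h₁)
  have f1 : (D ^ 2 * D₃).coeff 15 = c ^ 2 * (20 * c) := by
    rw [show 15 = 2 * 6 + 3 by norm_num,
      coeff_mul_add_eq_of_natDegree_le (natDegree_pow_le_of_le 2 hD) h₃,
      coeff_pow_of_natDegree_le hD, c0, c3]
  have f2 : (D * D₁ * D₂).coeff 15 = c * (6 * c) * (15 * c) := by
    rw [show 15 = (6 + 5) + 4 by norm_num,
      coeff_mul_add_eq_of_natDegree_le (natDegree_mul_le_of_le hD h₁) h₂,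
      coeff_mul_add_eq_of_natDegree_le hD h₁, c0, c1, c2]
  have f3 : (D₁ ^ 3).coeff 15 = (6 * c) ^ 3 := by
    rw [show 15 = 3 * 5 by norm_num, coeff_pow_of_natDegree_le h₁, c1]
  have e5 : ((8 * D ^ 2 * D₃ - 4 * D * D₁ * D₂ + D₁ ^ 3) * (X ^ q - X) ^ 3).coeff
      (3 * q + 15) = 16 * c ^ 3 := by
    rw [add_comm (3 * q) 15, coeff_mul_add_eq_of_natDegree_le b3 (natDegree_pow_le_of_le 3 hw),
      coeff_pow_of_natDegree_le hw, hwc,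
      show (8 * D ^ 2 * D₃ - 4 * D * D₁ * D₂ + D₁ ^ 3)
        = C 8 * (D ^ 2 * D₃) - C 4 * (D * D₁ * D₂) + D₁ ^ 3 by
        rw [C_ofNat, C_ofNat]; ring,
      coeff_add, coeff_sub, coeff_C_mul, coeff_C_mul, f1, f2, f3]
    ring
  rw [coeff_sub, coeff_add, coeff_add, coeff_add, e1, e2, e3, e4, e5]
  ring

lemma coeff_stepanovAux_of_quintic {D D₁ D₂ D₃ : F[X]} (hD : D.natDegree ≤ 5)
    (h₁ : D₁.natDegree ≤ 4) (h₂ : D₂.natDegree ≤ 3) (h₃ : D₃.natDegree ≤ 2)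
    (hq : 26 ≤ Fintype.card F) (hodd : Odd (Fintype.card F)) :
    (stepanovAux D D₁ D₂ D₃).coeff ((Fintype.card F - 1) / 2 * 5 + 3 * 5)
      = 16 * (D.coeff 5 ^ ((Fintype.card F - 1) / 2) * D.coeff 5 ^ 3) := by
  unfold stepanovAux sqrtTaylor
  set q := Fintype.card F
  obtain ⟨k, hk⟩ := hodd
  have hk' : (q - 1) / 2 = k := by omega
  rw [hk']
  have hw : ((X : F[X]) ^ q - X).natDegree ≤ q := by
    compute_degree
    omega
  have hp := natDegree_pow_le_of_le k hD
  have e1 : (16 * D ^ k * D ^ 3).coeff (k * 5 + 3 * 5)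
      = 16 * (D.coeff 5 ^ k * D.coeff 5 ^ 3) := by
    rw [mul_assoc, ← C_ofNat, coeff_C_mul,
      coeff_mul_add_eq_of_natDegree_le hp (natDegree_pow_le_of_le 3 hD),
      coeff_pow_of_natDegree_le hD, coeff_pow_of_natDegree_le hD]
  have e2 : (16 * D ^ 3).coeff (k * 5 + 3 * 5) = 0 := by
    refine coeff_eq_zero_of_natDegree_lt (lt_of_le_of_lt (natDegree_mul_le_of_le
      (natDegree_ofNat 16).le (natDegree_pow_le_of_le 3 hD)) ?_)
    omega
  have e3 : (8 * D₁ * D ^ 2 * (X ^ q - X)).coeff (k * 5 + 3 * 5) = 0 := by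
    refine coeff_eq_zero_of_natDegree_lt (lt_of_le_of_lt (natDegree_mul_le_of_le
      (natDegree_mul_le_of_le (natDegree_mul_le_of_le
      (natDegree_ofNat 8).le h₁) (natDegree_pow_le_of_le 2 hD)) hw) ?_)
    omega
  have b2 : (8 * D * D₂ - 2 * D₁ ^ 2).natDegree ≤ 8 :=
    natDegree_sub_le_of_le (natDegree_mul_le_of_le (natDegree_mul_le_of_le
      (natDegree_ofNat 8).le hD) h₂) (natDegree_mul_le_of_le (natDegree_ofNat 2).le
      (natDegree_pow_le_of_le 2 h₁))
  have e4 : ((8 * D * D₂ - 2 * D₁ ^ 2) * D * (X ^ q - X) ^ 2).coeff (k * 5 + 3 * 5) = 0 := by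
    refine coeff_eq_zero_of_natDegree_lt (lt_of_le_of_lt (natDegree_mul_le_of_le
      (natDegree_mul_le_of_le b2 hD) (natDegree_pow_le_of_le 2 hw)) ?_)
    omega
  have b3 : (8 * D ^ 2 * D₃ - 4 * D * D₁ * D₂ + D₁ ^ 3).natDegree ≤ 12 := by
    refine natDegree_add_le_of_degree_le (natDegree_sub_le_of_le
      (natDegree_mul_le_of_le (natDegree_mul_le_of_le (natDegree_ofNat 8).le
        (natDegree_pow_le_of_le 2 hD)) h₃)
      (natDegree_mul_le_of_le (natDegree_mul_le_of_le (natDegree_mul_le_of_le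
        (natDegree_ofNat 4).le hD) h₁) h₂))
      (natDegree_pow_le_of_le 3 h₁)
  set P := 8 * D ^ 2 * D₃ - 4 * D * D₁ * D₂ + D₁ ^ 3
  have e5 : (P * (X ^ q - X) ^ 3).coeff (k * 5 + 3 * 5) = 0 := by
    have hr : ((X ^ q) * (-3 * X ^ (q + 1) + 3 * X ^ 2) - X ^ 3 : F[X]).natDegree
        ≤ 2 * q + 1 := by
      refine (natDegree_sub_le_of_le (natDegree_mul_le_of_le (natDegree_X_pow q).le
        (natDegree_add_le_of_degree_le (n := q + 1) ?_ ?_)) (natDegree_X_pow 3).le).trans ?_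
      · compute_degree
      · compute_degree
        omega
      · omega
    have : P * (X ^ q - X) ^ 3 = P * X ^ (3 * q)
        + P * ((X ^ q) * (-3 * X ^ (q + 1) + 3 * X ^ 2) - X ^ 3) := by ring
    rw [this, coeff_add, coeff_mul_X_pow', if_neg (by omega), zero_add]
    refine coeff_eq_zero_of_natDegree_lt (lt_of_le_of_lt (natDegree_mul_le_of_le b3 hr) ?_)
    omega
  rw [coeff_sub, coeff_add, coeff_add, coeff_add, e1, e2, e3, e4, e5]
  ring

/-- A Stepanov type bound for the number of nonzero square values of a sextic. -/
theorem card_square_values_le [DecidableEq F] (hodd : Odd (Fintype.card F))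
    (hq : 26 ≤ Fintype.card F)
    (d : Fin 7 → F) (hd : ¬ IsSquare (d 6) ∨ (d 6 = 0 ∧ d 5 ≠ 0)) (s : Finset F)
    (hs : ∀ t ∈ s, (∑ i : Fin 7, d i * t ^ (i : ℕ)) ≠ 0
      ∧ IsSquare (∑ i : Fin 7, d i * t ^ (i : ℕ))) :
    4 * s.card ≤ 3 * Fintype.card F + 15 := by
  have h2 := two_ne_zero_of_odd hodd
  have h16 : (16 : F) ≠ 0 := by
    rw [show (16 : F) = 2 ^ 4 by norm_num]; exact pow_ne_zero _ h2
  have hchar : ringChar F ≠ 2 := by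
    intro h
    have := FiniteField.even_card_iff_char_two.1 h
    rw [Nat.odd_iff] at hodd
    omega
  set D : F[X] := ∑ i : Fin 7, C (d i) * X ^ (i : ℕ) with hD
  set D₁ : F[X] := C (d 1) + 2 * C (d 2) * X + 3 * C (d 3) * X ^ 2 + 4 * C (d 4) * X ^ 3
          + 5 * C (d 5) * X ^ 4 + 6 * C (d 6) * X ^ 5 with hD₁
  set D₂ : F[X] := C (d 2) + 3 * C (d 3) * X + 6 * C (d 4) * X ^ 2 + 10 * C (d 5) * X ^ 3
          + 15 * C (d 6) * X ^ 4 with hD₂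
  set D₃ : F[X] := C (d 3) + 4 * C (d 4) * X + 10 * C (d 5) * X ^ 2 + 20 * C (d 6) * X ^ 3
    with hD₃
  have hev : ∀ t, D.eval t = ∑ i : Fin 7, d i * t ^ (i : ℕ) := by
    intro t
    rw [hD, eval_finsetSum]
    simp
  have hDs : D = C (d 0) + C (d 1) * X + C (d 2) * X ^ 2 + C (d 3) * X ^ 3 + C (d 4) * X ^ 4
      + C (d 5) * X ^ 5 + C (d 6) * X ^ 6 := by
    rw [hD, Fin.sum_univ_seven]
    simp
  have n0 : D.natDegree ≤ 6 := by rw [hDs]; compute_degree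
  have n1 : D₁.natDegree ≤ 5 := by rw [hD₁]; compute_degree
  have n2 : D₂.natDegree ≤ 4 := by rw [hD₂]; compute_degree
  have n3 : D₃.natDegree ≤ 3 := by rw [hD₃]; compute_degree
  have hT : ∀ t : F, (X - C t) ^ 4 ∣
      C (D.eval t) - (D - D₁ * (X - C t) + D₂ * (X - C t) ^ 2 - D₃ * (X - C t) ^ 3) := by
    intro t
    have := sextic_taylor d t
    rw [hev]
    simpa only [map_sum, C_mul, C_pow] using this
  have hne : stepanovAux D D₁ D₂ D₃ ≠ 0 := by
    rcases hd with hns | ⟨h6, h5⟩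
    · have h60 : d 6 ≠ 0 := fun h => hns (h ▸ IsSquare.zero)
      have hc := coeff_stepanovAux_of_sextic n0 n1 n2 n3 (d 6)
        (by rw [hDs]; compute_degree!) (by rw [hD₁]; compute_degree!)
        (by rw [hD₂]; compute_degree!) (by rw [hD₃]; compute_degree!) (by omega) hodd
      intro h0
      rw [h0, coeff_zero] at hc
      have hpm := (FiniteField.pow_dichotomy hchar h60).resolve_left
        (fun h => hns ((FiniteField.isSquare_iff hchar h60).2 h))
      rw [show (Fintype.card F - 1) / 2 = Fintype.card F / 2 by
        obtain ⟨k, hk⟩ := hodd; omega, hpm] at hc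
      have : (16 * d 6 ^ 3 * (-1 - 1) : F) = -(2 ^ 5 * d 6 ^ 3) := by ring
      rw [this] at hc
      exact mul_ne_zero (pow_ne_zero 5 h2) (pow_ne_zero 3 h60) (neg_eq_zero.1 hc.symm)
    · have m0 : D.natDegree ≤ 5 := by
        rw [hDs, h6]; simp only [C_0, zero_mul, add_zero]; compute_degree
      have m1 : D₁.natDegree ≤ 4 := by
        rw [hD₁, h6]; simp only [C_0, zero_mul, mul_zero, add_zero]; compute_degree
      have m2 : D₂.natDegree ≤ 3 := by
        rw [hD₂, h6]; simp only [C_0, zero_mul, mul_zero, add_zero]; compute_degree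
      have m3 : D₃.natDegree ≤ 2 := by
        rw [hD₃, h6]; simp only [C_0, zero_mul, mul_zero, add_zero]; compute_degree
      have hc := coeff_stepanovAux_of_quintic m0 m1 m2 m3 hq hodd
      have hc5 : D.coeff 5 = d 5 := by
        rw [hDs, h6]; simp only [C_0, zero_mul, add_zero]; compute_degree!
      intro h0
      rw [h0, coeff_zero, hc5] at hc
      exact mul_ne_zero h16 (mul_ne_zero (pow_ne_zero _ h5) (pow_ne_zero 3 h5)) hc.symm
  refine (card_le_of_pow_dvd hne s 4 fun t ht => ?_).trans
    (natDegree_stepanovAux_le n0 n1 n2 n3 (by omega))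
  have := hs t ht
  rw [← hev] at this
  exact stepanovAux_dvd hodd (by omega) D D₁ D₂ D₃ hT t this.1 this.2

end Stepanov

section CubicRoots
open Polynomial

variable {F : Type} [Field F] [Fintype F]

lemma exists_algebraMap_eq_of_pow_card_eq {L : Type*} [Field L] [Algebra F L] {x : L}
    (hx : x ^ Fintype.card F = x) : ∃ a : F, algebraMap F L a = x := by
  classical
  by_contra hcon
  push Not at hcon
  set P : L[X] := X ^ Fintype.card F - X
  have hP : P ≠ 0 := FiniteField.X_pow_card_sub_X_ne_zero L Fintype.one_lt_card
  have hdeg : P.natDegree = Fintype.card F :=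
    FiniteField.X_pow_card_sub_X_natDegree_eq L Fintype.one_lt_card
  let s : Finset L := insert x (Finset.univ.image (algebraMap F L))
  have hs : s.card = Fintype.card F + 1 := by
    rw [Finset.card_insert_of_notMem (by simpa using hcon),
      Finset.card_image_of_injective _ (algebraMap F L).injective, Finset.card_univ]
  have hsub : s.val ⊆ P.roots := by
    intro y hy
    rw [mem_roots hP]
    rcases Finset.mem_insert.1 hy with rfl | hy
    · simp [P, hx]
    · obtain ⟨a, -, rfl⟩ := Finset.mem_image.1 hy
      simp [P, ← map_pow, FiniteField.pow_card]
  have := (Polynomial.card_le_degree_of_subset_roots hsub)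
  omega

/-- The discriminant of the cubic `k a³ + c₁ a² + c₂ a + c₃`. -/
def cubicDisc {R : Type*} [CommRing R] (k c₁ c₂ c₃ : R) : R :=
  c₁ ^ 2 * c₂ ^ 2 - 4 * k * c₂ ^ 3 - 4 * c₁ ^ 3 * c₃ - 27 * k ^ 2 * c₃ ^ 2
    + 18 * k * c₁ * c₂ * c₃

/-- A cubic over a finite field without roots has a nonzero square discriminant. -/
lemma cubicDisc_of_no_root {k c₁ c₂ c₃ : F} (hk : k ≠ 0)
    (h : ∀ a, k * a ^ 3 + c₁ * a ^ 2 + c₂ * a + c₃ ≠ 0) :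
    cubicDisc k c₁ c₂ c₃ ≠ 0 ∧ IsSquare (cubicDisc k c₁ c₂ c₃) := by
  let L := AlgebraicClosure F
  let φ : F →+* L := algebraMap F L
  let P : Cubic F := ⟨k, c₁, c₂, c₃⟩
  have ha : P.a ≠ 0 := hk
  obtain ⟨α, β, γ, h3⟩ := (Cubic.splits_iff_roots_eq_three (φ := φ) ha).1
    (IsAlgClosed.splits _)
  have hb := Cubic.b_eq_three_roots ha h3
  have hc := Cubic.c_eq_three_roots ha h3
  have hd := Cubic.d_eq_three_roots ha h3
  have hk' : φ k ≠ 0 := by simpa using hk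
  change φ c₁ = φ k * _ at hb
  change φ c₂ = φ k * _ at hc
  change φ c₃ = φ k * _ at hd
  set q := Fintype.card F with hq
  obtain ⟨p, hp⟩ := CharP.exists F
  have := hp
  obtain ⟨n, hpr, hcard⟩ := FiniteField.card F p
  have : Fact p.Prime := ⟨hpr⟩
  have : CharP L p := charP_of_injective_algebraMap φ.injective p
  have hadd : ∀ x y : L, (x + y) ^ q = x ^ q + y ^ q := fun x y => by
    rw [hq, hcard, add_pow_char_pow]
  have hsub : ∀ x y : L, (x - y) ^ q = x ^ q - y ^ q := fun x y => by
    rw [hq, hcard, sub_pow_char_pow]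
  have hfix : ∀ a : F, φ a ^ q = φ a := fun a => by rw [← map_pow, FiniteField.pow_card]
  have hfact : ∀ x : L, φ k * x ^ 3 + φ c₁ * x ^ 2 + φ c₂ * x + φ c₃
      = φ k * ((x - α) * (x - β) * (x - γ)) := by
    intro x; rw [hb, hc, hd]; ring
  have hnf : ∀ x : L, φ k * x ^ 3 + φ c₁ * x ^ 2 + φ c₂ * x + φ c₃ = 0 → x ^ q ≠ x := by
    intro x hx hxq
    obtain ⟨a, rfl⟩ := exists_algebraMap_eq_of_pow_card_eq hxq
    refine h a (φ.injective ?_)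
    simpa using hx
  have hroot : ∀ x : L, φ k * x ^ 3 + φ c₁ * x ^ 2 + φ c₂ * x + φ c₃ = 0 →
      x ^ q = α ∨ x ^ q = β ∨ x ^ q = γ := by
    intro x hx
    have h1 : φ k * (x ^ q) ^ 3 + φ c₁ * (x ^ q) ^ 2 + φ c₂ * x ^ q + φ c₃ = 0 := by
      have := congrArg (· ^ q) hx
      simp only [hadd, mul_pow, hfix] at this
      rw [zero_pow (by rw [hq]; exact Fintype.card_ne_zero)] at this
      rw [← this]
      ring
    rw [hfact] at h1
    have h2 := (mul_eq_zero.1 h1).resolve_left hk'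
    rcases mul_eq_zero.1 h2 with h2 | h2
    · rcases mul_eq_zero.1 h2 with h2 | h2
      · exact Or.inl (sub_eq_zero.1 h2)
      · exact Or.inr (Or.inl (sub_eq_zero.1 h2))
    · exact Or.inr (Or.inr (sub_eq_zero.1 h2))
  have hα : φ k * α ^ 3 + φ c₁ * α ^ 2 + φ c₂ * α + φ c₃ = 0 := by rw [hfact]; ring
  have hβ : φ k * β ^ 3 + φ c₁ * β ^ 2 + φ c₂ * β + φ c₃ = 0 := by rw [hfact]; ring
  have hγ : φ k * γ ^ 3 + φ c₁ * γ ^ 2 + φ c₂ * γ + φ c₃ = 0 := by rw [hfact]; ring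
  have hsum : α ^ q + β ^ q + γ ^ q = α + β + γ := by
    have h1 : φ (-(c₁ / k)) = α + β + γ := by
      rw [map_neg, map_div₀, hb, mul_div_cancel_left₀ _ hk']; ring
    rw [← h1, ← hfix, h1, hadd, hadd]
  have hdisc : φ (cubicDisc k c₁ c₂ c₃)
      = (φ k * φ k * ((α - β) * (α - γ) * (β - γ))) ^ 2 := by
    simp only [cubicDisc, map_add, map_sub, map_mul, map_pow, map_ofNat]
    rw [hb, hc, hd]
    ring
  have key : ((α - β) * (α - γ) * (β - γ)) ^ q = (α - β) * (α - γ) * (β - γ)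
      ∧ (α - β) * (α - γ) * (β - γ) ≠ 0 := by
    have nα := hnf α hα
    have nβ := hnf β hβ
    have nγ := hnf γ hγ
    rw [mul_pow, mul_pow, hsub, hsub, hsub]
    rcases hroot α hα with e1 | e1 | e1
    · exact absurd e1 nα
    · rcases hroot β hβ with e2 | e2 | e2
      · exfalso; apply nγ
        rw [e1, e2] at hsum
        linear_combination hsum
      · exact absurd e2 nβ
      · have e3 : γ ^ q = α := by rw [e1, e2] at hsum; linear_combination hsum
        refine ⟨by rw [e1, e2, e3]; ring, mul_ne_zero (mul_ne_zero ?_ ?_) ?_⟩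
        · intro h0; exact nα (by rw [e1, sub_eq_zero.1 h0])
        · intro h0; exact nγ (by rw [e3, sub_eq_zero.1 h0])
        · intro h0; exact nβ (by rw [e2, sub_eq_zero.1 h0])
    · rcases hroot γ hγ with e2 | e2 | e2
      · exfalso; apply nβ
        rw [e1, e2] at hsum
        linear_combination hsum
      · have e3 : β ^ q = α := by rw [e1, e2] at hsum; linear_combination hsum
        refine ⟨by rw [e1, e2, e3]; ring, mul_ne_zero (mul_ne_zero ?_ ?_) ?_⟩
        · intro h0; exact nβ (by rw [e3, sub_eq_zero.1 h0])
        · intro h0; exact nα (by rw [e1, sub_eq_zero.1 h0])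
        · intro h0; exact nγ (by rw [e2, sub_eq_zero.1 h0])
      · exact absurd e2 nγ
  obtain ⟨δ, hδ⟩ := exists_algebraMap_eq_of_pow_card_eq key.1
  have hfin : cubicDisc k c₁ c₂ c₃ = (k * k * δ) ^ 2 := by
    apply φ.injective
    rw [hdisc, map_pow, map_mul, map_mul]
    rw [← hδ]
  refine ⟨?_, ⟨k * k * δ, by rw [hfin, sq]⟩⟩
  rw [hfin]
  refine pow_ne_zero _ (mul_ne_zero (mul_ne_zero hk hk) ?_)
  rintro rfl
  exact key.2 (by rw [← hδ, map_zero])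

/-- A cubic with three distinct roots has a nonzero square discriminant. -/
lemma cubicDisc_of_three_roots {k c₁ c₂ c₃ x y z : F} (hk : k ≠ 0)
    (hx : k * x ^ 3 + c₁ * x ^ 2 + c₂ * x + c₃ = 0)
    (hy : k * y ^ 3 + c₁ * y ^ 2 + c₂ * y + c₃ = 0)
    (hz : k * z ^ 3 + c₁ * z ^ 2 + c₂ * z + c₃ = 0)
    (hxy : x ≠ y) (hxz : x ≠ z) (hyz : y ≠ z) :
    cubicDisc k c₁ c₂ c₃ ≠ 0 ∧ IsSquare (cubicDisc k c₁ c₂ c₃) := by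
  have sxy := sub_ne_zero.2 hxy
  have sxz := sub_ne_zero.2 hxz
  have syz := sub_ne_zero.2 hyz
  have e1 : k * (x ^ 2 + x * y + y ^ 2) + c₁ * (x + y) + c₂ = 0 := by
    apply mul_left_cancel₀ sxy
    linear_combination hx - hy
  have e2 : k * (x ^ 2 + x * z + z ^ 2) + c₁ * (x + z) + c₂ = 0 := by
    apply mul_left_cancel₀ sxz
    linear_combination hx - hz
  have h1 : c₁ = -(k * (x + y + z)) := by
    have : k * (x + y + z) + c₁ = 0 := by
      apply mul_left_cancel₀ syz
      linear_combination e1 - e2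
    linear_combination this
  have h2 : c₂ = k * (x * y + x * z + y * z) := by
    rw [h1] at e1; linear_combination e1
  have h3 : c₃ = -(k * (x * y * z)) := by
    rw [h1, h2] at hx; linear_combination hx
  have hfin : cubicDisc k c₁ c₂ c₃ = (k * k * ((x - y) * (x - z) * (y - z))) ^ 2 := by
    rw [h1, h2, h3]; unfold cubicDisc; ring
  rw [hfin]
  exact ⟨pow_ne_zero _ (mul_ne_zero (mul_ne_zero hk hk) (mul_ne_zero (mul_ne_zero sxy sxz) syz)),
    ⟨_, sq _⟩⟩

end CubicRoots

section
open Matrix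

section Plane
variable {F : Type} [Field F]

lemma exists_smul_of_cross_eq_zero {l n : Fin 3 → F} (hn : n ≠ 0) (h : l ⨯₃ n = 0) :
    ∃ c : F, l = c • n := by
  have h0 := congrFun h 0
  have h1 := congrFun h 1
  have h2 := congrFun h 2
  simp [cross_apply] at h0 h1 h2
  have hi : ∃ i, n i ≠ 0 := by
    by_contra hcon
    push Not at hcon
    exact hn (funext hcon)
  obtain ⟨i, hi⟩ := hi
  refine ⟨l i / n i, ?_⟩
  ext j
  rw [Pi.smul_apply, smul_eq_mul, div_mul_eq_mul_div, eq_div_iff hi]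
  fin_cases i <;> fin_cases j <;> simp <;>
    first
    | linear_combination h0
    | linear_combination h1
    | linear_combination h2
    | linear_combination -h0
    | linear_combination -h1
    | linear_combination -h2

lemma exists_smul_cross {l u v : Fin 3 → F} (hn : u ⨯₃ v ≠ 0) (hu : l ⬝ᵥ u = 0)
    (hv : l ⬝ᵥ v = 0) : ∃ c : F, l = c • (u ⨯₃ v) := by
  refine exists_smul_of_cross_eq_zero hn ?_
  rw [vec3_dotProduct] at hu hv
  ext j
  fin_cases j <;> simp [cross_apply]
  · linear_combination u 0 * hv - v 0 * hu
  · linear_combination u 1 * hv - v 1 * hu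
  · linear_combination u 2 * hv - v 2 * hu

lemma exists_mem_span_pair {l p r w : Fin 3 → F} (hl : l ≠ 0) (hpr : p ⨯₃ r ≠ 0)
    (hp : l ⬝ᵥ p = 0) (hr : l ⬝ᵥ r = 0) (hw : l ⬝ᵥ w = 0) :
    ∃ a b : F, w = a • p + b • r := by
  obtain ⟨c, hc⟩ := exists_smul_cross hpr hp hr
  have hc0 : c ≠ 0 := by rintro rfl; exact hl (by rw [hc, zero_smul])
  have hnw : (p ⨯₃ r) ⬝ᵥ w = 0 := by
    rw [hc, smul_dotProduct, smul_eq_mul] at hw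
    exact (mul_eq_zero.1 hw).resolve_left hc0
  have hi : ∃ i, (p ⨯₃ r) i ≠ 0 := by
    by_contra hcon
    push Not at hcon
    exact hpr (funext hcon)
  obtain ⟨i, hi⟩ := hi
  refine ⟨(w ⨯₃ r) i / (p ⨯₃ r) i, (p ⨯₃ w) i / (p ⨯₃ r) i, ?_⟩
  ext j
  rw [Pi.add_apply, Pi.smul_apply, Pi.smul_apply, smul_eq_mul, smul_eq_mul, div_mul_eq_mul_div,
    div_mul_eq_mul_div, ← add_div, eq_div_iff hi]
  rw [vec3_dotProduct] at hnw
  fin_cases i <;> fin_cases j <;> simp [cross_apply] at hnw ⊢ <;>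
    first
    | linear_combination hnw
    | ring1

lemma smul_cross_ne_zero_iff {u v : Fin 3 → F} {a b c d : F} (hn : u ⨯₃ v ≠ 0)
    (h : a * d - b * c ≠ 0) : (a • u + b • v) ⨯₃ (c • u + d • v) ≠ 0 := by
  have : (a • u + b • v) ⨯₃ (c • u + d • v) = (a * d - b * c) • (u ⨯₃ v) := by
    ext j
    fin_cases j <;> simp [cross_apply] <;> ring
  rw [this]
  exact smul_ne_zero h hn

lemma cross_ne_zero_of_not_smul {u v : Fin 3 → F} (hv : v ≠ 0) (h : ∀ c : F, u ≠ c • v) :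
    u ⨯₃ v ≠ 0 := by
  intro h0
  obtain ⟨c, hc⟩ := exists_smul_of_cross_eq_zero hv h0
  exact h c hc

lemma exists_dotProduct_ne_zero {n : Fin 3 → F} (hn : n ≠ 0) : ∃ r, n ⬝ᵥ r ≠ 0 := by
  by_contra hcon
  push Not at hcon
  refine hn (funext fun i => ?_)
  have := hcon (Pi.single i 1)
  simpa using this

variable [Fintype F] [DecidableEq F]

lemma card_orthogonal {v : Fin 3 → F} (hv : v ≠ 0) :
    (Finset.univ.filter fun l : Fin 3 → F => l ⬝ᵥ v = 0).card = Fintype.card F ^ 2 := by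
  let f : (Fin 3 → F) →ₗ[F] F :=
    { toFun := fun l => l ⬝ᵥ v
      map_add' := fun a b => add_dotProduct a b v
      map_smul' := fun c a => smul_dotProduct c a v }
  obtain ⟨r, hr⟩ := exists_dotProduct_ne_zero hv
  have hsurj : Function.Surjective f := by
    intro y
    refine ⟨(y / (v ⬝ᵥ r)) • r, ?_⟩
    change ((y / (v ⬝ᵥ r)) • r) ⬝ᵥ v = y
    rw [smul_dotProduct, dotProduct_comm r v, smul_eq_mul, div_mul_cancel₀ _ hr]
  have h1 := LinearMap.finrank_range_add_finrank_ker f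
  rw [LinearMap.range_eq_top.2 hsurj, finrank_top, Module.finrank_self,
    Module.finrank_fin_fun] at h1
  have h2 : Module.finrank F (LinearMap.ker f) = 2 := by omega
  have h3 := Module.natCard_eq_pow_finrank (K := F) (V := LinearMap.ker f)
  rw [h2, Nat.card_eq_fintype_card (α := F)] at h3
  rw [← h3, ← Fintype.card_subtype, ← Nat.card_eq_fintype_card]
  rfl

lemma card_orthogonal_pair {v w : Fin 3 → F} (h : v ⨯₃ w ≠ 0) :
    (Finset.univ.filter fun l : Fin 3 → F => l ⬝ᵥ v = 0 ∧ l ⬝ᵥ w = 0).card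
      = Fintype.card F := by
  have : (Finset.univ.filter fun l : Fin 3 → F => l ⬝ᵥ v = 0 ∧ l ⬝ᵥ w = 0)
      = Finset.univ.image (fun c : F => c • (v ⨯₃ w)) := by
    ext l
    simp only [Finset.mem_filter, Finset.mem_univ, true_and, Finset.mem_image]
    constructor
    · rintro ⟨h1, h2⟩
      obtain ⟨c, hc⟩ := exists_smul_cross h h1 h2
      exact ⟨c, hc.symm⟩
    · rintro ⟨c, rfl⟩
      rw [smul_dotProduct, smul_dotProduct, dotProduct_comm, dotProduct_comm _ w,
        dot_self_cross, dot_cross_self]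
      simp
  rw [this, Finset.card_image_of_injective _ (fun a b hab => smul_left_injective F h hab),
    Finset.card_univ]

/-- The nonzero multiples of a vector. -/
def nzMultiples (v : Fin 3 → F) : Finset (Fin 3 → F) :=
  (Finset.univ.filter fun c : F => c ≠ 0).image fun c => c • v

lemma card_nonzero : (Finset.univ.filter fun c : F => c ≠ 0).card = Fintype.card F - 1 := by
  rw [Finset.filter_ne', Finset.card_erase_of_mem (Finset.mem_univ _), Finset.card_univ]

lemma card_nzMultiples_le (v : Fin 3 → F) : (nzMultiples v).card ≤ Fintype.card F - 1 :=
  Finset.card_image_le.trans card_nonzero.le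

lemma mem_nzMultiples {v w : Fin 3 → F} : w ∈ nzMultiples v ↔ ∃ c : F, c ≠ 0 ∧ w = c • v := by
  simp [nzMultiples, eq_comm]

end Plane

/-- A smooth plane cubic over `F` without a line component, whose rational points are
parametrised by `G`; `g` is the gradient of the cubic form `C`. -/
structure PlaneModel (F G : Type) [Field F] where
  C : (Fin 3 → F) → F
  g : (Fin 3 → F) → (Fin 3 → F)
  expand : ∀ u v : Fin 3 → F, ∀ a b : F, C (a • u + b • v) = a ^ 3 * C u
    + a ^ 2 * b * (g u ⬝ᵥ v) + a * b ^ 2 * (g v ⬝ᵥ u) + b ^ 3 * C v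
  smooth : ∀ u, u ≠ 0 → C u = 0 → g u ≠ 0
  noline : ∀ l, l ≠ 0 → ∃ w, l ⬝ᵥ w = 0 ∧ C w ≠ 0
  pt : G → (Fin 3 → F)
  pt_ne : ∀ P, pt P ≠ 0
  C_pt : ∀ P, C (pt P) = 0
  inj : ∀ P Q, ∀ c : F, pt P = c • pt Q → P = Q
  surj : ∀ u, u ≠ 0 → C u = 0 → ∃ P, ∃ c : F, u = c • pt P

namespace PlaneModel
variable {F G : Type} [Field F] [Fintype F] [DecidableEq F] [Fintype G] [DecidableEq G]
  (M : PlaneModel F G)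

lemma C_smul (a : F) (u : Fin 3 → F) : M.C (a • u) = a ^ 3 * M.C u := by
  have := M.expand u 0 a 0
  simpa using this

lemma g_dot_self (h2 : (2 : F) ≠ 0) {u : Fin 3 → F} (hu : M.C u = 0) : M.g u ⬝ᵥ u = 0 := by
  have h := M.expand u u 1 1
  rw [← add_smul, M.C_smul, hu] at h
  apply mul_left_cancel₀ h2
  linear_combination -h

/-- The points of the cubic on the line `l`. -/
def zeros (l : Fin 3 → F) : Finset G := Finset.univ.filter fun P => l ⬝ᵥ M.pt P = 0

/-- The coefficient vectors of lines meeting the cubic in three rational points. -/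
def secants : Finset (Fin 3 → F) := Finset.univ.filter fun l => l ≠ 0 ∧ (M.zeros l).card = 3

variable {M}

lemma mem_zeros {l : Fin 3 → F} {P : G} : P ∈ M.zeros l ↔ l ⬝ᵥ M.pt P = 0 := by
  simp [zeros]

lemma mem_secants {l : Fin 3 → F} : l ∈ M.secants ↔ l ≠ 0 ∧ (M.zeros l).card = 3 := by
  simp [secants]

lemma zeros_smul {c : F} (hc : c ≠ 0) (l : Fin 3 → F) : M.zeros (c • l) = M.zeros l := by
  ext P
  simp [mem_zeros, smul_dotProduct, hc]

lemma pt_cross_ne {P Q : G} (h : P ≠ Q) : M.pt P ⨯₃ M.pt Q ≠ 0 :=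
  cross_ne_zero_of_not_smul (M.pt_ne Q) fun c hc => h (M.inj P Q c hc)

lemma cross_pt_ne {p : Fin 3 → F} (hp : M.C p ≠ 0) (P : G) : p ⨯₃ M.pt P ≠ 0 :=
  cross_ne_zero_of_not_smul (M.pt_ne P) fun c hc => hp (by rw [hc, M.C_smul, M.C_pt, mul_zero])

lemma tangent_coeffs_ne {l : Fin 3 → F} (hl : l ≠ 0) {P Q : G} (h : P ≠ Q) (hP : P ∈ M.zeros l)
    (hQ : Q ∈ M.zeros l) : M.g (M.pt P) ⬝ᵥ M.pt Q ≠ 0 ∨ M.g (M.pt Q) ⬝ᵥ M.pt P ≠ 0 := by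
  by_contra hcon
  push Not at hcon
  obtain ⟨w, hw, hCw⟩ := M.noline l hl
  obtain ⟨a, b, rfl⟩ := exists_mem_span_pair hl (pt_cross_ne h) (mem_zeros.1 hP)
    (mem_zeros.1 hQ) hw
  refine hCw ?_
  rw [M.expand, M.C_pt, M.C_pt, hcon.1, hcon.2]
  ring

lemma third_zero {l : Fin 3 → F} (hl : l ≠ 0) {P Q R : G} (h : P ≠ Q) (hR : R ≠ P) (hR' : R ≠ Q)
    (hP : P ∈ M.zeros l) (hQ : Q ∈ M.zeros l) (hRl : R ∈ M.zeros l) :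
    ∃ c : F, M.pt R =
      c • ((M.g (M.pt Q) ⬝ᵥ M.pt P) • M.pt P - (M.g (M.pt P) ⬝ᵥ M.pt Q) • M.pt Q) := by
  obtain ⟨a, b, hab⟩ := exists_mem_span_pair hl (pt_cross_ne h) (mem_zeros.1 hP)
    (mem_zeros.1 hQ) (mem_zeros.1 hRl)
  have ha : a ≠ 0 := by
    rintro rfl
    exact hR' (M.inj R Q b (by simpa using hab))
  have hb : b ≠ 0 := by
    rintro rfl
    exact hR (M.inj R P a (by simpa using hab))
  have hC := M.C_pt R
  rw [hab, M.expand, M.C_pt, M.C_pt] at hC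
  have hlin : a * (M.g (M.pt P) ⬝ᵥ M.pt Q) + b * (M.g (M.pt Q) ⬝ᵥ M.pt P) = 0 := by
    apply mul_left_cancel₀ (mul_ne_zero ha hb)
    linear_combination hC
  rcases tangent_coeffs_ne hl h hP hQ with h1 | h1
  · refine ⟨-b / (M.g (M.pt P) ⬝ᵥ M.pt Q), ?_⟩
    rw [hab]
    ext j
    simp only [Pi.add_apply, Pi.smul_apply, Pi.sub_apply, smul_eq_mul]
    field_simp
    linear_combination (M.pt P j) * hlin
  · refine ⟨a / (M.g (M.pt Q) ⬝ᵥ M.pt P), ?_⟩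
    rw [hab]
    ext j
    simp only [Pi.add_apply, Pi.smul_apply, Pi.sub_apply, smul_eq_mul]
    field_simp
    linear_combination (M.pt Q j) * hlin

lemma card_zeros_le {l : Fin 3 → F} (hl : l ≠ 0) : (M.zeros l).card ≤ 3 := by
  by_contra hcon
  push Not at hcon
  obtain ⟨t, ht, hcard⟩ := Finset.exists_subset_card_eq (show 4 ≤ (M.zeros l).card from hcon)
  obtain ⟨P, Q, R, S, hPQ, hPR, hPS, hQR, hQS, hRS, rfl⟩ := Finset.card_eq_four.1 hcard
  have hP : P ∈ M.zeros l := ht (by simp)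
  have hQ : Q ∈ M.zeros l := ht (by simp)
  have hR : R ∈ M.zeros l := ht (by simp)
  have hS : S ∈ M.zeros l := ht (by simp)
  obtain ⟨c, hc⟩ := third_zero hl hPQ hPR.symm hQR.symm hP hQ hR
  obtain ⟨d, hd⟩ := third_zero hl hPQ hPS.symm hQS.symm hP hQ hS
  have hd0 : d ≠ 0 := by
    rintro rfl
    exact M.pt_ne S (by rw [hd, zero_smul])
  refine hRS (M.inj R S (c / d) ?_)
  rw [hc, hd, smul_smul, div_mul_cancel₀ _ hd0]

lemma tangent_of_card_eq_two (h2 : (2 : F) ≠ 0) {l : Fin 3 → F} (hl : l ≠ 0)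
    (hc : (M.zeros l).card = 2) :
    ∃ P, P ∈ M.zeros l ∧ ∃ c : F, c ≠ 0 ∧ l = c • M.g (M.pt P) := by
  obtain ⟨P, Q, hPQ, hz⟩ := Finset.card_eq_two.1 hc
  have hP : P ∈ M.zeros l := by rw [hz]; simp
  have hQ : Q ∈ M.zeros l := by rw [hz]; simp
  have key : ∀ P Q : G, P ≠ Q → P ∈ M.zeros l → Q ∈ M.zeros l → M.g (M.pt P) ⬝ᵥ M.pt Q = 0 →
      ∃ P, P ∈ M.zeros l ∧ ∃ c : F, c ≠ 0 ∧ l = c • M.g (M.pt P) := by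
    intro P Q hPQ hP hQ h0
    refine ⟨P, hP, ?_⟩
    obtain ⟨c, hc⟩ := exists_smul_cross (pt_cross_ne hPQ) (g_dot_self M h2 (M.C_pt P)) h0
    obtain ⟨d, hd⟩ := exists_smul_cross (pt_cross_ne hPQ) (mem_zeros.1 hP) (mem_zeros.1 hQ)
    have hc0 : c ≠ 0 := by
      rintro rfl
      exact M.smooth _ (M.pt_ne P) (M.C_pt P) (by rw [hc, zero_smul])
    have hd0 : d ≠ 0 := by
      rintro rfl
      exact hl (by rw [hd, zero_smul])
    refine ⟨d / c, div_ne_zero hd0 hc0, ?_⟩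
    rw [hc, hd, smul_smul, div_mul_cancel₀ _ hc0]
  by_cases h0 : M.g (M.pt P) ⬝ᵥ M.pt Q = 0
  · exact key P Q hPQ hP hQ h0
  by_cases h1 : M.g (M.pt Q) ⬝ᵥ M.pt P = 0
  · exact key Q P hPQ.symm hQ hP h1
  exfalso
  set R := (M.g (M.pt Q) ⬝ᵥ M.pt P) • M.pt P + (-(M.g (M.pt P) ⬝ᵥ M.pt Q)) • M.pt Q with hR
  have hCR : M.C R = 0 := by
    rw [hR, M.expand, M.C_pt, M.C_pt]
    ring
  have hcr : ∀ a b : F, b ≠ 0 → a • M.pt P + b • M.pt Q ≠ 0 := by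
    intro a b hb h
    refine hPQ.symm (M.inj Q P (-a / b) ?_)
    rw [← sub_eq_zero]
    have := congrArg (b⁻¹ • ·) h
    simp only [smul_add, smul_smul, inv_mul_cancel₀ hb, one_smul, smul_zero] at this
    rw [← this, neg_div, neg_smul, sub_neg_eq_add, div_eq_inv_mul, add_comm]
  have hR0 : R ≠ 0 := hcr _ _ (neg_ne_zero.2 h0)
  obtain ⟨S, c, hS⟩ := M.surj R hR0 hCR
  have hc0 : c ≠ 0 := by rintro rfl; exact hR0 (by rw [hS, zero_smul])
  have hSl : S ∈ M.zeros l := by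
    have : l ⬝ᵥ R = 0 := by
      rw [hR, dotProduct_add, dotProduct_smul, dotProduct_smul, mem_zeros.1 hP, mem_zeros.1 hQ]
      simp
    rw [hS, dotProduct_smul, smul_eq_mul] at this
    exact mem_zeros.2 ((mul_eq_zero.1 this).resolve_left hc0)
  rw [hz] at hSl
  rcases Finset.mem_insert.1 hSl with rfl | h
  · refine hcr (M.g (M.pt Q) ⬝ᵥ M.pt S - c) _ (neg_ne_zero.2 h0) ?_
    rw [sub_smul, ← hS, hR]
    abel
  · rw [Finset.mem_singleton] at h
    subst h
    have h3 : (M.g (M.pt S) ⬝ᵥ M.pt P) • M.pt P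
      + (-(M.g (M.pt P) ⬝ᵥ M.pt S) - c) • M.pt S = 0 := by
      rw [sub_smul, ← hS, hR]
      abel
    refine hPQ (M.inj P S ((M.g (M.pt S) ⬝ᵥ M.pt P)⁻¹ * (M.g (M.pt P) ⬝ᵥ M.pt S + c)) ?_)
    have := congrArg ((M.g (M.pt S) ⬝ᵥ M.pt P)⁻¹ • ·) h3
    simp only [smul_add, smul_smul, inv_mul_cancel₀ h1, one_smul, smul_zero] at this
    rw [← sub_eq_zero, ← this, sub_eq_add_neg, ← neg_smul]
    congr 2
    ring

end PlaneModel

end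

section
open Matrix

lemma expander_bound {r N a : ℝ} (hr : 11 ≤ r) (h1 : (r - 1) ^ 2 ≤ N) (h2 : N ≤ (r + 1) ^ 2)
    (ha : (N ^ 2 - 3 * N) / 6 ≤ a) :
    0 < (r ^ 2) ^ 2 + r ^ 2 + 1 - (N ^ 2 - 9 * N) / 6 ∧
    3 * ((r ^ 2) ^ 2 + r ^ 2 + 1) ≤ a * (r ^ 2 + 1) ∧
    0 < a ^ 2 * r ^ 2 - ((r ^ 2) ^ 2 + r ^ 2 + 1) * r ^ 2 * a
      + 9 * ((r ^ 2) ^ 2 + r ^ 2 + 1) * ((N ^ 2 - 9 * N) / 6)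
      - (5 * r ^ 2 + 6) * ((N ^ 2 - 9 * N) / 6) * a + (N ^ 2 - 9 * N) / 6 * a ^ 2 := by
  have hN0 : 0 ≤ N := le_trans (sq_nonneg _) h1
  refine ⟨?_, ?_, ?_⟩
  · have h3 : N ^ 2 ≤ ((r + 1) ^ 2) ^ 2 := by gcongr
    have h4 : ((r + 1) ^ 2) ^ 2 ≤ (r * (12 / 11)) ^ 4 := by
      rw [← pow_mul]
      gcongr
      linarith
    nlinarith [pow_pos (show (0 : ℝ) < r by linarith) 4]
  · obtain ⟨x, rfl⟩ : ∃ x, r = 11 + x := ⟨r - 11, by ring⟩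
    obtain ⟨y, rfl⟩ : ∃ y, N = (11 + x - 1) ^ 2 + y := ⟨N - (11 + x - 1) ^ 2, by ring⟩
    obtain ⟨z, rfl⟩ : ∃ z, a = (((11 + x - 1) ^ 2 + y) ^ 2 - 3 * ((11 + x - 1) ^ 2 + y)) / 6 + z :=
      ⟨a - (((11 + x - 1) ^ 2 + y) ^ 2 - 3 * ((11 + x - 1) ^ 2 + y)) / 6, by ring⟩
    have hx : 0 ≤ x := by linarith
    have hy : 0 ≤ y := by linarith
    have hz : 0 ≤ z := by linarith
    rw [← sub_nonneg]
    ring_nf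
    positivity
  · obtain ⟨x, rfl⟩ : ∃ x, r = 11 + x := ⟨r - 11, by ring⟩
    obtain ⟨y, rfl⟩ : ∃ y, N = (11 + x - 1) ^ 2 + y := ⟨N - (11 + x - 1) ^ 2, by ring⟩
    obtain ⟨z, rfl⟩ : ∃ z, a = (((11 + x - 1) ^ 2 + y) ^ 2 - 3 * ((11 + x - 1) ^ 2 + y)) / 6 + z :=
      ⟨a - (((11 + x - 1) ^ 2 + y) ^ 2 - 3 * ((11 + x - 1) ^ 2 + y)) / 6, by ring⟩
    have hx : 0 ≤ x := by linarith
    have hy : 0 ≤ y := by linarith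
    have hz : 0 ≤ z := by linarith
    ring_nf
    positivity

/-- The Hasse bound in the form of an enclosure by squares. -/
lemma hasse_enclosure {q N : ℕ} (h : ((q : ℤ) + 1 - N) ^ 2 ≤ 4 * q) :
    (√(q : ℝ) - 1) ^ 2 ≤ N ∧ (N : ℝ) ≤ (√(q : ℝ) + 1) ^ 2 := by
  have h' : ((q : ℝ) + 1 - N) ^ 2 ≤ 4 * q := by exact_mod_cast h
  have hs : √(q : ℝ) ^ 2 = q := Real.sq_sqrt (Nat.cast_nonneg q)
  have h4 : ((q : ℝ) + 1 - N) ^ 2 ≤ (2 * √(q : ℝ)) ^ 2 := by rw [mul_pow, hs]; linarith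
  have := abs_le_of_sq_le_sq' h4 (by positivity)
  constructor <;> nlinarith [this.1, this.2]

lemma hasse_lower {q N : ℕ} (hq : 121 ≤ q) (h : ((q : ℤ) + 1 - N) ^ 2 ≤ 4 * q) : 100 ≤ N := by
  have h1 := (hasse_enclosure h).1
  have h2 : (11 : ℝ) ≤ √(q : ℝ) := by
    apply Real.le_sqrt_of_sq_le
    have : (121 : ℝ) ≤ q := by exact_mod_cast hq
    linarith
  have : (100 : ℝ) ≤ N := by nlinarith
  exact_mod_cast this

namespace PlaneModel
variable {F G : Type} [Field F] [Fintype F] [DecidableEq F] [Fintype G] [DecidableEq G]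
  {M M' : PlaneModel F G}

lemma card_lines_through_pair {v w : Fin 3 → F} (h : v ⨯₃ w ≠ 0) :
    (Finset.univ.filter fun l : Fin 3 → F => l ≠ 0 ∧ l ⬝ᵥ v = 0 ∧ l ⬝ᵥ w = 0).card
      = Fintype.card F - 1 := by
  rw [← card_orthogonal_pair h, ← Finset.card_erase_of_mem (a := (0 : Fin 3 → F)) (by simp)]
  congr 1
  ext l
  simp

lemma card_secants_ge (h2 : (2 : F) ≠ 0) :
    (Fintype.card F - 1) * (Fintype.card G * Fintype.card G) ≤
      6 * M.secants.card + (Fintype.card F - 1) * (3 * Fintype.card G) := by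
  have hsum : ∑ l ∈ Finset.univ.filter (fun l : Fin 3 → F => l ≠ 0), (M.zeros l).offDiag.card
      = (Finset.univ : Finset G).offDiag.card * (Fintype.card F - 1) := by
    have : ∀ l : Fin 3 → F, (M.zeros l).offDiag.card
        = ((Finset.univ : Finset G).offDiag.filter
          (fun x => l ⬝ᵥ M.pt x.1 = 0 ∧ l ⬝ᵥ M.pt x.2 = 0)).card := by
      intro l
      congr 1
      ext x
      simp only [Finset.mem_offDiag, mem_zeros, Finset.mem_filter, Finset.mem_univ, true_and]
      tauto
    simp_rw [this]
    refine (Finset.sum_card_bipartiteAbove_eq_sum_card_bipartiteBelow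
      (fun (l : Fin 3 → F) (x : G × G) => l ⬝ᵥ M.pt x.1 = 0 ∧ l ⬝ᵥ M.pt x.2 = 0)).trans ?_
    rw [Finset.card_eq_sum_ones, Finset.sum_mul]
    refine Finset.sum_congr rfl fun x hx => ?_
    rw [one_mul, ← card_lines_through_pair (pt_cross_ne (M := M) (Finset.mem_offDiag.1 hx).2.2)]
    congr 1
    ext l
    simp [Finset.bipartiteBelow]
  have hle : ∑ l ∈ Finset.univ.filter (fun l : Fin 3 → F => l ≠ 0), (M.zeros l).offDiag.card
      ≤ 6 * M.secants.card + 2 * (Fintype.card G * (Fintype.card F - 1)) := by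
    have hb : ∀ l ∈ Finset.univ.filter (fun l : Fin 3 → F => l ≠ 0), (M.zeros l).offDiag.card ≤
        (if l ∈ M.secants then 6 else 0)
          + (if l ∈ (Finset.univ : Finset G).biUnion (fun P => nzMultiples (M.g (M.pt P)))
              then 2 else 0) := by
      intro l hl
      simp only [Finset.mem_filter, Finset.mem_univ, true_and] at hl
      have h3 := card_zeros_le (M := M) hl
      rw [Finset.offDiag_card]
      rcases Nat.lt_or_ge (M.zeros l).card 2 with h | h
      · interval_cases (M.zeros l).card <;> simp
      rcases h.eq_or_lt with h | h
      · obtain ⟨P, -, c, hc0, hc⟩ := tangent_of_card_eq_two h2 hl h.symm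
        have : l ∈ (Finset.univ : Finset G).biUnion (fun P => nzMultiples (M.g (M.pt P))) :=
          Finset.mem_biUnion.2 ⟨P, Finset.mem_univ _, mem_nzMultiples.2 ⟨c, hc0, hc⟩⟩
        rw [if_pos this, ← h]
        simp
      · have h3' : (M.zeros l).card = 3 := by omega
        rw [if_pos (mem_secants.2 ⟨hl, h3'⟩), h3']
        simp
    refine (Finset.sum_le_sum hb).trans ?_
    rw [Finset.sum_add_distrib]
    apply add_le_add
    · rw [← Finset.sum_filter, Finset.sum_const, smul_eq_mul, mul_comm]
      exact Nat.mul_le_mul_left _ (Finset.card_le_card fun l hl => (Finset.mem_filter.1 hl).2)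
    · rw [← Finset.sum_filter, Finset.sum_const, smul_eq_mul, mul_comm]
      refine Nat.mul_le_mul_left _ ?_
      refine (Finset.card_le_card fun l hl => (Finset.mem_filter.1 hl).2).trans ?_
      exact Finset.card_biUnion_le_card_mul _ _ _ fun P _ => card_nzMultiples_le _
  rw [hsum, Finset.offDiag_card, Finset.card_univ, Nat.sub_mul] at hle
  have e1 : Fintype.card G * Fintype.card G * (Fintype.card F - 1)
    = (Fintype.card F - 1) * (Fintype.card G * Fintype.card G) := by ring
  have e2 : Fintype.card G * (Fintype.card F - 1)
    = (Fintype.card F - 1) * Fintype.card G := by ring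
  have e3 : (Fintype.card F - 1) * (3 * Fintype.card G)
    = 3 * ((Fintype.card F - 1) * Fintype.card G) := by ring
  rw [e1, e2] at hle
  rw [e3]
  omega

lemma card_secants_through_le (P : G) :
    2 * (M.secants.filter fun l => P ∈ M.zeros l).card
      ≤ (Fintype.card G - 1) * (Fintype.card F - 1) := by
  have h1 : ∑ l ∈ M.secants.filter (fun l => P ∈ M.zeros l), ((M.zeros l).erase P).card
      = 2 * (M.secants.filter fun l => P ∈ M.zeros l).card := by
    rw [Finset.sum_const_nat (m := 2), mul_comm]
    intro l hl
    rw [Finset.mem_filter, mem_secants] at hl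
    rw [Finset.card_erase_of_mem hl.2, hl.1.2]
  have h2 : ∀ l, (M.zeros l).erase P
      = Finset.bipartiteAbove (fun (l : Fin 3 → F) (Q : G) => l ⬝ᵥ M.pt Q = 0)
        ((Finset.univ : Finset G).erase P) l := by
    intro l
    ext Q
    simp [Finset.bipartiteAbove, mem_zeros]
  rw [← h1]
  simp_rw [h2]
  rw [Finset.sum_card_bipartiteAbove_eq_sum_card_bipartiteBelow]
  rw [← Finset.card_univ (α := G), ← Finset.card_erase_of_mem (Finset.mem_univ P),
    ← smul_eq_mul]
  refine Finset.sum_le_card_nsmul _ _ _ fun Q hQ => ?_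
  rw [← card_lines_through_pair (pt_cross_ne (M := M) (Finset.ne_of_mem_erase hQ))]
  refine Finset.card_le_card fun l hl => ?_
  simp only [Finset.bipartiteBelow, Finset.mem_filter, mem_secants, mem_zeros, Finset.mem_univ,
    true_and] at hl ⊢
  exact ⟨hl.1.1.1, hl.2, hl.1.2⟩

lemma exists_disjoint_secant (h2 : (2 : F) ≠ 0) (hN : 12 ≤ Fintype.card G) (Z : Finset G)
    (hZ : Z.card ≤ 3) : ∃ m ∈ M.secants, Disjoint Z (M.zeros m) := by
  by_contra hcon
  push Not at hcon
  have hsub : M.secants ⊆ Z.biUnion fun P => M.secants.filter fun l => P ∈ M.zeros l := by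
    intro m hm
    obtain ⟨P, hP, hPm⟩ := Finset.not_disjoint_iff.1 (hcon m hm)
    exact Finset.mem_biUnion.2 ⟨P, hP, Finset.mem_filter.2 ⟨hm, hPm⟩⟩
  have h3 : 2 * M.secants.card ≤ 3 * ((Fintype.card G - 1) * (Fintype.card F - 1)) := by
    calc 2 * M.secants.card
        ≤ 2 * ∑ P ∈ Z, (M.secants.filter fun l => P ∈ M.zeros l).card :=
          Nat.mul_le_mul_left _ ((Finset.card_le_card hsub).trans Finset.card_biUnion_le)
      _ = ∑ P ∈ Z, 2 * (M.secants.filter fun l => P ∈ M.zeros l).card := Finset.mul_sum _ _ _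
      _ ≤ Z.card • ((Fintype.card G - 1) * (Fintype.card F - 1)) :=
          Finset.sum_le_card_nsmul _ _ _ fun P _ => card_secants_through_le P
      _ ≤ 3 * ((Fintype.card G - 1) * (Fintype.card F - 1)) := by
          rw [smul_eq_mul]; exact Nat.mul_le_mul_right _ hZ
  have h4 := card_secants_ge (M := M) h2
  obtain ⟨k, hk⟩ : ∃ k, Fintype.card F = k + 2 :=
    ⟨Fintype.card F - 2, by have := Fintype.one_lt_card (α := F); omega⟩
  obtain ⟨j, hj⟩ : ∃ j, Fintype.card G = j + 12 := ⟨Fintype.card G - 12, by omega⟩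
  rw [hj, hk] at h3 h4
  simp only [show k + 2 - 1 = k + 1 by omega, show j + 12 - 1 = j + 11 by omega] at h3 h4
  nlinarith

/-- The members of a family of lines that are conjugate to `l` under `β`. -/
def conjugates (A : Finset (Fin 3 → F)) (β : Matrix (Fin 3) (Fin 3) F) (l : Fin 3 → F) :
    Finset (Fin 3 → F) := A.filter fun m => l ⬝ᵥ β *ᵥ m = 0

lemma mulVec_ne_zero {β : Matrix (Fin 3) (Fin 3) F} (hβ : β.det ≠ 0) {m : Fin 3 → F}
    (hm : m ≠ 0) : β *ᵥ m ≠ 0 := fun h => hm (Matrix.eq_zero_of_mulVec_eq_zero hβ h)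

lemma sum_card_conjugates {A : Finset (Fin 3 → F)} (hA : ∀ m ∈ A, m ≠ 0)
    {β : Matrix (Fin 3) (Fin 3) F} (hβ : β.det ≠ 0) :
    ∑ l, (conjugates A β l).card = A.card * Fintype.card F ^ 2 := by
  refine (Finset.sum_card_bipartiteAbove_eq_sum_card_bipartiteBelow
      (fun (l m : Fin 3 → F) => l ⬝ᵥ β *ᵥ m = 0)).trans ?_
  refine Finset.sum_const_nat fun m hm => ?_
  exact card_orthogonal (mulVec_ne_zero hβ (hA m hm))

lemma sum_card_conjugates_sq {A : Finset (Fin 3 → F)} (hA : ∀ m ∈ A, m ≠ 0)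
    {β : Matrix (Fin 3) (Fin 3) F} (hβ : β.det ≠ 0) :
    ∑ l, (conjugates A β l).card ^ 2 ≤ A.card * (A.card * Fintype.card F
      + (Fintype.card F - 1) * (Fintype.card F ^ 2 - Fintype.card F)) := by
  have h1 : ∀ l, (conjugates A β l).card ^ 2
      = (Finset.bipartiteAbove (fun (l : Fin 3 → F) (x : (Fin 3 → F) × (Fin 3 → F)) =>
        l ⬝ᵥ β *ᵥ x.1 = 0 ∧ l ⬝ᵥ β *ᵥ x.2 = 0) (A ×ˢ A) l).card := by
    intro l
    rw [sq, ← Finset.card_product]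
    congr 1
    ext x
    simp only [conjugates, Finset.bipartiteAbove, Finset.mem_product, Finset.mem_filter]
    tauto
  simp_rw [h1]
  rw [Finset.sum_card_bipartiteAbove_eq_sum_card_bipartiteBelow, Finset.sum_product,
    ← smul_eq_mul (a := A.card)]
  refine Finset.sum_le_card_nsmul _ _ _ fun m hm => ?_
  have hq : Fintype.card F ≤ Fintype.card F ^ 2 := Nat.le_self_pow (by norm_num) _
  calc _ ≤ ∑ m' ∈ A, (Fintype.card F + if m' ∈ nzMultiples m then
        Fintype.card F ^ 2 - Fintype.card F else 0) := by
        refine Finset.sum_le_sum fun m' hm' => ?_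
        simp only [Finset.bipartiteBelow]
        by_cases hc : (β *ᵥ m) ⨯₃ (β *ᵥ m') = 0
        · obtain ⟨c, hc⟩ := exists_smul_of_cross_eq_zero (mulVec_ne_zero hβ (hA m' hm')) hc
          have hc0 : c ≠ 0 := by
            rintro rfl
            exact mulVec_ne_zero hβ (hA m hm) (by rw [hc, zero_smul])
          have hmm : m = c • m' := by
            rw [← sub_eq_zero]
            apply Matrix.eq_zero_of_mulVec_eq_zero hβ
            rw [mulVec_sub, mulVec_smul, hc, sub_self]
          rw [if_pos (mem_nzMultiples.2 ⟨c⁻¹, inv_ne_zero hc0, by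
            rw [hmm, smul_smul, inv_mul_cancel₀ hc0, one_smul]⟩), Nat.add_sub_cancel' hq,
            ← card_orthogonal (mulVec_ne_zero hβ (hA m hm))]
          refine Finset.card_le_card fun l hl => ?_
          simp only [Finset.mem_filter, Finset.mem_univ, true_and] at hl ⊢
          exact hl.1
        · rw [card_orthogonal_pair hc]
          exact Nat.le_add_right _ _
    _ ≤ _ := by
        rw [Finset.sum_add_distrib, Finset.sum_const, smul_eq_mul, ← Finset.sum_filter,
          Finset.sum_const, smul_eq_mul]
        refine Nat.add_le_add_left (Nat.mul_le_mul_right _ ?_) _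
        exact (Finset.card_le_card fun l hl => (Finset.mem_filter.1 hl).2).trans
          (card_nzMultiples_le m)

lemma card_conjugates_secants_le {β : Matrix (Fin 3) (Fin 3) F} {l : Fin 3 → F}
    (hl : l ∈ M.secants) (hP : ∀ P, (β.transpose *ᵥ l) ⨯₃ M'.pt P ≠ 0)
    (hcon : ∀ m ∈ M'.secants, l ⬝ᵥ β *ᵥ m = 0 → ¬ Disjoint (M.zeros l) (M'.zeros m)) :
    (conjugates M'.secants β l).card ≤ 3 * (Fintype.card F - 1) := by
  have hsub : conjugates M'.secants β l ⊆ (M.zeros l).biUnion fun P =>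
      Finset.univ.filter fun m : Fin 3 → F =>
        m ≠ 0 ∧ m ⬝ᵥ (β.transpose *ᵥ l) = 0 ∧ m ⬝ᵥ M'.pt P = 0 := by
    intro m hm
    rw [conjugates, Finset.mem_filter] at hm
    obtain ⟨P, hPl, hPm⟩ := Finset.not_disjoint_iff.1 (hcon m hm.1 hm.2)
    refine Finset.mem_biUnion.2 ⟨P, hPl, ?_⟩
    simp only [Finset.mem_filter, Finset.mem_univ, true_and]
    refine ⟨(mem_secants.1 hm.1).1, ?_, mem_zeros.1 hPm⟩
    rw [← hm.2, mulVec_transpose, dotProduct_comm, dotProduct_mulVec]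
  refine (Finset.card_le_card hsub).trans ?_
  have := Finset.card_biUnion_le_card_mul (M.zeros l) (fun P =>
      Finset.univ.filter fun m : Fin 3 → F =>
        m ≠ 0 ∧ m ⬝ᵥ (β.transpose *ᵥ l) = 0 ∧ m ⬝ᵥ M'.pt P = 0) _
    fun P _ => (card_lines_through_pair (hP P)).le
  rwa [(mem_secants.1 hl).2] at this

lemma card_conjugate_to_point_le {β : Matrix (Fin 3) (Fin 3) F} (hβ : β.det ≠ 0) :
    (Finset.univ.filter fun l : Fin 3 → F => l ≠ 0 ∧
      ∃ P, (β.transpose *ᵥ l) ⨯₃ M.pt P = 0).card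
        ≤ Fintype.card G * (Fintype.card F - 1) := by
  have hβ' : β.transpose.det ≠ 0 := by rwa [det_transpose]
  have hinj : Function.Injective fun l : Fin 3 → F => β.transpose *ᵥ l := by
    intro x y hxy
    rw [← sub_eq_zero]
    apply Matrix.eq_zero_of_mulVec_eq_zero hβ'
    rw [mulVec_sub, sub_eq_zero]
    exact hxy
  rw [← Finset.card_image_of_injective _ hinj]
  refine (Finset.card_le_card (t := Finset.univ.biUnion fun P => nzMultiples (M.pt P)) ?_).trans
    (Finset.card_biUnion_le_card_mul _ _ _ fun P _ => card_nzMultiples_le _)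
  intro w hw
  simp only [Finset.mem_image, Finset.mem_filter, Finset.mem_univ, true_and] at hw
  obtain ⟨l, ⟨hl, P, hP⟩, rfl⟩ := hw
  obtain ⟨c, hc⟩ := exists_smul_of_cross_eq_zero (M.pt_ne P) hP
  refine Finset.mem_biUnion.2 ⟨P, Finset.mem_univ _, mem_nzMultiples.2 ⟨c, ?_, hc⟩⟩
  rintro rfl
  exact mulVec_ne_zero hβ' hl (by rw [hc, zero_smul])

set_option maxHeartbeats 1000000 in
/-- For a nondegenerate pairing, there are conjugate secants of two models with disjoint sets of
points. -/
theorem exists_conjugate_secants (h2 : (2 : F) ≠ 0) (hq : 121 ≤ Fintype.card F)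
    (hN : ((Fintype.card F : ℤ) + 1 - Fintype.card G) ^ 2 ≤ 4 * Fintype.card F)
    (M M' : PlaneModel F G) {β : Matrix (Fin 3) (Fin 3) F} (hβ : β.det ≠ 0) :
    ∃ l ∈ M.secants, ∃ m ∈ M'.secants, Disjoint (M.zeros l) (M'.zeros m)
      ∧ l ⬝ᵥ β *ᵥ m = 0 := by
  by_contra hcon
  push Not at hcon
  set q := Fintype.card F with hqdef
  set N := Fintype.card G with hNdef
  set r : ℝ := √(q : ℝ) with hr
  have hr2 : r ^ 2 = q := Real.sq_sqrt (Nat.cast_nonneg q)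
  have hr11 : 11 ≤ r := by
    apply Real.le_sqrt_of_sq_le
    have : (121 : ℝ) ≤ q := by exact_mod_cast hq
    linarith
  obtain ⟨hN1, hN2⟩ := hasse_enclosure hN
  set t : ℝ := (q : ℝ) - 1 with ht
  have ht0 : 0 < t := by
    have : (121 : ℝ) ≤ q := by exact_mod_cast hq
    rw [ht]; linarith
  have hcast : ((q - 1 : ℕ) : ℝ) = t := by
    rw [Nat.cast_sub (by omega)]; simp [ht]
  set A' := M'.secants with hA'
  have hA'0 : ∀ m ∈ A', m ≠ 0 := fun m hm => (mem_secants.1 hm).1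
  set a : ℝ := A'.card / t with ha
  have hAa : (A'.card : ℝ) = a * t := by rw [ha, div_mul_cancel₀ _ ht0.ne']
  have hbound : ∀ M : PlaneModel F G, t * (N ^ 2 - 3 * N) / 6 ≤ (M.secants.card : ℝ) := by
    intro M
    have := card_secants_ge (M := M) h2
    have h' : (((q - 1 : ℕ) * (N * N) : ℕ) : ℝ) ≤
        ((6 * M.secants.card + (q - 1 : ℕ) * (3 * N) : ℕ) : ℝ) := by exact_mod_cast this
    push_cast [hcast] at h'
    linarith
  have haN : ((N : ℝ) ^ 2 - 3 * N) / 6 ≤ a := by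
    rw [ha, le_div_iff₀ ht0]
    have := hbound M'
    linarith
  set A1 := M.secants.filter fun l => ∀ P, (β.transpose *ᵥ l) ⨯₃ M'.pt P ≠ 0 with hA1
  have hA1card : t * ((N ^ 2 - 9 * N) / 6) ≤ (A1.card : ℝ) := by
    have h3 : M.secants.card ≤ A1.card + N * (q - 1) := by
      rw [← Finset.card_filter_add_card_filter_not (s := M.secants)
        (fun l => ∀ P, (β.transpose *ᵥ l) ⨯₃ M'.pt P ≠ 0)]
      refine Nat.add_le_add_left ?_ _
      refine (Finset.card_le_card fun l hl => ?_).trans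
        (card_conjugate_to_point_le (M := M') hβ)
      simp only [Finset.mem_filter, Finset.mem_univ, true_and] at hl ⊢
      refine ⟨(mem_secants.1 hl.1).1, ?_⟩
      have := hl.2
      push Not at this
      exact this
    have h' : (M.secants.card : ℝ) ≤ ((A1.card + N * (q - 1 : ℕ) : ℕ) : ℝ) := by
      exact_mod_cast h3
    push_cast at h'
    rw [hcast] at h'
    have := hbound M
    linarith
  obtain ⟨hT, hS, hΦ⟩ := expander_bound hr11 hN1 hN2 haN
  rw [hr2] at hT hS hΦ
  set a0 : ℝ := ((N : ℝ) ^ 2 - 9 * N) / 6 with ha0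
  set V : ℝ := (q : ℝ) ^ 2 + q + 1 with hV
  set e : (Fin 3 → F) → ℝ := fun l => (conjugates A' β l).card / t with he
  have he0 : e 0 = a := by
    simp [he, conjugates, ha]
  have hsum1 : ∑ l, e l = a * q ^ 2 := by
    rw [he, ← Finset.sum_div, ← Nat.cast_sum, sum_card_conjugates hA'0 hβ]
    push_cast
    rw [hAa, ← hqdef]
    field_simp
  have hsum2 : ∑ l, e l ^ 2 ≤ a * (a * q + q * t) := by
    have h3 := sum_card_conjugates_sq hA'0 hβ
    rw [← hqdef] at h3
    have h' : ((∑ l, (conjugates A' β l).card ^ 2 : ℕ) : ℝ)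
        ≤ ((A'.card * (A'.card * q + (q - 1) * (q ^ 2 - q)) : ℕ) : ℝ) := by exact_mod_cast h3
    rw [Nat.cast_mul, Nat.cast_add, Nat.cast_mul, Nat.cast_mul, hcast,
      Nat.cast_sub (Nat.le_self_pow (by norm_num) _), hAa] at h'
    push_cast at h'
    simp only [he, div_pow]
    rw [← Finset.sum_div, div_le_iff₀ (by positivity)]
    refine h'.trans (le_of_eq ?_)
    rw [ht]
    ring
  have hcardV : (Fintype.card (Fin 3 → F) : ℝ) = t * V + 1 := by
    rw [Fintype.card_fun, Fintype.card_fin, ← hqdef, ht, hV]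
    push_cast
    ring
  have key : ∀ c : ℝ, 3 ≤ c → a0 * (c - 3) ^ 2 ≤
      a ^ 2 + a * q - 2 * c * a * (q + 1) + c ^ 2 * V := by
    intro c hc
    have h3 : ∑ l ∈ A1, (c - 3) ^ 2 ≤ ∑ l ∈ Finset.univ.erase 0, (e l - c) ^ 2 := by
      refine (Finset.sum_le_sum fun l hl => ?_).trans
        (Finset.sum_le_sum_of_subset_of_nonneg (t := Finset.univ.erase 0) (s := A1) ?_
          fun _ _ _ => sq_nonneg _)
      · rw [hA1, Finset.mem_filter] at hl
        have h4 : e l ≤ 3 := by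
          rw [he, div_le_iff₀ ht0, ← hcast]
          exact_mod_cast card_conjugates_secants_le hl.1 hl.2 (fun m hm h0 hd =>
            hcon l hl.1 m hm hd h0)
        rw [← neg_sub c (e l), neg_sq]
        exact pow_le_pow_left₀ (by linarith) (by linarith) 2
      · intro l hl
        rw [hA1, Finset.mem_filter] at hl
        exact Finset.mem_erase.2 ⟨(mem_secants.1 hl.1).1, Finset.mem_univ _⟩
    rw [Finset.sum_const, nsmul_eq_mul] at h3
    have h5 : ∑ l, (e l - c) ^ 2 = ∑ l, e l ^ 2 - 2 * c * ∑ l, e l + (t * V + 1) * c ^ 2 := by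
      rw [← hcardV, ← Finset.card_univ, Finset.mul_sum, ← Finset.sum_sub_distrib,
        ← nsmul_eq_mul, ← Finset.sum_const, ← Finset.sum_add_distrib]
      exact Finset.sum_congr rfl fun l _ => by ring
    have h6 := Finset.sum_erase_add Finset.univ (fun l => (e l - c) ^ 2)
      (Finset.mem_univ (0 : Fin 3 → F))
    simp only [he0] at h6
    have h7 : t * a0 * (c - 3) ^ 2 ≤ A1.card * (c - 3) ^ 2 := by gcongr
    have h8 : t * (a0 * (c - 3) ^ 2)
        ≤ t * (a ^ 2 + a * q - 2 * c * a * (q + 1) + c ^ 2 * V) := by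
      rw [h5, hsum1] at h6
      have h9 : t * (a ^ 2 + a * q - 2 * c * a * (q + 1) + c ^ 2 * V)
        = a * (a * q + q * t) - 2 * c * (a * q ^ 2) + (t * V + 1) * c ^ 2 - (a - c) ^ 2 := by
        rw [ht]; ring
      rw [h9]
      linarith
    exact le_of_mul_le_mul_left h8 ht0
  have hc3 : 3 ≤ (a * (q + 1) - 3 * a0) / (V - a0) := by
    rw [le_div_iff₀ hT]
    linarith
  have h10 := key _ hc3
  have h11 : (a * (q + 1) - 3 * a0) / (V - a0) * (V - a0) = a * (q + 1) - 3 * a0 :=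
    div_mul_cancel₀ _ hT.ne'
  generalize (a * (q + 1) - 3 * a0) / (V - a0) = c at *
  have h12 : 0 ≤ (V - a0) * (a ^ 2 + a * q - 2 * c * a * (q + 1) + c ^ 2 * V - a0 * (c - 3) ^ 2) :=
    mul_nonneg hT.le (sub_nonneg.2 h10)
  have h13 : (V - a0) * (a ^ 2 + a * q - 2 * c * a * (q + 1) + c ^ 2 * V - a0 * (c - 3) ^ 2)
      = (V - a0) * (a ^ 2 + a * q - 9 * a0) - (a * (q + 1) - 3 * a0) ^ 2 := by
    rw [← h11]
    linear_combination (2 * c * (V - a0)) * h11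
  rw [h13, hV] at h12
  rw [hV] at hΦ
  linarith

end PlaneModel

end

section
open Matrix

lemma exists_cubicDisc_coeffs {F : Type} [Field F] (k a₀ a₁ b₀ b₁ b₂ e₀ e₁ e₂ e₃ : F) :
    ∃ d : Fin 7 → F, (∀ t : F, ∑ i : Fin 7, d i * t ^ (i : ℕ) = cubicDisc k (a₀ + a₁ * t)
        (b₀ + b₁ * t + b₂ * t ^ 2) (e₀ + e₁ * t + e₂ * t ^ 2 + e₃ * t ^ 3))
      ∧ d 6 = cubicDisc k a₁ b₂ e₃ ∧ (b₂ = 0 → e₃ = 0 → d 5 = -4 * a₁ ^ 3 * e₂) := by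
  refine ⟨![-4 * a₀ ^ 3 * e₀ + a₀ ^ 2 * b₀ ^ 2 + 18 * a₀ * b₀ * e₀ * k - 4 * b₀ ^ 3 * k - 27 * e₀ ^ 2
      * k ^ 2,
    -4 * a₀ ^ 3 * e₁ - 12 * a₀ ^ 2 * a₁ * e₀ + 2 * a₀ ^ 2 * b₀ * b₁ + 2 * a₀ * a₁ * b₀ ^ 2 +
      18 * a₀ * b₀ * e₁ * k + 18 * a₀ * b₁ * e₀ * k + 18 * a₁ * b₀ * e₀ * k - 12 * b₀ ^ 2 * b₁ *
      k - 54 * e₀ * e₁ * k ^ 2,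
    -4 * a₀ ^ 3 * e₂ - 12 * a₀ ^ 2 * a₁ * e₁ + 2 * a₀ ^ 2 * b₀ * b₂ + a₀ ^ 2 * b₁ ^ 2 - 12 *
      a₀ * a₁ ^ 2 * e₀ + 4 * a₀ * a₁ * b₀ * b₁ + 18 * a₀ * b₀ * e₂ * k + 18 * a₀ * b₁ * e₁ * k +
      18 * a₀ * b₂ * e₀ * k + a₁ ^ 2 * b₀ ^ 2 + 18 * a₁ * b₀ * e₁ * k + 18 * a₁ * b₁ * e₀ * k -
      12 * b₀ ^ 2 * b₂ * k - 12 * b₀ * b₁ ^ 2 * k - 54 * e₀ * e₂ * k ^ 2 - 27 * e₁ ^ 2 * k ^ 2,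
    -4 * a₀ ^ 3 * e₃ - 12 * a₀ ^ 2 * a₁ * e₂ + 2 * a₀ ^ 2 * b₁ * b₂ - 12 * a₀ * a₁ ^ 2 * e₁ +
      4 * a₀ * a₁ * b₀ * b₂ + 2 * a₀ * a₁ * b₁ ^ 2 + 18 * a₀ * b₀ * e₃ * k + 18 * a₀ * b₁ * e₂ *
      k + 18 * a₀ * b₂ * e₁ * k - 4 * a₁ ^ 3 * e₀ + 2 * a₁ ^ 2 * b₀ * b₁ + 18 * a₁ * b₀ * e₂ * k
      + 18 * a₁ * b₁ * e₁ * k + 18 * a₁ * b₂ * e₀ * k - 24 * b₀ * b₁ * b₂ * k - 4 * b₁ ^ 3 * k -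
      54 * e₀ * e₃ * k ^ 2 - 54 * e₁ * e₂ * k ^ 2,
    -12 * a₀ ^ 2 * a₁ * e₃ + a₀ ^ 2 * b₂ ^ 2 - 12 * a₀ * a₁ ^ 2 * e₂ + 4 * a₀ * a₁ * b₁ * b₂ +
      18 * a₀ * b₁ * e₃ * k + 18 * a₀ * b₂ * e₂ * k - 4 * a₁ ^ 3 * e₁ + 2 * a₁ ^ 2 * b₀ * b₂ +
      a₁ ^ 2 * b₁ ^ 2 + 18 * a₁ * b₀ * e₃ * k + 18 * a₁ * b₁ * e₂ * k + 18 * a₁ * b₂ * e₁ * k -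
      12 * b₀ * b₂ ^ 2 * k - 12 * b₁ ^ 2 * b₂ * k - 54 * e₁ * e₃ * k ^ 2 - 27 * e₂ ^ 2 * k ^ 2,
    -12 * a₀ * a₁ ^ 2 * e₃ + 2 * a₀ * a₁ * b₂ ^ 2 + 18 * a₀ * b₂ * e₃ * k - 4 * a₁ ^ 3 * e₂ +
      2 * a₁ ^ 2 * b₁ * b₂ + 18 * a₁ * b₁ * e₃ * k + 18 * a₁ * b₂ * e₂ * k - 12 * b₁ * b₂ ^ 2 *
      k - 54 * e₂ * e₃ * k ^ 2,
    -4 * a₁ ^ 3 * e₃ + a₁ ^ 2 * b₂ ^ 2 + 18 * a₁ * b₂ * e₃ * k - 4 * b₂ ^ 3 * k - 27 * e₃ ^ 2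
      * k ^ 2], ?_, ?_, ?_⟩
  · intro t
    simp only [Fin.sum_univ_succ, cubicDisc]
    simp [Fin.succ]
    ring
  · simp [cubicDisc]
    ring
  · rintro rfl rfl
    simp

namespace PlaneModel
variable {F G : Type} [Field F] [Fintype F] [DecidableEq F] [Fintype G] [DecidableEq G]
  {M M' : PlaneModel F G}

lemma two_mul_g_dot (x y : Fin 3 → F) :
    2 * (M.g x ⬝ᵥ y) = M.C (x + y) - M.C (x - y) - 2 * M.C y := by
  have h1 := M.expand x y 1 1
  have h3 := M.expand x y 1 (-1)
  rw [one_smul, one_smul] at h1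
  rw [one_smul, neg_smul, one_smul, ← sub_eq_add_neg] at h3
  rw [h1, h3]
  ring

lemma g_dot (h2 : (2 : F) ≠ 0) (u v : Fin 3 → F) (a b c d : F) :
    M.g (a • u + b • v) ⬝ᵥ (c • u + d • v) = 3 * a ^ 2 * c * M.C u
      + (2 * a * b * c + a ^ 2 * d) * (M.g u ⬝ᵥ v) + (b ^ 2 * c + 2 * a * b * d) * (M.g v ⬝ᵥ u)
      + 3 * b ^ 2 * d * M.C v := by
  apply mul_left_cancel₀ h2
  rw [two_mul_g_dot, show a • u + b • v + (c • u + d • v) = (a + c) • u + (b + d) • v by module,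
    show a • u + b • v - (c • u + d • v) = (a - c) • u + (b - d) • v by module,
    M.expand, M.expand, M.expand]
  ring

lemma g_line_dot (h2 : (2 : F) ≠ 0) (r₀ r₁ p : Fin 3 → F) (t : F) :
    M.g (r₀ + t • r₁) ⬝ᵥ p = M.g r₀ ⬝ᵥ p
      + (M.g (r₀ + p) ⬝ᵥ r₁ - M.g (r₀ - p) ⬝ᵥ r₁) / 2 * t + (M.g r₁ ⬝ᵥ p) * t ^ 2 := by
  apply mul_left_cancel₀ h2
  have e1 := M.expand (r₀ + p) r₁ 1 t
  have e2 := M.expand (r₀ - p) r₁ 1 t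
  rw [two_mul_g_dot, show r₀ + t • r₁ + p = (1 : F) • (r₀ + p) + t • r₁ by module,
    show r₀ + t • r₁ - p = (1 : F) • (r₀ - p) + t • r₁ by module, e1, e2]
  rw [dotProduct_add, dotProduct_sub]
  have e3 := two_mul_g_dot (M := M) r₀ p
  field_simp
  linear_combination -e3

/-- The discriminant of the cubic form restricted to the line through two points. -/
def lineDisc (M : PlaneModel F G) (p r : Fin 3 → F) : F :=
  cubicDisc (M.C p) (M.g p ⬝ᵥ r) (M.g r ⬝ᵥ p) (M.C r)

lemma lineDisc_change (h2 : (2 : F) ≠ 0) (u v : Fin 3 → F) (a b c d : F) :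
    M.lineDisc (a • u + b • v) (c • u + d • v) = (a * d - b * c) ^ 6 * M.lineDisc u v := by
  rw [lineDisc, lineDisc, g_dot h2, g_dot h2, M.expand, M.expand, cubicDisc, cubicDisc]
  ring

lemma lineDisc_of_secant {p r : Fin 3 → F} (hp : M.C p ≠ 0) (hpr : p ⨯₃ r ≠ 0)
    (h : p ⨯₃ r ∈ M.secants) : M.lineDisc p r ≠ 0 ∧ IsSquare (M.lineDisc p r) := by
  obtain ⟨-, h3⟩ := mem_secants.1 h
  obtain ⟨P, Q, R, hPQ, hPR, hQR, hz⟩ := Finset.card_eq_three.1 h3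
  have key : ∀ S ∈ M.zeros (p ⨯₃ r), ∃ x b : F, M.pt S = b • (x • p + r) ∧
      M.C p * x ^ 3 + (M.g p ⬝ᵥ r) * x ^ 2 + (M.g r ⬝ᵥ p) * x + M.C r = 0 := by
    intro S hS
    obtain ⟨a, b, hab⟩ := exists_mem_span_pair hpr hpr
      (by rw [dotProduct_comm, dot_self_cross]) (by rw [dotProduct_comm, dot_cross_self])
      (mem_zeros.1 hS)
    have hb : b ≠ 0 := by
      rintro rfl
      have h0 := M.C_pt S
      have h1 := M.pt_ne S
      rw [hab, zero_smul, add_zero] at h0 h1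
      rw [M.C_smul] at h0
      rcases mul_eq_zero.1 h0 with h | h
      · rw [pow_eq_zero_iff (by norm_num)] at h
        exact h1 (by rw [h, zero_smul])
      · exact hp h
    refine ⟨a / b, b, ?_, ?_⟩
    · rw [hab, smul_add, smul_smul, mul_div_cancel₀ _ hb]
    · have h0 := M.C_pt S
      rw [hab, M.expand] at h0
      field_simp
      linear_combination h0
  have hne : ∀ S T : G, S ≠ T → ∀ x y b c : F, M.pt S = b • (x • p + r) →
      M.pt T = c • (y • p + r) → x ≠ y := by
    rintro S T hST x y b c hS hT rfl
    have hc : c ≠ 0 := by rintro rfl; exact M.pt_ne T (by rw [hT, zero_smul])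
    refine hST (M.inj S T (b / c) ?_)
    rw [hT, hS, smul_smul, div_mul_cancel₀ _ hc]
  obtain ⟨x, a, hx, hx0⟩ := key P (by rw [hz]; simp)
  obtain ⟨y, b, hy, hy0⟩ := key Q (by rw [hz]; simp)
  obtain ⟨z, c, hz', hz0⟩ := key R (by rw [hz]; simp)
  exact cubicDisc_of_three_roots hp hx0 hy0 hz0 (hne P Q hPQ _ _ _ _ hx hy)
    (hne P R hPR _ _ _ _ hx hz') (hne Q R hQR _ _ _ _ hy hz')

lemma lineDisc_of_zeros_eq_empty {p r : Fin 3 → F} (hp : M.C p ≠ 0) (hpr : p ⨯₃ r ≠ 0)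
    (h : M.zeros (p ⨯₃ r) = ∅) : M.lineDisc p r ≠ 0 ∧ IsSquare (M.lineDisc p r) := by
  refine cubicDisc_of_no_root hp fun a ha => ?_
  have h0 : a • p + r ≠ 0 := by
    intro h0
    apply hpr
    rw [show r = -(a • p) by rw [← sub_eq_zero, ← h0]; abel]
    simp
  obtain ⟨P, c, hP⟩ := M.surj (a • p + r) h0 (by
    have := M.expand p r a 1
    rw [one_smul] at this
    rw [this]
    linear_combination ha)
  have hc : c ≠ 0 := by rintro rfl; exact h0 (by rw [hP, zero_smul])
  have hPz : P ∈ M.zeros (p ⨯₃ r) := by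
    rw [mem_zeros]
    have h3 : (p ⨯₃ r) ⬝ᵥ (a • p + r) = 0 := by
      rw [dotProduct_add, dotProduct_smul, dotProduct_comm, dot_self_cross, dotProduct_comm,
        dot_cross_self]
      simp
    rw [hP, dotProduct_smul, smul_eq_mul] at h3
    exact (mul_eq_zero.1 h3).resolve_left hc
  rw [h] at hPz
  simp at hPz

/-- The secants through a given point of the plane. -/
def secantsThrough (M : PlaneModel F G) (p : Fin 3 → F) : Finset (Fin 3 → F) :=
  M.secants.filter fun l => l ⬝ᵥ p = 0

lemma mem_secantsThrough {p l : Fin 3 → F} :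
    l ∈ M.secantsThrough p ↔ l ∈ M.secants ∧ l ⬝ᵥ p = 0 := by
  simp [secantsThrough]

lemma smul_mem_secants {c : F} (hc : c ≠ 0) {l : Fin 3 → F} (h : c • l ∈ M.secants) :
    l ∈ M.secants := by
  rw [mem_secants, zeros_smul hc] at h
  exact mem_secants.2 ⟨fun h0 => h.1 (by rw [h0, smul_zero]), h.2⟩

lemma cramer_cross (l p r₀ r₁ : Fin 3 → F) : ((p ⨯₃ r₁) ⬝ᵥ r₀) • l
    = (l ⬝ᵥ p) • (r₁ ⨯₃ r₀) + (l ⬝ᵥ r₀) • (p ⨯₃ r₁) - (l ⬝ᵥ r₁) • (p ⨯₃ r₀) := by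
  ext j
  fin_cases j <;> simp only [vec3_dotProduct, cross_apply] <;> simp <;> ring

/-- A bound for the number of secants through a point off the cubic. -/
lemma card_secantsThrough_le (hodd : Odd (Fintype.card F)) (hq : 26 ≤ Fintype.card F)
    {p r₀ r₁ : Fin 3 → F} (hp : M.C p ≠ 0) (hr : (p ⨯₃ r₁) ⬝ᵥ r₀ ≠ 0)
    (h : ¬ IsSquare (M.lineDisc p r₁) ∨
      (M.g r₁ ⬝ᵥ p = 0 ∧ M.C r₁ = 0 ∧ M.g p ⬝ᵥ r₁ ≠ 0 ∧ M.g r₁ ⬝ᵥ r₀ ≠ 0)) :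
    12 * (M.secantsThrough p).card + (Fintype.card F - 1) * Fintype.card F
      ≤ (Fintype.card F - 1) * (4 * Fintype.card G + 15) := by
  have h2 := two_ne_zero_of_odd hodd
  have hpr1 : p ⨯₃ r₁ ≠ 0 := by
    intro h0; rw [h0, zero_dotProduct] at hr; exact hr rfl
  have hprt : ∀ t : F, p ⨯₃ (r₀ + t • r₁) ≠ 0 := by
    intro t h0
    apply hr
    have : (p ⨯₃ r₁) ⬝ᵥ r₀ = -((p ⨯₃ (r₀ + t • r₁)) ⬝ᵥ r₁) := by
      simp only [vec3_dotProduct, cross_apply]; simp; ring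
    rw [this, h0, zero_dotProduct, neg_zero]
  have hinf : p ⨯₃ r₁ ∉ M.secants := by
    intro hs
    obtain ⟨h0, hsq⟩ := lineDisc_of_secant hp hpr1 hs
    rcases h with h | ⟨h1, h3, -, -⟩
    · exact h hsq
    · apply h0
      rw [lineDisc, h1, h3, cubicDisc]
      ring
  set T3 : Finset F := Finset.univ.filter fun t => p ⨯₃ (r₀ + t • r₁) ∈ M.secants with hT3
  set T0 : Finset F := Finset.univ.filter fun t => M.lineDisc p (r₀ + t • r₁) ≠ 0
    ∧ IsSquare (M.lineDisc p (r₀ + t • r₁)) with hT0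
  have hT0card : 4 * T0.card ≤ 3 * Fintype.card F + 15 := by
    obtain ⟨d, hd, hd6, hd5⟩ := exists_cubicDisc_coeffs (M.C p) (M.g p ⬝ᵥ r₀) (M.g p ⬝ᵥ r₁)
      (M.g r₀ ⬝ᵥ p) ((M.g (r₀ + p) ⬝ᵥ r₁ - M.g (r₀ - p) ⬝ᵥ r₁) / 2) (M.g r₁ ⬝ᵥ p)
      (M.C r₀) (M.g r₀ ⬝ᵥ r₁) (M.g r₁ ⬝ᵥ r₀) (M.C r₁)
    have hd' : ∀ t : F, ∑ i : Fin 7, d i * t ^ (i : ℕ) = M.lineDisc p (r₀ + t • r₁) := by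
      intro t
      have hE := M.expand r₀ r₁ 1 t
      rw [one_smul] at hE
      rw [hd, lineDisc, g_line_dot h2, hE, dotProduct_add, dotProduct_smul, smul_eq_mul]
      congr 1 <;> ring
    refine card_square_values_le hodd hq d ?_ T0 ?_
    · rcases h with h | ⟨h1, h3, h4, h5⟩
      · left; rwa [hd6]
      · right
        refine ⟨?_, ?_⟩
        · rw [hd6, h1, h3, cubicDisc]; ring
        · rw [hd5 h1 h3]
          have h4' : (4 : F) ≠ 0 := by
            rw [show (4 : F) = 2 * 2 by norm_num]; exact mul_ne_zero h2 h2
          exact mul_ne_zero (mul_ne_zero (neg_ne_zero.2 h4') (pow_ne_zero _ h4)) h5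
    · intro t ht
      rw [hd']
      exact (Finset.mem_filter.1 ht).2
  have hdisj : ∑ t : F, (M.zeros (p ⨯₃ (r₀ + t • r₁))).card ≤ Fintype.card G := by
    rw [← Finset.card_biUnion, ← Finset.card_univ]
    · exact Finset.card_le_card (Finset.subset_univ _)
    · intro s _ t _ hst
      rw [Function.onFun, Finset.disjoint_left]
      intro P hs ht
      rw [mem_zeros] at hs ht
      have e : ∀ t : F, (p ⨯₃ (r₀ + t • r₁)) ⬝ᵥ M.pt P
          = (p ⨯₃ r₀) ⬝ᵥ M.pt P + t * ((p ⨯₃ r₁) ⬝ᵥ M.pt P) := by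
        intro t
        simp only [vec3_dotProduct, cross_apply]; simp; ring
      rw [e] at hs ht
      have e1 : (p ⨯₃ r₁) ⬝ᵥ M.pt P = 0 := by
        apply mul_left_cancel₀ (sub_ne_zero.2 hst)
        linear_combination hs - ht
      have e0 : (p ⨯₃ r₀) ⬝ᵥ M.pt P = 0 := by
        rw [e1] at hs
        linear_combination hs
      have hc := cramer_cross (p ⨯₃ M.pt P) p r₀ r₁
      apply cross_pt_ne hp P
      apply (smul_eq_zero.1 (hc.trans ?_)).resolve_left hr
      have f1 : (p ⨯₃ M.pt P) ⬝ᵥ r₁ = -((p ⨯₃ r₁) ⬝ᵥ M.pt P) := by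
        simp only [vec3_dotProduct, cross_apply]; simp; ring
      have f0 : (p ⨯₃ M.pt P) ⬝ᵥ r₀ = -((p ⨯₃ r₀) ⬝ᵥ M.pt P) := by
        simp only [vec3_dotProduct, cross_apply]; simp; ring
      rw [f1, f0, e1, e0, dotProduct_comm, dot_self_cross]
      simp
  have hcount : 3 * T3.card + (Fintype.card F - T0.card) ≤ Fintype.card G := by
    refine le_trans ?_ hdisj
    have hsub : T3 ⊆ T0 := by
      intro t ht
      simp only [hT3, hT0, Finset.mem_filter, Finset.mem_univ, true_and] at ht ⊢
      exact lineDisc_of_secant hp (hprt t) ht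
    have h5 : ∀ t ∈ (Finset.univ : Finset F), ((if t ∈ T3 then 3 else 0)
        + (if t ∈ T0ᶜ then 1 else 0)) ≤ (M.zeros (p ⨯₃ (r₀ + t • r₁))).card := by
      intro t _
      by_cases ht : t ∈ T3
      · have ht0 : t ∉ T0ᶜ := by simp [hsub ht]
        rw [if_pos ht, if_neg ht0]
        exact (mem_secants.1 (Finset.mem_filter.1 ht).2).2.ge
      · rw [if_neg ht, zero_add]
        split_ifs with h0
        · rw [Finset.mem_compl] at h0
          by_contra hlt
          apply h0
          have hempty : M.zeros (p ⨯₃ (r₀ + t • r₁)) = ∅ := by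
            rw [← Finset.card_eq_zero]; omega
          exact Finset.mem_filter.2 ⟨Finset.mem_univ _,
            lineDisc_of_zeros_eq_empty hp (hprt t) hempty⟩
        · exact Nat.zero_le _
    refine le_trans (le_of_eq ?_) (Finset.sum_le_sum h5)
    rw [Finset.sum_add_distrib, ← Finset.sum_filter, ← Finset.sum_filter, Finset.sum_const,
      Finset.sum_const, Finset.filter_mem_eq_inter, Finset.filter_mem_eq_inter, Finset.univ_inter,
      Finset.univ_inter, Finset.card_compl]
    simp [mul_comm]
  have hW : (M.secantsThrough p).card ≤ T3.card * (Fintype.card F - 1) := by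
    have hsub : M.secantsThrough p ⊆ T3.biUnion fun t => nzMultiples (p ⨯₃ (r₀ + t • r₁)) := by
      intro l hl
      obtain ⟨hl, hlp⟩ := mem_secantsThrough.1 hl
      have hc := cramer_cross l p r₀ r₁
      rw [hlp, zero_smul, zero_add] at hc
      have hl' : l = ((p ⨯₃ r₁) ⬝ᵥ r₀)⁻¹ • ((l ⬝ᵥ r₀) • (p ⨯₃ r₁) - (l ⬝ᵥ r₁) • (p ⨯₃ r₀)) := by
        rw [← hc, smul_smul, inv_mul_cancel₀ hr, one_smul]
      have h1 : l ⬝ᵥ r₁ ≠ 0 := by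
        intro h1
        rw [h1, zero_smul, sub_zero, smul_smul] at hl'
        have h0 : ((p ⨯₃ r₁) ⬝ᵥ r₀)⁻¹ * (l ⬝ᵥ r₀) ≠ 0 := by
          intro h0
          rw [h0, zero_smul] at hl'
          exact (mem_secants.1 hl).1 hl'
        rw [hl'] at hl
        exact hinf (smul_mem_secants h0 hl)
      have hl'' : l = (-((p ⨯₃ r₁) ⬝ᵥ r₀)⁻¹ * (l ⬝ᵥ r₁)) •
          (p ⨯₃ (r₀ + (-(l ⬝ᵥ r₀) / (l ⬝ᵥ r₁)) • r₁)) := by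
        conv_lhs => rw [hl']
        rw [map_add, map_smul, smul_add, smul_smul, smul_sub, smul_smul, smul_smul]
        rw [show -((p ⨯₃ r₁) ⬝ᵥ r₀)⁻¹ * (l ⬝ᵥ r₁) * (-(l ⬝ᵥ r₀) / (l ⬝ᵥ r₁))
          = ((p ⨯₃ r₁) ⬝ᵥ r₀)⁻¹ * (l ⬝ᵥ r₀) by field_simp]
        rw [neg_mul, neg_smul]
        abel
      have h0 : -((p ⨯₃ r₁) ⬝ᵥ r₀)⁻¹ * (l ⬝ᵥ r₁) ≠ 0 :=
        mul_ne_zero (neg_ne_zero.2 (inv_ne_zero hr)) h1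
      refine Finset.mem_biUnion.2 ⟨-(l ⬝ᵥ r₀) / (l ⬝ᵥ r₁), ?_, mem_nzMultiples.2 ⟨_, h0, hl''⟩⟩
      refine Finset.mem_filter.2 ⟨Finset.mem_univ _, smul_mem_secants h0 ?_⟩
      rw [← hl'']
      exact hl
    exact (Finset.card_le_card hsub).trans
      (Finset.card_biUnion_le_card_mul _ _ _ fun t _ => card_nzMultiples_le _)
  have h12 : 12 * T3.card + Fintype.card F ≤ 4 * Fintype.card G + 15 := by omega
  calc 12 * (M.secantsThrough p).card + (Fintype.card F - 1) * Fintype.card F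
      ≤ 12 * (T3.card * (Fintype.card F - 1)) + (Fintype.card F - 1) * Fintype.card F := by gcongr
    _ = (Fintype.card F - 1) * (12 * T3.card + Fintype.card F) := by ring
    _ ≤ _ := Nat.mul_le_mul_left _ h12

end PlaneModel

end

section
open Matrix

lemma pencil_bound {r N : ℝ} (hr : 11 ≤ r) (h1 : (r - 1) ^ 2 ≤ N) :
    57 ≤ 4 * N - r ^ 2 ∧
      (r ^ 2 + 1) * (4 * N - r ^ 2 + 15) < 4 * N ^ 2 - 36 * N + 24 := by
  obtain ⟨x, rfl⟩ : ∃ x, r = 11 + x := ⟨r - 11, by ring⟩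
  obtain ⟨y, rfl⟩ : ∃ y, N = (11 + x - 1) ^ 2 + y := ⟨N - (11 + x - 1) ^ 2, by ring⟩
  have hx : 0 ≤ x := by linarith
  have hy : 0 ≤ y := by linarith
  constructor
  · nlinarith
  · rw [← sub_pos]
    ring_nf
    positivity

lemma exists_complement {F : Type} [Field F] {a b : F} (h : a ≠ 0 ∨ b ≠ 0) :
    ∃ c d : F, a * d - b * c = 1 := by
  rcases h with h | h
  · exact ⟨0, a⁻¹, by field_simp; ring⟩
  · exact ⟨-b⁻¹, 0, by field_simp; ring⟩

namespace PlaneModel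
variable {F G : Type} [Field F] [Fintype F] [DecidableEq F] [Fintype G] [DecidableEq G]
  {M M' : PlaneModel F G}

/-- A condition on the line spanned by two points under which there are few secants through each
of its points off the cubic: the discriminant of the cubic on the line is not a square, or the
line is tangent to the cubic at a point that is not a flex. -/
def IsGood (M : PlaneModel F G) (u v : Fin 3 → F) : Prop :=
  ¬ IsSquare (M.lineDisc u v) ∨ ∃ R T : Fin 3 → F, R ≠ 0 ∧ M.C R = 0 ∧ (u ⨯₃ v) ⬝ᵥ R = 0 ∧
    (u ⨯₃ v) ⬝ᵥ T = 0 ∧ M.g R ⬝ᵥ u = 0 ∧ M.g R ⬝ᵥ v = 0 ∧ M.g T ⬝ᵥ R ≠ 0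

lemma IsGood.change (h2 : (2 : F) ≠ 0) {u v : Fin 3 → F} (h : M.IsGood u v) {a b c d : F}
    (hdet : a * d - b * c ≠ 0) : M.IsGood (a • u + b • v) (c • u + d • v) := by
  rcases h with h | ⟨R, T, hR, hCR, huR, huT, hu, hv, hT⟩
  · left
    rw [lineDisc_change h2]
    rintro ⟨s, hs⟩
    refine h ⟨s / (a * d - b * c) ^ 3, ?_⟩
    field_simp
    linear_combination hs
  · right
    have e : (a • u + b • v) ⨯₃ (c • u + d • v) = (a * d - b * c) • (u ⨯₃ v) := by
      ext j
      fin_cases j <;> simp [cross_apply] <;> ring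
    refine ⟨R, T, hR, hCR, ?_, ?_, ?_, ?_, hT⟩
    · rw [e, smul_dotProduct, huR, smul_zero]
    · rw [e, smul_dotProduct, huT, smul_zero]
    · simp [dotProduct_add, dotProduct_smul, hu, hv]
    · simp [dotProduct_add, dotProduct_smul, hu, hv]

lemma IsGood.exists_pencil (h2 : (2 : F) ≠ 0) {u v : Fin 3 → F} (huv : u ⨯₃ v ≠ 0)
    (h : M.IsGood u v) {p : Fin 3 → F} (hp : M.C p ≠ 0) (hl : (u ⨯₃ v) ⬝ᵥ p = 0) :
    ∃ r₀ r₁, (p ⨯₃ r₁) ⬝ᵥ r₀ ≠ 0 ∧ (u ⨯₃ v) ⬝ᵥ r₁ = 0 ∧ (¬ IsSquare (M.lineDisc p r₁) ∨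
      (M.g r₁ ⬝ᵥ p = 0 ∧ M.C r₁ = 0 ∧ M.g p ⬝ᵥ r₁ ≠ 0 ∧ M.g r₁ ⬝ᵥ r₀ ≠ 0)) := by
  have hlu : (u ⨯₃ v) ⬝ᵥ u = 0 := by rw [dotProduct_comm, dot_self_cross]
  have hlv : (u ⨯₃ v) ⬝ᵥ v = 0 := by rw [dotProduct_comm, dot_cross_self]
  obtain ⟨a, b, rfl⟩ := exists_mem_span_pair huv huv hlu hlv hl
  rcases h with h | ⟨R, T, hR, hCR, huR, huT, hu, hv, hT⟩
  · have hab : a ≠ 0 ∨ b ≠ 0 := by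
      by_contra hcon
      push Not at hcon
      rw [hcon.1, hcon.2, M.expand] at hp
      exact hp (by ring)
    obtain ⟨c, d, hcd⟩ := exists_complement hab
    have hne : (a • u + b • v) ⨯₃ (c • u + d • v) ≠ 0 :=
      smul_cross_ne_zero_iff huv (by rw [hcd]; exact one_ne_zero)
    obtain ⟨r₀, hr₀⟩ := exists_dotProduct_ne_zero hne
    refine ⟨r₀, c • u + d • v, hr₀, ?_, Or.inl ?_⟩
    · simp [dotProduct_add, dotProduct_smul, hlu, hlv]
    · rw [lineDisc_change h2, hcd]
      simpa using h
  · set p := a • u + b • v with hpdef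
    have hgR : ∀ w, (u ⨯₃ v) ⬝ᵥ w = 0 → M.g R ⬝ᵥ w = 0 := by
      intro w hw
      obtain ⟨x, y, rfl⟩ := exists_mem_span_pair huv huv hlu hlv hw
      simp [dotProduct_add, dotProduct_smul, hu, hv]
    have hpR : p ⨯₃ R ≠ 0 := cross_ne_zero_of_not_smul hR fun c hc => hp (by
      rw [hc, M.C_smul, hCR, mul_zero])
    obtain ⟨r₀, hr₀⟩ := exists_dotProduct_ne_zero (M.smooth R hR hCR)
    obtain ⟨c, hc⟩ := exists_smul_cross hpR (hgR p hl) (hgR R huR)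
    refine ⟨r₀, R, ?_, huR, Or.inr ⟨hgR p hl, hCR, ?_, hr₀⟩⟩
    · intro h0
      rw [hc, smul_dotProduct, h0, smul_zero] at hr₀
      exact hr₀ rfl
    · have hT0 : T ≠ 0 := by
        rintro rfl
        have := g_dot (M := M) h2 R 0 0 0 1 0
        simp at this
        exact hT this
      have hRT : R ⨯₃ T ≠ 0 := by
        refine cross_ne_zero_of_not_smul hT0 fun c hc => ?_
        have hc0 : c ≠ 0 := by rintro rfl; exact hR (by rw [hc, zero_smul])
        have hTR : T = c⁻¹ • R := by rw [hc, smul_smul, inv_mul_cancel₀ hc0, one_smul]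
        have := g_dot (M := M) h2 R 0 c⁻¹ 0 1 0
        rw [smul_zero, add_zero, one_smul, add_zero, ← hTR, hCR] at this
        apply hT
        rw [this]
        simp
      obtain ⟨x, y, hxy⟩ := exists_mem_span_pair huv hRT huR huT hl
      have hy : y ≠ 0 := by
        rintro rfl
        apply hp
        rw [hxy, zero_smul, add_zero, M.C_smul, hCR, mul_zero]
      have := g_dot (M := M) h2 R T x y 1 0
      rw [← hxy, one_smul, zero_smul, add_zero, hCR, hgR T huT] at this
      rw [this]
      have hne := mul_ne_zero (pow_ne_zero 2 hy) hT
      intro h0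
      apply hne
      linear_combination h0

lemma IsGood.not_mem_secants (h2 : (2 : F) ≠ 0) {u v : Fin 3 → F} (huv : u ⨯₃ v ≠ 0)
    (h : M.IsGood u v) : u ⨯₃ v ∉ M.secants := by
  intro hs
  obtain ⟨p, hl, hp⟩ := M.noline _ huv
  obtain ⟨r₀, r₁, hr, hlr, h⟩ := h.exists_pencil h2 huv hp hl
  have hpr : p ⨯₃ r₁ ≠ 0 := by
    intro h0; rw [h0, zero_dotProduct] at hr; exact hr rfl
  obtain ⟨c, hc⟩ := exists_smul_cross hpr hl hlr
  have hc0 : c ≠ 0 := by rintro rfl; exact huv (by rw [hc, zero_smul])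
  rw [hc] at hs
  obtain ⟨h0, hsq⟩ := lineDisc_of_secant hp hpr (smul_mem_secants hc0 hs)
  rcases h with h | ⟨h1, h3, -, -⟩
  · exact h hsq
  · apply h0
    rw [lineDisc, h1, h3, cubicDisc]
    ring

/-- The points of the line spanned by two vectors. -/
def linePoint (u v : Fin 3 → F) : Option F → (Fin 3 → F)
  | none => v
  | some t => u + t • v

lemma cross_dot_linePoint (u v : Fin 3 → F) (x : Option F) :
    (u ⨯₃ v) ⬝ᵥ linePoint u v x = 0 := by
  cases x with
  | none => rw [linePoint, dotProduct_comm, dot_cross_self]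
  | some t =>
    rw [linePoint, dotProduct_comm, add_dotProduct, smul_dotProduct, dot_self_cross,
      dot_cross_self]
    simp

lemma linePoint_cross {u v : Fin 3 → F} (huv : u ⨯₃ v ≠ 0) {x y : Option F} (hxy : x ≠ y) :
    linePoint u v x ⨯₃ linePoint u v y ≠ 0 := by
  have hx : ∀ x : Option F, linePoint u v x
      = (x.elim (0 : F) fun _ => 1) • u + (x.elim (1 : F) fun t => t) • v := by
    intro x
    cases x <;> simp [linePoint]
  rw [hx x, hx y]
  apply smul_cross_ne_zero_iff huv
  cases x with
  | none => cases y with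
    | none => exact absurd rfl hxy
    | some t => simp
  | some s => cases y with
    | none => simp
    | some t =>
      simp only [Option.elim, one_mul, mul_one]
      rw [sub_ne_zero]
      rintro rfl
      exact hxy rfl

lemma exists_linePoint (u v l : Fin 3 → F) : ∃ x, l ⬝ᵥ linePoint u v x = 0 := by
  by_cases h : l ⬝ᵥ v = 0
  · exact ⟨none, h⟩
  · refine ⟨some (-(l ⬝ᵥ u) / (l ⬝ᵥ v)), ?_⟩
    rw [linePoint, dotProduct_add, dotProduct_smul, smul_eq_mul, div_mul_cancel₀ _ h]
    ring

lemma card_secants_le_sum {u v : Fin 3 → F} (huv : u ⨯₃ v ≠ 0) (hs : u ⨯₃ v ∉ M.secants) :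
    M.secants.card ≤ (∑ x, if M.C (linePoint u v x) ≠ 0
        then (M.secantsThrough (linePoint u v x)).card else 0)
      + (Fintype.card G - 1) * (Fintype.card F - 1) := by
  set p := linePoint u v with hp
  have h1 : M.secants.card ≤ ∑ x, (M.secantsThrough (p x)).card := by
    refine (Finset.card_le_card (t := Finset.univ.biUnion fun x => M.secantsThrough (p x))
      fun l hl => ?_).trans Finset.card_biUnion_le
    obtain ⟨x, hx⟩ := exists_linePoint u v l
    exact Finset.mem_biUnion.2 ⟨x, Finset.mem_univ _, mem_secantsThrough.2 ⟨hl, hx⟩⟩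
  rw [← Finset.sum_filter]
  rw [← Finset.sum_filter_add_sum_filter_not _ fun x => M.C (p x) ≠ 0] at h1
  refine h1.trans (Nat.add_le_add_left ?_ _)
  have hp0 : ∀ x, p x ≠ 0 := by
    intro x h0
    obtain ⟨y, hy⟩ := exists_ne x
    have := linePoint_cross huv hy.symm
    rw [← hp, h0] at this
    simp at this
  have hpt : ∀ x, M.C (p x) = 0 → ∃ P, ∃ c : F, p x = c • M.pt P := fun x hC =>
    M.surj _ (hp0 x) hC
  rcases isEmpty_or_nonempty G with hG | hG
  · rw [Finset.sum_eq_zero]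
    · exact Nat.zero_le _
    · intro x hx
      rw [Finset.mem_filter, not_not] at hx
      obtain ⟨P, -⟩ := hpt x hx.2
      exact hG.elim P
  choose! f hf using hpt
  have hnz : ∀ x, M.C (p x) = 0 → ∃ c : F, c ≠ 0 ∧ p x = c • M.pt (f x) := by
    intro x hx
    obtain ⟨c, hc⟩ := hf x hx
    exact ⟨c, by rintro rfl; exact hp0 x (by rw [hc, zero_smul]), hc⟩
  have hcard : (Finset.univ.filter fun x => ¬ M.C (p x) ≠ 0).card ≤ 2 := by
    have h3 := card_zeros_le (M := M) huv
    have h3' : (M.zeros (u ⨯₃ v)).card ≠ 3 := fun h => hs (mem_secants.2 ⟨huv, h⟩)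
    have hle : (Finset.univ.filter fun x => ¬ M.C (p x) ≠ 0).card
        ≤ (M.zeros (u ⨯₃ v)).card := by
      refine Finset.card_le_card_of_injOn f ?_ ?_
      · intro x hx
        simp only [not_not, Finset.coe_filter, Finset.mem_univ, true_and, Set.mem_ofPred_eq] at hx
        obtain ⟨c, hc0, hc⟩ := hnz x hx
        have h0 := cross_dot_linePoint u v x
        rw [← hp, hc, dotProduct_smul, smul_eq_mul] at h0
        exact mem_zeros.2 ((mul_eq_zero.1 h0).resolve_left hc0)
      · intro x hx y hy hxy
        simp only [not_not, Finset.coe_filter, Finset.mem_univ, true_and, Set.mem_ofPred_eq]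
          at hx hy
        by_contra hne
        apply linePoint_cross huv hne
        obtain ⟨c, -, hc⟩ := hnz x hx
        obtain ⟨d, -, hd⟩ := hnz y hy
        rw [← hp, hc, hd, hxy]
        simp
    omega
  have h5 : ∀ x ∈ Finset.univ.filter (fun x => ¬ M.C (p x) ≠ 0),
      2 * (M.secantsThrough (p x)).card ≤ (Fintype.card G - 1) * (Fintype.card F - 1) := by
    intro x hx
    rw [Finset.mem_filter, not_not] at hx
    obtain ⟨c, hc0, hc⟩ := hnz x hx.2
    refine le_trans (Nat.mul_le_mul_left _ (Finset.card_le_card fun l hl => ?_))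
      (card_secants_through_le (M := M) (f x))
    rw [mem_secantsThrough, hc, dotProduct_smul, smul_eq_mul] at hl
    exact Finset.mem_filter.2 ⟨hl.1, mem_zeros.2 ((mul_eq_zero.1 hl.2).resolve_left hc0)⟩
  have h6 := Finset.sum_le_card_nsmul _ _ _ h5
  rw [← Finset.mul_sum, smul_eq_mul] at h6
  have h7 := Nat.mul_le_mul_right ((Fintype.card G - 1) * (Fintype.card F - 1)) hcard
  omega

lemma exists_disjoint_secant_through {p : Fin 3 → F} (hp : M.C p ≠ 0) {Z : Finset G}
    (hZ : Z.card = 3) (hc : 3 * (Fintype.card F - 1) < (M.secantsThrough p).card) :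
    ∃ m ∈ M.secants, m ⬝ᵥ p = 0 ∧ Disjoint Z (M.zeros m) := by
  by_contra hcon
  push Not at hcon
  have hsub : M.secantsThrough p ⊆ Z.biUnion fun P => Finset.univ.filter fun l : Fin 3 → F =>
      l ≠ 0 ∧ l ⬝ᵥ p = 0 ∧ l ⬝ᵥ M.pt P = 0 := by
    intro l hl
    obtain ⟨hl, hlp⟩ := mem_secantsThrough.1 hl
    obtain ⟨P, hP, hPl⟩ := Finset.not_disjoint_iff.1 (hcon l hl hlp)
    exact Finset.mem_biUnion.2 ⟨P, hP, Finset.mem_filter.2 ⟨Finset.mem_univ _,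
      (mem_secants.1 hl).1, hlp, mem_zeros.1 hPl⟩⟩
  have h1 := (Finset.card_le_card hsub).trans (Finset.card_biUnion_le_card_mul _ _ _ fun P _ =>
    (card_lines_through_pair (cross_pt_ne (M := M) hp P)).le)
  rw [hZ] at h1
  omega

/-- For a degenerate pairing of rank two whose kernel lines are good, there are conjugate secants
of two models with disjoint sets of points. -/
theorem exists_conjugate_secants_of_isGood (hodd : Odd (Fintype.card F))
    (hq : 121 ≤ Fintype.card F)
    (hN : ((Fintype.card F : ℤ) + 1 - Fintype.card G) ^ 2 ≤ 4 * Fintype.card F)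
    {u v u' v' : Fin 3 → F} (huv : u ⨯₃ v ≠ 0) (huv' : u' ⨯₃ v' ≠ 0)
    (h : M.IsGood u v) (h' : M'.IsGood u' v') :
    ∃ l ∈ M.secants, ∃ m ∈ M'.secants, Disjoint (M.zeros l) (M'.zeros m)
      ∧ (l ⬝ᵥ u) * (m ⬝ᵥ u') + (l ⬝ᵥ v) * (m ⬝ᵥ v') = 0 := by
  have h2 := two_ne_zero_of_odd hodd
  set w := -v' with hw
  have hwu : w ⨯₃ u' ≠ 0 := by
    rw [hw, map_neg, LinearMap.neg_apply, cross_anticomm]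
    exact huv'
  have hgw : M'.IsGood w u' := by
    have := h'.change h2 (a := 0) (b := -1) (c := 1) (d := 0) (by simp)
    simpa [hw] using this
  have hpair : ∀ x : Option F, ∀ l m : Fin 3 → F, l ⬝ᵥ linePoint u v x = 0 →
      m ⬝ᵥ linePoint w u' x = 0 → (l ⬝ᵥ u) * (m ⬝ᵥ u') + (l ⬝ᵥ v) * (m ⬝ᵥ v') = 0 := by
    intro x l m hl hm
    cases x with
    | none =>
      rw [linePoint] at hl hm
      rw [hl, hm]
      ring
    | some t =>
      rw [linePoint, dotProduct_add, dotProduct_smul, smul_eq_mul] at hl hm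
      rw [hw, dotProduct_neg] at hm
      linear_combination (m ⬝ᵥ u') * hl - (l ⬝ᵥ v) * hm
  set q := Fintype.card F with hqdef
  set N := Fintype.card G with hNdef
  set f : Option F → ℕ := fun x => if M.C (linePoint u v x) ≠ 0
    then (M.secantsThrough (linePoint u v x)).card else 0 with hf
  set f' : Option F → ℕ := fun x => if M'.C (linePoint w u' x) ≠ 0
    then (M'.secantsThrough (linePoint w u' x)).card else 0 with hf'
  by_contra hcon
  push Not at hcon
  obtain ⟨hN1, -⟩ := hasse_enclosure hN
  have hr2 : √(q : ℝ) ^ 2 = q := Real.sq_sqrt (Nat.cast_nonneg q)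
  have hr11 : (11 : ℝ) ≤ √(q : ℝ) := by
    apply Real.le_sqrt_of_sq_le
    have : (121 : ℝ) ≤ q := by exact_mod_cast hq
    linarith
  obtain ⟨hb1, hb2⟩ := pencil_bound hr11 hN1
  rw [hr2] at hb1 hb2
  set t : ℝ := (q : ℝ) - 1 with ht
  have ht0 : 0 < t := by
    have : (121 : ℝ) ≤ q := by exact_mod_cast hq
    rw [ht]; linarith
  have hcast : ((q - 1 : ℕ) : ℝ) = t := by
    rw [Nat.cast_sub (by omega)]; simp [ht]
  have hN100 := hasse_lower hq hN
  have hcastN : ((N - 1 : ℕ) : ℝ) = N - 1 := by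
    rw [Nat.cast_sub (by omega)]; simp
  have hK0 : 72 * t ≤ t * (4 * N + 15 - q) := by nlinarith
  have bound : ∀ (L : PlaneModel F G) (x y : Fin 3 → F), x ⨯₃ y ≠ 0 → L.IsGood x y →
      ∀ z, L.C (linePoint x y z) ≠ 0 →
        12 * ((L.secantsThrough (linePoint x y z)).card : ℝ) ≤ t * (4 * N + 15 - q) := by
    intro L x y hxy hg z hz
    obtain ⟨r₀, r₁, hr, -, hc⟩ := hg.exists_pencil h2 hxy hz (cross_dot_linePoint x y z)
    have h3 := card_secantsThrough_le hodd (by omega) hz hr hc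
    have h4 : ((12 * (L.secantsThrough (linePoint x y z)).card + (q - 1) * q : ℕ) : ℝ)
      ≤ (((q - 1) * (4 * N + 15) : ℕ) : ℝ) := by exact_mod_cast h3
    rw [Nat.cast_add, Nat.cast_mul, Nat.cast_mul, Nat.cast_mul, hcast] at h4
    push_cast at h4
    linarith
  have sumbound : ∀ (L : PlaneModel F G) (x y : Fin 3 → F), x ⨯₃ y ≠ 0 → L.IsGood x y →
      t * (N ^ 2 - 9 * N + 6) / 6 ≤ ((∑ z, if L.C (linePoint x y z) ≠ 0
        then (L.secantsThrough (linePoint x y z)).card else 0 : ℕ) : ℝ) := by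
    intro L x y hxy hg
    have h3 := card_secants_le_sum hxy (hg.not_mem_secants h2 hxy)
    have h4 := card_secants_ge (M := L) h2
    rw [← hqdef, ← hNdef] at h3 h4
    have h3' := (Nat.cast_le (α := ℝ)).2 h3
    rw [Nat.cast_add, Nat.cast_mul, hcast, hcastN] at h3'
    have h4' : (((q - 1) * (N * N) : ℕ) : ℝ) ≤
        ((6 * L.secants.card + (q - 1) * (3 * N) : ℕ) : ℝ) := by
      exact_mod_cast h4
    rw [Nat.cast_add, Nat.cast_mul, Nat.cast_mul, Nat.cast_mul, hcast] at h4'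
    push_cast at h4' h3' ⊢
    rw [hcast] at h4'
    linarith
  have hx : ∀ x, 12 * ((f x : ℝ) + f' x) ≤ t * (4 * N + 15 - q) := by
    intro x
    by_cases hC : M.C (linePoint u v x) ≠ 0
    swap
    · have h0 : f x = 0 := if_neg hC
      rw [h0]
      by_cases hC' : M'.C (linePoint w u' x) ≠ 0
      · have := bound M' w u' hwu hgw x hC'
        simp only [hf', if_pos hC']
        push_cast
        linarith
      · have h0 : f' x = 0 := if_neg hC'
        rw [h0]
        push_cast
        linarith
    have e : f x = (M.secantsThrough (linePoint u v x)).card := if_pos hC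
    have hb := bound M u v huv h x hC
    rw [← e] at hb
    by_cases hC' : M'.C (linePoint w u' x) ≠ 0
    swap
    · have h0 : f' x = 0 := if_neg hC'
      rw [h0]
      push_cast
      linarith
    have e' : f' x = (M'.secantsThrough (linePoint w u' x)).card := if_pos hC'
    have hb' := bound M' w u' hwu hgw x hC'
    rw [← e'] at hb'
    rcases Nat.eq_zero_or_pos (f x) with h0 | h0
    · rw [h0]; push_cast; linarith
    rcases Nat.eq_zero_or_pos (f' x) with h0' | h0'
    · rw [h0']; push_cast; linarith
    have g1 : f x ≤ 3 * (q - 1) := by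
      by_contra hlt
      push Not at hlt
      rw [e'] at h0'
      rw [e] at hlt
      obtain ⟨m, hm⟩ := Finset.card_pos.1 h0'
      obtain ⟨hm, hmp⟩ := mem_secantsThrough.1 hm
      obtain ⟨l, hl, hlp, hd⟩ := exists_disjoint_secant_through hC (mem_secants.1 hm).2 hlt
      exact hcon l hl m hm hd.symm (hpair x l m hlp hmp)
    have g2 : f' x ≤ 3 * (q - 1) := by
      by_contra hlt
      push Not at hlt
      rw [e] at h0
      rw [e'] at hlt
      obtain ⟨l, hl⟩ := Finset.card_pos.1 h0
      obtain ⟨hl, hlp⟩ := mem_secantsThrough.1 hl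
      obtain ⟨m, hm, hmp, hd⟩ := exists_disjoint_secant_through hC' (mem_secants.1 hl).2 hlt
      exact hcon l hl m hm hd (hpair x l m hlp hmp)
    have g1' : (f x : ℝ) ≤ 3 * t := by rw [← hcast]; exact_mod_cast g1
    have g2' : (f' x : ℝ) ≤ 3 * t := by rw [← hcast]; exact_mod_cast g2
    linarith
  have hsum := Finset.sum_le_card_nsmul Finset.univ _ _ fun x _ => hx x
  rw [← Finset.mul_sum, Finset.sum_add_distrib, Finset.card_univ, Fintype.card_option,
    nsmul_eq_mul, ← hqdef] at hsum
  have s1 := sumbound M u v huv h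
  have s2 := sumbound M' w u' hwu hgw
  rw [Nat.cast_sum] at s1 s2
  push_cast at hsum
  have : t * ((q + 1) * (4 * N - q + 15)) < t * (4 * N ^ 2 - 36 * N + 24) :=
    mul_lt_mul_of_pos_left hb2 ht0
  nlinarith

/-- Like `exists_conjugate_secants_of_isGood`, allowing the kernel lines to be secants. -/
theorem exists_conjugate_secants_of_rank_two (hodd : Odd (Fintype.card F))
    (hq : 121 ≤ Fintype.card F)
    (hN : ((Fintype.card F : ℤ) + 1 - Fintype.card G) ^ 2 ≤ 4 * Fintype.card F)
    {u v u' v' : Fin 3 → F} (huv : u ⨯₃ v ≠ 0) (huv' : u' ⨯₃ v' ≠ 0)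
    (h : u ⨯₃ v ∈ M.secants ∨ M.IsGood u v) (h' : u' ⨯₃ v' ∈ M'.secants ∨ M'.IsGood u' v') :
    ∃ l ∈ M.secants, ∃ m ∈ M'.secants, Disjoint (M.zeros l) (M'.zeros m)
      ∧ (l ⬝ᵥ u) * (m ⬝ᵥ u') + (l ⬝ᵥ v) * (m ⬝ᵥ v') = 0 := by
  have h2 := two_ne_zero_of_odd hodd
  have h12 : 12 ≤ Fintype.card G := by
    have := hasse_lower hq hN
    omega
  rcases h with h | h
  · obtain ⟨m, hm, hd⟩ := exists_disjoint_secant (M := M') h2 h12 _ (mem_secants.1 h).2.le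
    refine ⟨_, h, m, hm, hd, ?_⟩
    rw [dotProduct_comm, dot_self_cross, dotProduct_comm _ v, dot_cross_self]
    ring
  rcases h' with h' | h'
  · obtain ⟨l, hl, hd⟩ := exists_disjoint_secant (M := M) h2 h12 _ (mem_secants.1 h').2.le
    refine ⟨l, hl, _, h', hd.symm, ?_⟩
    rw [dotProduct_comm _ u', dot_self_cross, dotProduct_comm _ v', dot_cross_self]
    ring
  exact exists_conjugate_secants_of_isGood hodd hq hN huv huv' h h'

end PlaneModel

end

section Kummer
open WeierstrassCurve Matrix

/-- The short Weierstrass curve `y² = x³ + ax² + bx + c`. -/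
def shortCurve {R : Type*} [CommRing R] (a b c : R) : WeierstrassCurve R := ⟨0, a, 0, b, c⟩

variable {K : Type*} [Field K] [DecidableEq K] {a b c : K}

lemma shortCurve_equation_iff (x y : K) :
    (shortCurve a b c).toAffine.Equation x y ↔ y ^ 2 = x ^ 3 + a * x ^ 2 + b * x + c := by
  rw [WeierstrassCurve.Affine.equation_iff]
  simp [shortCurve]

lemma shortCurve_nonsingular_of_ne_zero {x y : K} (hy : 2 * y ≠ 0)
    (h : y ^ 2 = x ^ 3 + a * x ^ 2 + b * x + c) :
    (shortCurve a b c).toAffine.Nonsingular x y := by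
  rw [WeierstrassCurve.Affine.nonsingular_iff]
  refine ⟨(shortCurve_equation_iff x y).2 h, Or.inr ?_⟩
  simp only [shortCurve]
  intro h0
  exact hy (by linear_combination h0)

lemma exists_xRep_add_sub {x y : K} (h : (shortCurve a b c).toAffine.Nonsingular x y)
    (hy : 2 * y ≠ 0) (P : (shortCurve a b c).toAffine.Point) :
    ∃ κ : K, κ ≠ 0 ∧
      (P + .some x y h).xRep 0 * (P - .some x y h).xRep 0
        = κ * ((P.xRep 0 * x - b * P.xRep 1) ^ 2
          - 4 * c * P.xRep 1 * (P.xRep 0 + x * P.xRep 1 + a * P.xRep 1)) ∧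
      (P + .some x y h).xRep 0 * (P - .some x y h).xRep 1
          + (P + .some x y h).xRep 1 * (P - .some x y h).xRep 0
        = κ * (2 * ((P.xRep 0 + x * P.xRep 1) * (P.xRep 0 * x + b * P.xRep 1)
          + 2 * c * P.xRep 1 ^ 2 + 2 * a * P.xRep 0 * x * P.xRep 1)) ∧
      (P + .some x y h).xRep 1 * (P - .some x y h).xRep 1
        = κ * (P.xRep 0 - x * P.xRep 1) ^ 2 := by
  have hE := (shortCurve_equation_iff x y).1 h.1
  have hneg : (shortCurve a b c).toAffine.negY x y = -y := by
    simp [WeierstrassCurve.Affine.negY, shortCurve]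
  have hk : ((2 * y) ^ 2)⁻¹ ≠ 0 := inv_ne_zero (pow_ne_zero 2 hy)
  have hk' : (2 * y) ^ 2 ≠ 0 := pow_ne_zero 2 hy
  have hdouble : (2 * y) ^ 2 * ((Affine.Point.some x y h + .some x y h).xRep 0)
      = (x * x - b) ^ 2 - 4 * c * (x + x + a) ∧
      (Affine.Point.some x y h + .some x y h).xRep 1 = 1 := by
    have hne : y ≠ (shortCurve a b c).toAffine.negY x y := by
      rw [hneg]; intro h0; exact hy (by linear_combination h0)
    rw [Affine.Point.add_self_of_Y_ne hne, Affine.Point.xRep_some,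
      Affine.slope_of_Y_ne rfl hne, hneg]
    refine ⟨?_, rfl⟩
    simp only [Affine.addX, shortCurve, Matrix.cons_val_zero]
    have h2 : y - -y = 2 * y := by ring
    have h3 : (2 * y) ^ 2 * ((3 * x ^ 2 + 2 * a * x + b - 0 * y) / (2 * y)) ^ 2
        = (3 * x ^ 2 + 2 * a * x + b) ^ 2 := by
      rw [div_pow, mul_div_cancel₀ _ hk', zero_mul, sub_zero]
    rw [h2]
    linear_combination h3 - 4 * (2 * x + a) * hE
  rcases P with _ | ⟨x₁, y₁, h₁⟩
  · refine ⟨1, one_ne_zero, ?_⟩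
    rw [← Affine.Point.zero_def, zero_add, zero_sub, Affine.Point.xRep_neg]
    simp only [Affine.Point.xRep_zero, Affine.Point.xRep_some, Matrix.cons_val_zero,
      Matrix.cons_val_one]
    refine ⟨?_, ?_, ?_⟩ <;> ring
  by_cases hx : x₁ = x
  · subst hx
    have hE₁ := (shortCurve_equation_iff x₁ y₁).1 h₁.1
    have hyy : (y₁ - y) * (y₁ + y) = 0 := by linear_combination hE₁ - hE
    refine ⟨((2 * y) ^ 2)⁻¹, hk, ?_⟩
    rcases mul_eq_zero.1 hyy with h0 | h0
    · obtain rfl : y₁ = y := by linear_combination h0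
      rw [sub_self]
      simp only [Affine.Point.xRep_zero, Affine.Point.xRep_some, hdouble.2]
      simp only [Matrix.cons_val_zero, Matrix.cons_val_one, inv_mul_eq_div, eq_div_iff hk']
      refine ⟨?_, ?_, ?_⟩
      · linear_combination hdouble.1
      · linear_combination 4 * hE
      · ring
    · obtain rfl : y₁ = -y := by linear_combination h0
      have hP : (Affine.Point.some x₁ (-y) h₁) = -(Affine.Point.some x₁ y h) := by
        simp only [Affine.Point.neg_some, hneg]
      have hPs : (Affine.Point.some x₁ (-y) h₁) - (Affine.Point.some x₁ y h)
          = -(Affine.Point.some x₁ y h + Affine.Point.some x₁ y h) := by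
        rw [hP]; abel
      rw [hPs, hP, neg_add_cancel]
      simp only [Affine.Point.xRep_neg, Affine.Point.xRep_zero, Affine.Point.xRep_some, hdouble.2]
      simp only [Matrix.cons_val_zero, Matrix.cons_val_one, inv_mul_eq_div, eq_div_iff hk']
      refine ⟨?_, ?_, ?_⟩
      · linear_combination hdouble.1
      · linear_combination 4 * hE
      · ring
  · have hE₁ := (shortCurve_equation_iff x₁ y₁).1 h₁.1
    have hd : x₁ - x ≠ 0 := sub_ne_zero.2 hx
    have hd' : (x₁ - x) ^ 2 ≠ 0 := pow_ne_zero 2 hd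
    refine ⟨((x₁ - x) ^ 2)⁻¹, inv_ne_zero hd', ?_⟩
    rw [sub_eq_add_neg, Affine.Point.neg_some, Affine.Point.add_of_X_ne hx,
      Affine.Point.add_of_X_ne hx]
    simp only [Affine.Point.xRep_some, Affine.slope_of_X_ne hx, hneg]
    simp only [Affine.addX, shortCurve, Matrix.cons_val_zero, Matrix.cons_val_one]
    obtain ⟨m, hm⟩ : ∃ m, m = (y₁ - y) / (x₁ - x) := ⟨_, rfl⟩
    obtain ⟨n, hn⟩ : ∃ n, n = (y₁ - -y) / (x₁ - x) := ⟨_, rfl⟩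
    have hm2 : m ^ 2 * (x₁ - x) ^ 2 = (y₁ - y) ^ 2 := by
      rw [hm, div_pow, div_mul_cancel₀ _ hd']
    have hn2 : n ^ 2 * (x₁ - x) ^ 2 = (y₁ + y) ^ 2 := by
      rw [hn, div_pow, div_mul_cancel₀ _ hd', sub_neg_eq_add]
    rw [← hm, ← hn]
    simp only [inv_mul_eq_div, eq_div_iff hd']
    refine ⟨mul_right_cancel₀ hd' ?_, ?_, ?_⟩
    · linear_combination
        (n ^ 2 * (x₁ - x) ^ 2 - (a + x₁ + x) * (x₁ - x) ^ 2) * hm2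
        + ((y₁ - y) ^ 2 - (a + x₁ + x) * (x₁ - x) ^ 2) * hn2
        + (y₁ ^ 2 - y ^ 2 + (x₁ ^ 3 + a * x₁ ^ 2 + b * x₁ + c)
            - (x ^ 3 + a * x ^ 2 + b * x + c) - 2 * (a + x₁ + x) * (x₁ - x) ^ 2) * hE₁
        + (-(y₁ ^ 2 - y ^ 2 + (x₁ ^ 3 + a * x₁ ^ 2 + b * x₁ + c)
            - (x ^ 3 + a * x ^ 2 + b * x + c)) - 2 * (a + x₁ + x) * (x₁ - x) ^ 2) * hE
    · linear_combination hm2 + hn2 + 2 * hE₁ + 2 * hE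
    · ring

end Kummer

section KummerPolynomials
open Polynomial

variable {F : Type*} [Field F]

/-- The polynomial `X³ + aX² + bX + c`. -/
noncomputable def cubicPoly (a b c : F) : F[X] := X ^ 3 + C a * X ^ 2 + C b * X + C c

/-- The derivative of `X³ + aX² + bX + c`. -/
noncomputable def cubicPolyDeriv (a b : F) : F[X] := 3 * X ^ 2 + 2 * C a * X + C b

lemma isCoprime_cubicPoly_deriv {a b c : F} (h : cubicDisc 1 a b c ≠ 0) :
    IsCoprime (cubicPoly a b c) (cubicPolyDeriv a b) := by
  refine ⟨C (cubicDisc 1 a b c)⁻¹ * ((-6 * C a ^ 2 + 18 * C b) * X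
      + (-4 * C a ^ 3 + 15 * C a * C b - 27 * C c)),
    C (cubicDisc 1 a b c)⁻¹ * ((2 * C a ^ 2 - 6 * C b) * X ^ 2
      + (2 * C a ^ 3 - 7 * C a * C b + 9 * C c) * X
      + (C a ^ 2 * C b + 3 * C a * C c - 4 * C b ^ 2)), ?_⟩
  have h1 : C (cubicDisc 1 a b c)⁻¹ * C (cubicDisc 1 a b c) = (1 : F[X]) := by
    rw [← C_mul, inv_mul_cancel₀ h, C_1]
  have h2 : C (cubicDisc 1 a b c) = C a ^ 2 * C b ^ 2 - 4 * C b ^ 3 - 4 * C a ^ 3 * C c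
      - 27 * C c ^ 2 + 18 * C a * C b * C c := by
    simp only [cubicDisc, C_sub, C_add, C_mul, C_pow, one_pow, mul_one, C_ofNat]
  rw [h2] at h1
  unfold cubicPoly cubicPolyDeriv
  linear_combination h1

lemma natDegree_cubicPoly (a b c : F) : (cubicPoly a b c).natDegree = 3 := by
  unfold cubicPoly; compute_degree!

variable (a b c : F) (p r : F[X])

/-- The numerator of `x(P + Q) x(P - Q)`, for `x(P) = p / r` and `x(Q) = X`. -/
noncomputable def kummerProd : F[X] :=
  (p * X - C b * r) ^ 2 - 4 * C c * r * (p + X * r + C a * r)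

/-- The numerator of `x(P + Q) + x(P - Q)`, for `x(P) = p / r` and `x(Q) = X`. -/
noncomputable def kummerSum : F[X] :=
  2 * ((p + X * r) * (p * X + C b * r) + 2 * C c * r ^ 2 + 2 * C a * p * X * r)

/-- The common denominator of `kummerProd` and `kummerSum`. -/
noncomputable def kummerDen : F[X] := (p - X * r) ^ 2

variable {a b c p r}

lemma kummer_primitive (h2 : (2 : F) ≠ 0) (hΔ : cubicDisc 1 a b c ≠ 0) (hpr : IsCoprime p r)
    {π : F[X]} (hπ : Prime π) (hB : π ∣ kummerProd a b c p r) (hA : π ∣ kummerSum a b c p r)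
    (hD : π ∣ kummerDen p r) : False := by
  have hδ : π ∣ p - X * r := hπ.dvd_of_dvd_pow hD
  have hr : ¬ π ∣ r := by
    intro hr
    have hp : π ∣ p := by
      have := dvd_add hδ (hr.mul_left X)
      simpa using this
    exact hπ.not_isUnit (hpr.isUnit_of_dvd' hp hr)
  have hu : IsUnit (4 : F[X]) := by
    have : (4 : F[X]) = C (2 * 2) := by rw [C_mul, C_ofNat]; norm_num
    rw [this]
    exact (mul_ne_zero h2 h2).isUnit.map C
  have h1 : π ∣ cubicPoly a b c := by
    have h : π ∣ 4 * (r ^ 2 * cubicPoly a b c) := by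
      have e : 4 * (r ^ 2 * cubicPoly a b c) = kummerSum a b c p r
          - (p - X * r) * (2 * (p * X + C b * r) + 4 * X ^ 2 * r + 4 * C a * X * r) := by
        unfold cubicPoly kummerSum; ring
      rw [e]
      exact dvd_sub hA (hδ.mul_right _)
    rw [hu.dvd_mul_left] at h
    exact (hπ.dvd_or_dvd h).resolve_left fun h => hr (hπ.dvd_of_dvd_pow h)
  have h3 : π ∣ cubicPolyDeriv a b := by
    have h : π ∣ r ^ 2 * cubicPolyDeriv a b ^ 2 := by
      have e : r ^ 2 * cubicPolyDeriv a b ^ 2 = kummerProd a b c p r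
          - (p - X * r) * (X * (p * X + X ^ 2 * r - 2 * C b * r) - 4 * C c * r)
          + cubicPoly a b c * (r ^ 2 * (8 * X + 4 * C a)) := by
        unfold cubicPoly cubicPolyDeriv kummerProd; ring
      rw [e]
      exact dvd_add (dvd_sub hB (hδ.mul_right _)) (h1.mul_right _)
    exact hπ.dvd_of_dvd_pow ((hπ.dvd_or_dvd h).resolve_left fun h => hr (hπ.dvd_of_dvd_pow h))
  exact hπ.not_isUnit ((isCoprime_cubicPoly_deriv hΔ).isUnit_of_dvd' h1 h3)

lemma natDegree_C_mul_le_of_le {s : F[X]} {d : ℕ} (x : F) (h : s.natDegree ≤ d) :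
    (C x * s).natDegree ≤ d := (natDegree_C_mul_le x s).trans h

lemma natDegree_X_mul_le_of_degree_lt (h : r.degree < p.degree) :
    (X * r).natDegree ≤ p.natDegree ∧ r.natDegree ≤ p.natDegree := by
  rcases eq_or_ne r 0 with rfl | hr
  · simp
  · have := natDegree_lt_natDegree hr h
    rw [natDegree_X_mul hr]
    omega

lemma natDegree_kummerProd (h : r.degree < p.degree) :
    (kummerProd a b c p r).natDegree = 2 * p.natDegree + 2 := by
  obtain ⟨hX, hr⟩ := natDegree_X_mul_le_of_degree_lt h
  have hp : p ≠ 0 := by rintro rfl; simp at h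
  have h1 : (p * X - C b * r).natDegree = p.natDegree + 1 := by
    rw [natDegree_sub_eq_left_of_natDegree_lt, natDegree_mul_X hp]
    rw [natDegree_mul_X hp]
    exact Nat.lt_succ_of_le (natDegree_C_mul_le_of_le b hr)
  have h3 : (4 * C c * r * (p + X * r + C a * r)).natDegree ≤ 2 * p.natDegree := by
    have e : 4 * C c * r * (p + X * r + C a * r) = (C (4 * c) * r) * (p + X * r + C a * r) := by
      rw [C_mul, C_ofNat]
    rw [e, two_mul]
    exact natDegree_mul_le_of_le (natDegree_C_mul_le_of_le _ hr)
      (natDegree_add_le_of_degree_le (natDegree_add_le_of_degree_le le_rfl hX)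
        (natDegree_C_mul_le_of_le _ hr))
  unfold kummerProd
  rw [natDegree_sub_eq_left_of_natDegree_lt, natDegree_pow, h1]
  · ring
  · rw [natDegree_pow, h1]; omega

lemma natDegree_kummerSum_le (h : r.degree < p.degree) :
    (kummerSum a b c p r).natDegree ≤ 2 * p.natDegree + 1 := by
  obtain ⟨hX, hr⟩ := natDegree_X_mul_le_of_degree_lt h
  have e : kummerSum a b c p r = C 2 * ((p + X * r) * (p * X + C b * r) + C (2 * c) * (r * r)
      + C (2 * a) * (p * (X * r))) := by
    simp only [kummerSum, C_mul, C_ofNat]; ring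
  rw [e]
  have hpX : (p * X).natDegree ≤ p.natDegree + 1 :=
    natDegree_mul_le_of_le le_rfl natDegree_X_le
  refine natDegree_C_mul_le_of_le _ (natDegree_add_le_of_degree_le
    (natDegree_add_le_of_degree_le ?_ ?_) ?_)
  · have h5 := natDegree_mul_le_of_le (natDegree_add_le_of_degree_le (le_refl p.natDegree) hX)
      (natDegree_add_le_of_degree_le hpX ((natDegree_C_mul_le_of_le b hr).trans (Nat.le_succ _)))
    exact h5.trans (by omega)
  · exact natDegree_C_mul_le_of_le _ ((natDegree_mul_le_of_le hr hr).trans (by omega))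
  · exact natDegree_C_mul_le_of_le _ ((natDegree_mul_le_of_le le_rfl hX).trans (by omega))

lemma natDegree_kummerDen_le (h : r.degree < p.degree) :
    (kummerDen p r).natDegree ≤ 2 * p.natDegree := by
  obtain ⟨hX, hr⟩ := natDegree_X_mul_le_of_degree_lt h
  unfold kummerDen
  exact natDegree_pow_le_of_le 2 ((natDegree_sub_le_of_le le_rfl hX).trans (max_self _).le)

lemma natDegree_lt_of_kummer {p₁ r₁ p₂ r₂ : F[X]} {d : ℕ} (h₁ : p₁ ≠ 0) (h₂ : p₂ ≠ 0)
    (hp : p₁.natDegree + p₂.natDegree = 2 * d + 2)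
    (hs : (p₁ * r₂ + r₁ * p₂).natDegree ≤ 2 * d + 1) (hr : (r₁ * r₂).natDegree ≤ 2 * d) :
    r₁.degree < p₁.degree := by
  by_contra hcon
  have hr₁ : r₁ ≠ 0 := by
    rintro rfl
    exact hcon (by simpa [bot_lt_iff_ne_bot] using h₁)
  have h1 : p₁.natDegree ≤ r₁.natDegree := natDegree_le_natDegree (not_lt.1 hcon)
  have h3 : (r₁ * p₂).natDegree = r₁.natDegree + p₂.natDegree := natDegree_mul hr₁ h₂
  have h4 : (p₁ * r₂).natDegree < (r₁ * p₂).natDegree := by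
    rcases eq_or_ne r₂ 0 with rfl | hr₂
    · simp; omega
    · rw [natDegree_mul hr₁ hr₂] at hr
      rw [natDegree_mul h₁ hr₂]
      omega
  rw [natDegree_add_eq_right_of_natDegree_lt h4] at hs
  omega

lemma kummer_step (h2 : (2 : F) ≠ 0) (hΔ : cubicDisc 1 a b c ≠ 0) (hpr : IsCoprime p r)
    (hdeg : r.degree < p.degree) {p₁ r₁ p₂ r₂ u v : F[X]} (h₁ : IsCoprime p₁ r₁)
    (h₂ : IsCoprime p₂ r₂) (huv : IsCoprime u v) (hu : u ≠ 0)
    (hB : v * (p₁ * p₂) = u * kummerProd a b c p r)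
    (hA : v * (p₁ * r₂ + r₁ * p₂) = u * kummerSum a b c p r)
    (hD : v * (r₁ * r₂) = u * kummerDen p r) :
    p₁.natDegree + p₂.natDegree = 2 * p.natDegree + 2 ∧ r₁.degree < p₁.degree ∧
      r₂.degree < p₂.degree := by
  have hB0 : kummerProd a b c p r ≠ 0 := by
    intro h0
    have := natDegree_kummerProd (a := a) (b := b) (c := c) hdeg
    rw [h0, natDegree_zero] at this
    omega
  have hv0 : v ≠ 0 := by
    rintro rfl
    rw [zero_mul] at hB
    exact mul_ne_zero hu hB0 hB.symm
  have hprod : v * (p₁ * p₂) ≠ 0 := hB ▸ mul_ne_zero hu hB0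
  have hp₁ : p₁ ≠ 0 := by rintro rfl; simp at hprod
  have hp₂ : p₂ ≠ 0 := by rintro rfl; simp at hprod
  have hvu : IsUnit v := by
    by_contra hv
    obtain ⟨π, hπ, hd⟩ := WfDvdMonoid.exists_irreducible_factor hv hv0
    have hP := hπ.prime
    have hnu : ¬ π ∣ u := fun h => hP.not_isUnit (huv.isUnit_of_dvd' h hd)
    refine kummer_primitive h2 hΔ hpr hP ?_ ?_ ?_
    · exact (hP.dvd_or_dvd (hB ▸ hd.mul_right _)).resolve_left hnu
    · exact (hP.dvd_or_dvd (hA ▸ hd.mul_right _)).resolve_left hnu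
    · exact (hP.dvd_or_dvd (hD ▸ hd.mul_right _)).resolve_left hnu
  have huu : IsUnit u := by
    by_contra hv
    obtain ⟨π, hπ, hd⟩ := WfDvdMonoid.exists_irreducible_factor hv hu
    have hP := hπ.prime
    have hnu : ¬ π ∣ v := fun h => hP.not_isUnit (huv.isUnit_of_dvd' hd h)
    have d1 := (hP.dvd_or_dvd (hB ▸ hd.mul_right _)).resolve_left hnu
    have d2 := (hP.dvd_or_dvd (hA ▸ hd.mul_right _)).resolve_left hnu
    have d3 := (hP.dvd_or_dvd (hD ▸ hd.mul_right _)).resolve_left hnu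
    have n1 : π ∣ p₁ → ¬ π ∣ r₁ := fun x y => hP.not_isUnit (h₁.isUnit_of_dvd' x y)
    have n2 : π ∣ p₂ → ¬ π ∣ r₂ := fun x y => hP.not_isUnit (h₂.isUnit_of_dvd' x y)
    rcases hP.dvd_or_dvd d1 with d | d
    · have d4 : π ∣ r₁ * p₂ := (dvd_add_right (d.mul_right _)).1 d2
      have d5 := (hP.dvd_or_dvd d4).resolve_left (n1 d)
      rcases hP.dvd_or_dvd d3 with d6 | d6
      · exact n1 d d6
      · exact n2 d5 d6
    · have d4 : π ∣ p₁ * r₂ := (dvd_add_left (d.mul_left _)).1 d2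
      have d5 := (hP.dvd_or_dvd d4).resolve_right (n2 d)
      rcases hP.dvd_or_dvd d3 with d6 | d6
      · exact n1 d5 d6
      · exact n2 d d6
  have nd : ∀ {s t : F[X]}, v * s = u * t → s.natDegree = t.natDegree := by
    intro s t h
    obtain ⟨x, hx, rfl⟩ := Polynomial.isUnit_iff.1 hvu
    obtain ⟨y, hy, rfl⟩ := Polynomial.isUnit_iff.1 huu
    have := congrArg natDegree h
    rwa [natDegree_C_mul hx.ne_zero, natDegree_C_mul hy.ne_zero] at this
  have e1 := nd hB
  rw [natDegree_mul hp₁ hp₂, natDegree_kummerProd hdeg] at e1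
  have e2 := (nd hA).trans_le (natDegree_kummerSum_le hdeg)
  have e3 := (nd hD).trans_le (natDegree_kummerDen_le hdeg)
  refine ⟨e1, natDegree_lt_of_kummer hp₁ hp₂ e1 e2 e3, ?_⟩
  refine natDegree_lt_of_kummer hp₂ hp₁ (by omega) (d := p.natDegree) (r₂ := r₁) ?_ ?_
  · rwa [add_comm, mul_comm p₂ r₁, mul_comm r₂ p₁, add_comm, add_comm]
  · rwa [mul_comm]

end KummerPolynomials

section FrobeniusDifference
open Polynomial Finset

variable {F : Type} [Field F] [Fintype F] [DecidableEq F]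

lemma X_pow_card_sub_X_eq_prod :
    (X ^ Fintype.card F - X : F[X]) = ∏ α : F, (X - C α) := by
  have hq : 1 < Fintype.card F := Fintype.one_lt_card
  have hm : (X ^ Fintype.card F - X : F[X]).Monic :=
    monic_X_pow_sub (by rw [degree_X]; exact_mod_cast hq)
  have h := prod_multiset_X_sub_C_of_monic_of_roots_card_eq hm (by
    rw [FiniteField.roots_X_pow_card_sub_X, FiniteField.X_pow_card_sub_X_natDegree_eq F hq]
    rfl)
  rw [FiniteField.roots_X_pow_card_sub_X] at h
  exact h.symm

lemma prod_X_sub_C_dvd {s : Finset F} {f : F[X]} (h : ∀ α ∈ s, f.eval α = 0) :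
    ∏ α ∈ s, (X - C α) ∣ f :=
  Finset.prod_dvd_of_coprime
    (fun _ _ _ _ hab => pairwise_coprime_X_sub_C Function.injective_id hab)
    fun α hα => dvd_iff_isRoot.2 (h α hα)

lemma isCoprime_prod_X_sub_C {s : Finset F} {f : F[X]} (h : ∀ α ∈ s, f.eval α ≠ 0) :
    IsCoprime f (∏ α ∈ s, (X - C α)) := by
  refine IsCoprime.prod_right fun α hα => IsCoprime.symm ?_
  refine ((irreducible_X_sub_C α).coprime_iff_not_dvd).2 fun hd => h α hα ?_
  exact dvd_iff_isRoot.1 hd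

lemma natDegree_prod_X_sub_C (s : Finset F) : (∏ α ∈ s, (X - C α)).natDegree = s.card := by
  rw [natDegree_prod_of_monic _ _ fun α _ => monic_X_sub_C α]
  simp

lemma eval_cubicPoly (a b c α : F) :
    (cubicPoly a b c).eval α = α ^ 3 + a * α ^ 2 + b * α + c := by
  simp [cubicPoly]

lemma derivative_cubicPoly (a b c : F) :
    derivative (cubicPoly a b c) = cubicPolyDeriv a b := by
  simp only [cubicPoly, cubicPolyDeriv, derivative_add, derivative_mul, derivative_X_pow,
    derivative_C, derivative_X]
  simp only [Nat.cast_ofNat, Nat.reduceSub, pow_one, mul_one, zero_mul, zero_add, add_zero]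
  simp only [C_ofNat]
  ring

/-- The number of affine points on `y² = x³ + ax² + bx + c`, counted by the quadratic
character of the right-hand side. -/
lemma card_affine (h2 : (2 : F) ≠ 0) (f : F → F) :
    Fintype.card {s : F × F // s.2 ^ 2 = f s.1}
      = #{α | f α = 0} + 2 * #{α | f α ≠ 0 ∧ IsSquare (f α)} := by
  have hsq : ∀ d : F, #{y : F | y ^ 2 = d}
      = (if d = 0 then 1 else 0) + 2 * (if d ≠ 0 ∧ IsSquare d then 1 else 0) := by
    intro d
    by_cases hd : d = 0
    · subst hd
      have hset : ({y : F | y ^ 2 = 0} : Finset F) = {0} := by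
        ext y
        simp
      rw [hset]
      simp
    by_cases hs : IsSquare d
    · obtain ⟨e, rfl⟩ := hs
      have he : e ≠ 0 := by rintro rfl; simp at hd
      have hset : ({y : F | y ^ 2 = e * e} : Finset F) = {e, -e} := by
        ext y
        simp only [mem_filter, mem_univ, true_and, mem_insert, mem_singleton]
        rw [← sq, sq_eq_sq_iff_eq_or_eq_neg]
      rw [hset, card_pair]
      · simp [he]
      · intro h0
        exact mul_ne_zero h2 he (by linear_combination h0)
    · have hset : ({y : F | y ^ 2 = d} : Finset F) = ∅ := by
        ext y
        simp only [mem_filter, mem_univ, true_and, notMem_empty, iff_false]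
        rintro rfl
        exact hs ⟨y, sq y⟩
      rw [hset]
      simp [hd, hs]
  rw [Fintype.card_subtype]
  have h1 : #{s : F × F | s.2 ^ 2 = f s.1} = ∑ α : F, #{y : F | y ^ 2 = f α} := by
    rw [card_filter, ← univ_product_univ, sum_product]
    simp only [card_filter]
  rw [h1, sum_congr rfl fun α _ => hsq (f α), sum_add_distrib, ← mul_sum, ← card_filter,
    ← card_filter]

lemma exists_frobenius_sub (hodd : Odd (Fintype.card F)) {a b c : F}
    (hΔ : cubicDisc 1 a b c ≠ 0) {m : ℕ} (hm : Fintype.card F = 2 * m + 1) :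
    ∃ p r : F[X], IsCoprime p r ∧ r ≠ 0 ∧
      p.natDegree = 1 + Fintype.card
        {s : F × F // s.2 ^ 2 = s.1 ^ 3 + a * s.1 ^ 2 + b * s.1 + c} ∧
      p * (X ^ Fintype.card F - X) ^ 2 = r * (cubicPoly a b c * (cubicPoly a b c ^ m + 1) ^ 2
        - (C a + X ^ Fintype.card F + X) * (X ^ Fintype.card F - X) ^ 2) := by
  have h2 := two_ne_zero_of_odd hodd
  have hchar : ringChar F ≠ 2 := fun h => h2 (by
    have := CharP.cast_eq_zero F (ringChar F)
    rw [h] at this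
    exact_mod_cast this)
  have hdiv : Fintype.card F / 2 = m := by omega
  have hm1 : 1 ≤ m := by
    have := Fintype.one_lt_card (α := F)
    omega
  set q := Fintype.card F with hq
  set f : F → F := fun x => x ^ 3 + a * x ^ 2 + b * x + c with hf
  rw [card_affine h2 f]
  set s₀ : Finset F := {α | f α = 0} with hs₀
  set s₁ : Finset F := {α | f α ≠ 0 ∧ IsSquare (f α)} with hs₁
  set s₂ : Finset F := {α | ¬ IsSquare (f α)} with hs₂
  set R₀ : F[X] := ∏ α ∈ s₀, (X - C α)
  set R₁ : F[X] := ∏ α ∈ s₁, (X - C α)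
  set R₂ : F[X] := ∏ α ∈ s₂, (X - C α)
  have hprod : (X ^ q - X : F[X]) = R₀ * R₁ * R₂ := by
    rw [hq, X_pow_card_sub_X_eq_prod]
    have d1 : Disjoint s₀ s₁ := by
      rw [disjoint_left]; intro x h h'
      simp only [hs₀, hs₁, mem_filter, mem_univ, true_and] at h h'
      exact h'.1 h
    have d2 : Disjoint (s₀ ∪ s₁) s₂ := by
      rw [disjoint_left]; intro x h h'
      simp only [hs₀, hs₁, hs₂, mem_union, mem_filter, mem_univ, true_and] at h h'
      rcases h with h | h
      · exact h' (h ▸ IsSquare.zero)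
      · exact h' h.2
    have hu : (univ : Finset F) = (s₀ ∪ s₁) ∪ s₂ := by
      ext x
      simp only [hs₀, hs₁, hs₂, mem_union, mem_filter, mem_univ, true_and, true_iff]
      tauto
    rw [hu, prod_union d2, prod_union d1]
  have hcard : s₀.card + s₁.card + s₂.card = q := by
    have h1 := congrArg natDegree hprod
    have hm0 : R₀.Monic := monic_prod_of_monic _ _ fun α _ => monic_X_sub_C α
    have hm1 : R₁.Monic := monic_prod_of_monic _ _ fun α _ => monic_X_sub_C α
    have hm2 : R₂.Monic := monic_prod_of_monic _ _ fun α _ => monic_X_sub_C α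
    rw [FiniteField.X_pow_card_sub_X_natDegree_eq F Fintype.one_lt_card,
      (hm0.mul hm1).natDegree_mul hm2, hm0.natDegree_mul hm1, natDegree_prod_X_sub_C,
      natDegree_prod_X_sub_C, natDegree_prod_X_sub_C] at h1
    exact h1.symm
  have hev : ∀ α, (cubicPoly a b c).eval α = f α := fun α => eval_cubicPoly a b c α
  obtain ⟨Λ', hΛ'⟩ : R₀ ∣ cubicPoly a b c := prod_X_sub_C_dvd fun α hα => by
    rw [hev]; exact (mem_filter.1 hα).2
  have hevm : ∀ α, (cubicPoly a b c ^ m + 1).eval α = f α ^ m + 1 := fun α => by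
    simp [hev]
  obtain ⟨S, hS⟩ : R₂ ∣ cubicPoly a b c ^ m + 1 := prod_X_sub_C_dvd fun α hα => by
    have hα' : ¬ IsSquare (f α) := (mem_filter.1 hα).2
    have h0 : f α ≠ 0 := fun h => hα' (h ▸ IsSquare.zero)
    rw [hevm]
    rcases FiniteField.pow_dichotomy hchar h0 with h | h
    · exact absurd ((FiniteField.isSquare_iff hchar h0).2 h) hα'
    · rw [hdiv] at h; rw [h]; ring
  have hS0 : ∀ α, f α = 0 ∨ (f α ≠ 0 ∧ IsSquare (f α)) → S.eval α ≠ 0 := by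
    intro α hα h0
    have h1 := congrArg (eval α) hS
    rw [hevm, eval_mul, h0, mul_zero] at h1
    rcases hα with h | ⟨h, h'⟩
    · rw [h, zero_pow (by omega)] at h1; simp at h1
    · rw [FiniteField.isSquare_iff hchar h, hdiv] at h'
      rw [h'] at h1
      exact h2 (by linear_combination h1)
  have hΛ0 : ∀ α, f α = 0 → Λ'.eval α ≠ 0 := by
    intro α hα h0
    have hd1 : (X - C α) ∣ cubicPoly a b c := dvd_iff_isRoot.2 (by rw [IsRoot, hev, hα])
    have hd2 : (X - C α) ∣ cubicPolyDeriv a b := by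
      rw [← derivative_cubicPoly a b c, dvd_iff_isRoot, IsRoot, hΛ', derivative_mul, eval_add,
        eval_mul, eval_mul, h0]
      have hR : R₀.eval α = 0 := by
        rw [eval_prod]
        exact prod_eq_zero (i := α) (mem_filter.2 ⟨mem_univ _, hα⟩) (by simp)
      rw [hR]; ring
    exact not_isUnit_X_sub_C α ((isCoprime_cubicPoly_deriv hΔ).isUnit_of_dvd' hd1 hd2)
  have hΛ1 : ∀ α, f α ≠ 0 → Λ'.eval α ≠ 0 := by
    intro α hα h0
    apply hα
    rw [← hev, hΛ', eval_mul, h0, mul_zero]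
  have hR0 : R₀ ≠ 0 := (monic_prod_of_monic _ _ fun α _ => monic_X_sub_C α).ne_zero
  have hR1 : R₁ ≠ 0 := (monic_prod_of_monic _ _ fun α _ => monic_X_sub_C α).ne_zero
  have hR2 : R₂ ≠ 0 := (monic_prod_of_monic _ _ fun α _ => monic_X_sub_C α).ne_zero
  have hcop : IsCoprime (Λ' * S ^ 2) (R₀ * R₁ ^ 2) := by
    refine IsCoprime.mul_right ?_ (IsCoprime.pow_right ?_)
    · refine isCoprime_prod_X_sub_C fun α hα => ?_
      have hα' : f α = 0 := (mem_filter.1 hα).2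
      rw [eval_mul, eval_pow]
      exact mul_ne_zero (hΛ0 α hα') (pow_ne_zero 2 (hS0 α (Or.inl hα')))
    · refine isCoprime_prod_X_sub_C fun α hα => ?_
      have hα' := (mem_filter.1 hα).2
      rw [eval_mul, eval_pow]
      exact mul_ne_zero (hΛ1 α hα'.1) (pow_ne_zero 2 (hS0 α (Or.inr hα')))
  set p : F[X] := Λ' * S ^ 2 - (C a + X ^ q + X) * (R₀ * R₁ ^ 2) with hp
  have hnum : p * (R₀ * R₂ ^ 2) = cubicPoly a b c * (cubicPoly a b c ^ m + 1) ^ 2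
        - (C a + X ^ q + X) * (X ^ q - X) ^ 2 := by
    rw [hS, hprod, hp]
    linear_combination (-R₂ ^ 2 * S ^ 2) * hΛ'
  have hdeg : (cubicPoly a b c * (cubicPoly a b c ^ m + 1) ^ 2
        - (C a + X ^ q + X) * (X ^ q - X) ^ 2).natDegree = 2 * q + 1 := by
    have hexp : cubicPoly a b c ^ q = X ^ (3 * q) + C a * X ^ (2 * q) + C b * X ^ q + C c := by
      rw [hq, ← FiniteField.expand_card]
      simp only [cubicPoly, map_add, map_mul, map_pow, expand_C, expand_X, ← pow_mul]
      ring
    have e : cubicPoly a b c * (cubicPoly a b c ^ m + 1) ^ 2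
        - (C a + X ^ q + X) * (X ^ q - X) ^ 2 = X ^ (2 * q + 1)
        + (X ^ (q + 2) + C (2 * a) * X ^ (q + 1) + C b * X ^ q
          + C 2 * cubicPoly a b c ^ (m + 1) + cubicPoly a b c + C c - C a * X ^ 2 - X ^ 3) := by
      have h3 : cubicPoly a b c * (cubicPoly a b c ^ m + 1) ^ 2 = cubicPoly a b c ^ q
          + 2 * cubicPoly a b c ^ (m + 1) + cubicPoly a b c := by
        rw [hm]; ring
      rw [h3, hexp, C_mul, C_ofNat]
      ring
    rw [e]
    have hrest : (X ^ (q + 2) + C (2 * a) * X ^ (q + 1) + C b * X ^ q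
          + C 2 * cubicPoly a b c ^ (m + 1) + cubicPoly a b c + C c - C a * X ^ 2
          - X ^ 3 : F[X]).natDegree ≤ 2 * q := by
      have hcp : (cubicPoly a b c ^ (m + 1)).natDegree ≤ 2 * q := by
        rw [natDegree_pow, natDegree_cubicPoly]; omega
      have hc1 : (cubicPoly a b c).natDegree ≤ 2 * q := by
        rw [natDegree_cubicPoly]; omega
      have hX : ∀ j, j ≤ 2 * q → (X ^ j : F[X]).natDegree ≤ 2 * q := fun j hj => by
        rw [natDegree_X_pow]; exact hj
      refine (natDegree_sub_le_of_le (natDegree_sub_le_of_le (natDegree_add_le_of_degree_le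
        (natDegree_add_le_of_degree_le (natDegree_add_le_of_degree_le
        (natDegree_add_le_of_degree_le (natDegree_add_le_of_degree_le (hX _ (by omega))
        (natDegree_C_mul_le_of_le _ (hX _ (by omega))))
        (natDegree_C_mul_le_of_le _ (hX _ (by omega)))) (natDegree_C_mul_le_of_le _ hcp)) hc1)
        (by simp)) (natDegree_C_mul_le_of_le _ (hX _ (by omega)))) (hX _ (by omega))).trans ?_
      simp
    rw [natDegree_add_eq_left_of_natDegree_lt, natDegree_X_pow]
    rw [natDegree_X_pow]
    omega
  refine ⟨p, R₀ * R₁ ^ 2, ?_, mul_ne_zero hR0 (pow_ne_zero 2 hR1), ?_, ?_⟩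
  · rw [hp, sub_eq_add_neg, ← neg_mul]
    exact IsCoprime.add_mul_right_left hcop _
  · have hp0 : p ≠ 0 := by
      intro h0
      rw [← hnum, h0, zero_mul, natDegree_zero] at hdeg
      omega
    rw [← hnum, natDegree_mul hp0 (mul_ne_zero hR0 (pow_ne_zero 2 hR2)),
      natDegree_mul hR0 (pow_ne_zero 2 hR2), natDegree_pow, natDegree_prod_X_sub_C,
      natDegree_prod_X_sub_C] at hdeg
    omega
  · rw [← hnum, hprod]; ring

end FrobeniusDifference

section Hasse
open Polynomial WeierstrassCurve

variable {F : Type} [Field F]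

/-- The quadratic twist of `y² = x³ + ax² + bx + c` by `X³ + aX² + bX + c` over the field of
rational functions. -/
noncomputable def twist (a b c : F) : WeierstrassCurve (RatFunc F) :=
  shortCurve (algebraMap F[X] (RatFunc F) (C a * cubicPoly a b c))
    (algebraMap F[X] (RatFunc F) (C b * cubicPoly a b c ^ 2))
    (algebraMap F[X] (RatFunc F) (C c * cubicPoly a b c ^ 3))

/-- `x(P) / λ = p / r` in lowest terms, where `λ` is the twisting polynomial. -/
def IsReduced {a b c : F} (P : (twist a b c).toAffine.Point) (p r : F[X]) : Prop :=
  IsCoprime p r ∧ ∃ s : RatFunc F, s ≠ 0 ∧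
    P.xRep 0 = s * algebraMap F[X] (RatFunc F) (cubicPoly a b c * p) ∧
    P.xRep 1 = s * algebraMap F[X] (RatFunc F) r

variable {a b c : F}

lemma cubicPoly_ne_zero : cubicPoly a b c ≠ 0 := by
  intro h
  have := natDegree_cubicPoly a b c
  rw [h] at this
  simp at this

lemma algebraMap_ne_zero {p : F[X]} (hp : p ≠ 0) : algebraMap F[X] (RatFunc F) p ≠ 0 :=
  (map_ne_zero_iff _ (IsFractionRing.injective F[X] (RatFunc F))).2 hp

lemma exists_isReduced (P : (twist a b c).toAffine.Point) : ∃ p r, IsReduced P p r := by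
  have hl := algebraMap_ne_zero (cubicPoly_ne_zero (a := a) (b := b) (c := c))
  rcases P with _ | ⟨x, y, h⟩
  · refine ⟨1, 0, isCoprime_one_left, (algebraMap F[X] (RatFunc F) (cubicPoly a b c))⁻¹,
      inv_ne_zero hl, ?_, ?_⟩
    · rw [mul_one, inv_mul_cancel₀ hl]; rfl
    · rw [map_zero, mul_zero]; rfl
  · obtain ⟨z, hz⟩ : ∃ z, x = z * algebraMap F[X] (RatFunc F) (cubicPoly a b c) :=
      ⟨_, (div_mul_cancel₀ _ hl).symm⟩
    have hd := algebraMap_ne_zero z.denom_ne_zero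
    refine ⟨z.num, z.denom, z.isCoprime_num_denom, (algebraMap F[X] (RatFunc F) z.denom)⁻¹,
      inv_ne_zero hd, ?_, ?_⟩
    · rw [Affine.Point.xRep_some, map_mul]
      have h1 := z.num_div_denom
      rw [div_eq_iff hd] at h1
      rw [h1, hz]
      simp only [Matrix.cons_val_zero]
      rw [mul_left_comm, mul_left_comm (algebraMap F[X] (RatFunc F) z.denom)⁻¹,
        inv_mul_cancel₀ hd, mul_one, mul_comm]
    · rw [inv_mul_cancel₀ hd]; rfl

lemma IsReduced.degree_eq {P : (twist a b c).toAffine.Point} {p r p' r' : F[X]}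
    (h : IsReduced P p r) (h' : IsReduced P p' r') :
      p.degree = p'.degree ∧ r.degree = r'.degree := by
  obtain ⟨hc, s, hs, h0, h1⟩ := h
  obtain ⟨hc', s', hs', h0', h1'⟩ := h'
  have hl := algebraMap_ne_zero (cubicPoly_ne_zero (a := a) (b := b) (c := c))
  have e : p * r' = p' * r := by
    apply IsFractionRing.injective F[X] (RatFunc F)
    rw [h0] at h0'
    rw [h1] at h1'
    rw [map_mul] at h0' ⊢
    rw [map_mul] at h0' ⊢
    apply mul_left_cancel₀ (mul_ne_zero (mul_ne_zero hs hs') hl)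
    linear_combination s' * algebraMap F[X] (RatFunc F) r' * h0' -
      s' * algebraMap F[X] (RatFunc F) (cubicPoly a b c) * algebraMap F[X] (RatFunc F) p' * h1'
  have d1 : p ∣ p' := hc.dvd_of_dvd_mul_right ⟨r', e.symm⟩
  have d2 : p' ∣ p := hc'.dvd_of_dvd_mul_right ⟨r, e⟩
  have d3 : r ∣ r' := hc.symm.dvd_of_dvd_mul_left ⟨p', by rw [e, mul_comm]⟩
  have d4 : r' ∣ r := hc'.symm.dvd_of_dvd_mul_left ⟨p, by rw [← e, mul_comm]⟩
  exact ⟨degree_eq_degree_of_associated (associated_of_dvd_dvd d1 d2),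
    degree_eq_degree_of_associated (associated_of_dvd_dvd d3 d4)⟩

variable [DecidableEq (RatFunc F)]

lemma IsReduced.step (h2 : (2 : F) ≠ 0) (hΔ : cubicDisc 1 a b c ≠ 0)
    {P P₁ P₂ Q : (twist a b c).toAffine.Point} {x y : RatFunc F}
    {hxy : (twist a b c).toAffine.Nonsingular x y} (hQ : Q = .some x y hxy)
    (hx : x = algebraMap F[X] (RatFunc F) (cubicPoly a b c * X)) (hy : 2 * y ≠ 0)
    (hP₁ : P₁ = P + Q) (hP₂ : P₂ = P - Q)
    {p r p₁ r₁ p₂ r₂ : F[X]} (h : IsReduced P p r) (h₁ : IsReduced P₁ p₁ r₁)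
    (h₂ : IsReduced P₂ p₂ r₂) (hdeg : r.degree < p.degree) :
    p₁.natDegree + p₂.natDegree = 2 * p.natDegree + 2 ∧ r₁.degree < p₁.degree ∧
      r₂.degree < p₂.degree := by
  subst hP₁ hP₂ hQ
  obtain ⟨hc, s, hs, h0, h1⟩ := h
  obtain ⟨hc₁, s₁, hs₁, h0₁, h1₁⟩ := h₁
  obtain ⟨hc₂, s₂, hs₂, h0₂, h1₂⟩ := h₂
  obtain ⟨κ, hκ, hB, hA, hD⟩ := exists_xRep_add_sub hxy hy P
  have hl := algebraMap_ne_zero (cubicPoly_ne_zero (a := a) (b := b) (c := c))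
  unfold twist at h0₁ h0₂ h1₁ h1₂ h0 h1
  rw [h0₁, h0₂, h0, h1, hx] at hB
  rw [h0₁, h1₂, h1₁, h0₂, h0, h1, hx] at hA
  rw [h1₁, h1₂, h0, h1, hx] at hD
  set φ := algebraMap F[X] (RatFunc F) with hφ
  set w : RatFunc F := κ * s ^ 2 * φ (cubicPoly a b c) ^ 2 / (s₁ * s₂) with hw
  have hs₁₂ : s₁ * s₂ ≠ 0 := mul_ne_zero hs₁ hs₂
  have hw' : w * (s₁ * s₂) = κ * s ^ 2 * φ (cubicPoly a b c) ^ 2 := by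
    rw [hw, div_mul_cancel₀ _ hs₁₂]
  have hw0 : w ≠ 0 := by
    rw [hw]
    exact div_ne_zero (mul_ne_zero (mul_ne_zero hκ (pow_ne_zero 2 hs)) (pow_ne_zero 2 hl)) hs₁₂
  have hd := algebraMap_ne_zero w.denom_ne_zero
  have hnd : φ w.num = w * φ w.denom := by
    have := w.num_div_denom
    rwa [div_eq_iff hd] at this
  have h4 : φ 4 = 4 := map_ofNat φ 4
  have h2' : φ 2 = 2 := map_ofNat φ 2
  refine kummer_step h2 hΔ hc hdeg (u := w.num) (v := w.denom) hc₁ hc₂ w.isCoprime_num_denom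
    (RatFunc.num_ne_zero hw0) ?_ ?_ ?_
  · apply IsFractionRing.injective F[X] (RatFunc F)
    rw [← hφ]
    simp only [map_mul, map_add, map_sub, map_pow, kummerProd, hnd, h4] at hB ⊢
    apply mul_left_cancel₀ (mul_ne_zero hs₁₂ (pow_ne_zero 2 hl))
    linear_combination φ w.denom * hB - φ w.denom * φ (cubicPoly a b c) ^ 2 *
      ((φ p * φ X - φ (C b) * φ r) ^ 2
        - 4 * φ (C c) * φ r * (φ p + φ X * φ r + φ (C a) * φ r)) * hw'
  · apply IsFractionRing.injective F[X] (RatFunc F)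
    rw [← hφ]
    simp only [map_mul, map_add, map_pow, kummerSum, hnd, h2'] at hA ⊢
    apply mul_left_cancel₀ (mul_ne_zero hs₁₂ hl)
    linear_combination φ w.denom * hA - φ w.denom * φ (cubicPoly a b c) *
      (2 * ((φ p + φ X * φ r) * (φ p * φ X + φ (C b) * φ r) + 2 * φ (C c) * φ r ^ 2
        + 2 * φ (C a) * φ p * φ X * φ r)) * hw'
  · apply IsFractionRing.injective F[X] (RatFunc F)
    rw [← hφ]
    simp only [map_mul, map_sub, map_pow, kummerDen, hnd] at hD ⊢
    apply mul_left_cancel₀ hs₁₂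
    linear_combination φ w.denom * hD - φ w.denom * (φ p - φ X * φ r) ^ 2 * hw'

lemma twist_nonsingular (h2 : (2 : F) ≠ 0) {x y : F[X]} (hy : y ≠ 0)
    (h : cubicPoly a b c * y ^ 2 = x ^ 3 + C a * x ^ 2 + C b * x + C c) :
    (twist a b c).toAffine.Nonsingular (algebraMap F[X] (RatFunc F) (cubicPoly a b c * x))
      (algebraMap F[X] (RatFunc F) (cubicPoly a b c ^ 2 * y)) ∧
    2 * algebraMap F[X] (RatFunc F) (cubicPoly a b c ^ 2 * y) ≠ 0 := by
  have h4 : 2 * algebraMap F[X] (RatFunc F) (cubicPoly a b c ^ 2 * y) ≠ 0 := by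
    have h2' : (2 : F[X]) ≠ 0 := by
      rw [← C_ofNat]
      exact C_ne_zero.2 h2
    have : (2 : RatFunc F) = algebraMap F[X] (RatFunc F) 2 := (map_ofNat _ 2).symm
    rw [this]
    exact mul_ne_zero (algebraMap_ne_zero h2')
      (algebraMap_ne_zero (mul_ne_zero (pow_ne_zero 2 cubicPoly_ne_zero) hy))
  refine ⟨shortCurve_nonsingular_of_ne_zero h4 ?_, h4⟩
  simp only [← map_pow, ← map_mul, ← map_add]
  congr 1
  linear_combination cubicPoly a b c ^ 3 * h

lemma quadratic_bound {q b : ℤ} (h : ∀ n : ℤ, 0 ≤ n ^ 2 + b * n + q)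
    (h' : ∀ n : ℤ, n ^ 2 + b * n + q = 0 → (n + 1) ^ 2 + b * (n + 1) + q ≠ 0) :
    b ^ 2 ≤ 4 * q := by
  rcases Int.even_or_odd' b with ⟨m, rfl | rfl⟩
  · have := h (-m)
    nlinarith
  · have h1 := h (-m - 1)
    have h3 := h' (-m - 1)
    have e : (-m - 1) ^ 2 + (2 * m + 1) * (-m - 1) + q = q - m ^ 2 - m := by ring
    have e' : (-m - 1 + 1) ^ 2 + (2 * m + 1) * (-m - 1 + 1) + q = q - m ^ 2 - m := by ring
    rw [e] at h1 h3
    rw [e'] at h3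
    have h4 : q - m ^ 2 - m ≠ 0 := fun h0 => h3 h0 h0
    have h5 : 1 ≤ q - m ^ 2 - m := by omega
    nlinarith

end Hasse

section HasseBound
open Polynomial WeierstrassCurve

variable {F : Type} [Field F] [Fintype F] [DecidableEq F]

/-- Hasse's theorem for `y² = x³ + ax² + bx + c` in odd characteristic. -/
theorem hasse_bound (hodd : Odd (Fintype.card F)) {a b c : F} (hΔ : cubicDisc 1 a b c ≠ 0) :
    ((Fintype.card F : ℤ) + 1 - (1 + Fintype.card
      {s : F × F // s.2 ^ 2 = s.1 ^ 3 + a * s.1 ^ 2 + b * s.1 + c} : ℕ)) ^ 2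
      ≤ 4 * Fintype.card F := by
  classical
  have h2 := two_ne_zero_of_odd hodd
  obtain ⟨m, hm⟩ := hodd
  obtain ⟨p', r', hcop', hr', hdeg', heq'⟩ := exists_frobenius_sub ⟨m, hm⟩ hΔ hm
  set N := 1 + Fintype.card {s : F × F // s.2 ^ 2 = s.1 ^ 3 + a * s.1 ^ 2 + b * s.1 + c}
  set q := Fintype.card F with hq
  set Λ := cubicPoly a b c with hΛ
  set φ := algebraMap F[X] (RatFunc F) with hφ
  have hexp : Λ ^ q = (X ^ q) ^ 3 + C a * (X ^ q) ^ 2 + C b * X ^ q + C c := by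
    rw [hq, ← FiniteField.expand_card]
    simp only [hΛ, cubicPoly, map_add, map_mul, map_pow, expand_C, expand_X]
  obtain ⟨hns, hy⟩ := twist_nonsingular (a := a) (b := b) (c := c) h2 (x := X) (y := 1)
    one_ne_zero (by rw [one_pow, mul_one, cubicPoly])
  obtain ⟨hns₀, hy₀⟩ := twist_nonsingular (a := a) (b := b) (c := c) h2 (x := X ^ q) (y := Λ ^ m)
    (pow_ne_zero m cubicPoly_ne_zero) (by
      rw [← hexp, hm]; ring)
  set Q : (twist a b c).toAffine.Point := .some _ _ hns with hQ
  set P₀ : (twist a b c).toAffine.Point := .some _ _ hns₀ with hP₀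
  have hl : φ Λ ≠ 0 := algebraMap_ne_zero cubicPoly_ne_zero
  have hT : (X ^ q - X : F[X]) ≠ 0 :=
    FiniteField.X_pow_card_sub_X_ne_zero F Fintype.one_lt_card
  have hred₀ : IsReduced P₀ (X ^ q) 1 := by
    refine ⟨isCoprime_one_right, 1, one_ne_zero, ?_, ?_⟩
    · rw [one_mul]; rfl
    · rw [map_one, one_mul]; rfl
  have hred₁ : IsReduced (P₀ - Q) p' r' := by
    have hne : φ (Λ * X ^ q) ≠ φ (Λ * X) := by
      intro h0
      have := IsFractionRing.injective F[X] (RatFunc F) h0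
      exact hT (sub_eq_zero.2 (mul_left_cancel₀ cubicPoly_ne_zero this))
    have hr0 : φ r' ≠ 0 := algebraMap_ne_zero hr'
    have hT0 : φ (X ^ q) - φ X ≠ 0 := by rw [← map_sub]; exact algebraMap_ne_zero hT
    refine ⟨hcop', (φ r')⁻¹, inv_ne_zero hr0, ?_, ?_⟩
    · rw [sub_eq_add_neg, hQ, hP₀, Affine.Point.neg_some, Affine.Point.add_of_X_ne hne,
        Affine.Point.xRep_some, Affine.slope_of_X_ne hne]
      have hneg : (twist a b c).toAffine.negY (φ (Λ * X)) (φ (Λ ^ 2 * 1)) = -φ (Λ ^ 2 * 1) := by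
        simp [Affine.negY, twist, shortCurve]
      rw [hneg]
      simp only [Affine.addX, twist, shortCurve, Matrix.cons_val_zero, zero_mul, add_zero]
      have e := congrArg φ heq'
      simp only [← hΛ, ← hφ, map_mul, map_sub, map_add, map_pow, map_one, mul_one] at e hT0 ⊢
      have hd : φ Λ * φ X ^ q - φ Λ * φ X = φ Λ * (φ X ^ q - φ X) := by ring
      rw [hd]
      field_simp
      linear_combination -e
    · rw [inv_mul_cancel₀ hr0, sub_eq_add_neg, hQ, hP₀, Affine.Point.neg_some,
        Affine.Point.add_of_X_ne hne]
      rfl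
  choose p r hpr using fun n : ℤ => exists_isReduced (P₀ + n • Q)
  have hstep : ∀ n : ℤ, (r n).degree < (p n).degree →
      (p (n + 1)).natDegree + (p (n - 1)).natDegree = 2 * (p n).natDegree + 2 ∧
      (r (n + 1)).degree < (p (n + 1)).degree ∧ (r (n - 1)).degree < (p (n - 1)).degree := by
    intro n hn
    exact IsReduced.step h2 hΔ hQ rfl hy (by rw [add_zsmul, one_zsmul, add_assoc])
      (by rw [sub_zsmul, one_zsmul, add_sub_assoc, sub_eq_add_neg (n • Q)]) (hpr n)
      (hpr (n + 1)) (hpr (n - 1)) hn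
  have hdeg₀ := (hpr 0).degree_eq (p' := X ^ q) (r' := 1) (by simpa using hred₀)
  have hp0 : (p 0).natDegree = q := by
    rw [natDegree_eq_of_degree_eq hdeg₀.1, natDegree_X_pow]
  have hp1 : (p (-1)).natDegree = N := by
    rw [← hdeg']
    exact natDegree_eq_of_degree_eq
      ((hpr (-1)).degree_eq (by simpa [sub_eq_add_neg] using hred₁)).1
  have hlt : ∀ n : ℤ, (r n).degree < (p n).degree := by
    intro n
    induction n with
    | zero =>
      rw [hdeg₀.1, hdeg₀.2, degree_one, degree_X_pow]
      exact_mod_cast Fintype.card_pos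
    | succ n ih => exact (hstep _ ih).2.1
    | pred n ih => exact (hstep _ ih).2.2
  have hD : ∀ n : ℤ, ((p n).natDegree : ℤ) = n ^ 2 + (q + 1 - N) * n + q ∧
      ((p (n - 1)).natDegree : ℤ) = (n - 1) ^ 2 + (q + 1 - N) * (n - 1) + q := by
    intro n
    induction n with
    | zero =>
      rw [zero_sub, hp0, hp1]
      constructor <;> ring
    | succ n ih =>
      have h := (hstep _ (hlt n)).1
      zify at h
      rw [add_sub_cancel_right]
      exact ⟨by linear_combination h + 2 * ih.1 - ih.2, ih.1⟩
    | pred n ih =>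
      have h := (hstep _ (hlt (-n - 1))).1
      zify at h
      rw [sub_add_cancel] at h
      exact ⟨ih.2, by linear_combination h + 2 * ih.2 - ih.1⟩
  have hzero : ∀ n : ℤ, (p n).natDegree = 0 → P₀ + n • Q = 0 := by
    intro n hn
    have h := hlt n
    have hr : r n = 0 := by
      by_contra hr
      have h3 := natDegree_lt_natDegree hr h
      omega
    obtain ⟨-, s, -, -, h1⟩ := hpr n
    rw [hr, map_zero, mul_zero] at h1
    cases hP : P₀ + n • Q with
    | zero => rfl
    | some x y h' =>
      rw [hP, Affine.Point.xRep_some] at h1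
      simp at h1
  apply quadratic_bound
  · intro n
    rw [← (hD n).1]
    positivity
  · intro n h1 h3
    rw [← (hD n).1] at h1
    rw [← (hD (n + 1)).1] at h3
    have h4 := hzero n (by exact_mod_cast h1)
    have h5 := hzero (n + 1) (by exact_mod_cast h3)
    rw [add_zsmul, one_zsmul, ← add_assoc, h4, zero_add, hQ] at h5
    exact Affine.Point.some_ne_zero _ h5

end HasseBound

section Models
open Matrix

variable {F : Type} [Field F]

/-- The points of `y² = x³ + ax² + bx + c`, with `none` the point at infinity. -/
abbrev CurvePt (a b c : F) : Type :=
  Option {s : F × F // s.2 ^ 2 = s.1 ^ 3 + a * s.1 ^ 2 + b * s.1 + c}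

variable {a b c : F}

lemma eq_zero_iff_coords {u : Fin 3 → F} : u = 0 ↔ u 0 = 0 ∧ u 1 = 0 ∧ u 2 = 0 := by
  constructor
  · rintro rfl
    simp
  · rintro ⟨h0, h1, h2⟩
    ext i
    fin_cases i <;> simp [h0, h1, h2]

lemma deriv_ne_zero_of_root (hΔ : cubicDisc 1 a b c ≠ 0) {x : F}
    (hx : x ^ 3 + a * x ^ 2 + b * x + c = 0) : 3 * x ^ 2 + 2 * a * x + b ≠ 0 := by
  intro h
  apply hΔ
  unfold cubicDisc
  linear_combination ((-6 * a ^ 2 + 18 * b) * x + (-4 * a ^ 3 + 15 * a * b - 27 * c)) * hx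
    + ((2 * a ^ 2 - 6 * b) * x ^ 2 + (2 * a ^ 3 - 7 * a * b + 9 * c) * x
      + (a ^ 2 * b + 3 * a * c - 4 * b ^ 2)) * h

variable [DecidableEq F]

/-- The coordinates `(Z, X, Y)` of a point of the plane cubic. -/
def planePt : CurvePt a b c → Fin 3 → F
  | none => ![0, 0, 1]
  | some s => ![1, s.1.1, s.1.2]

/-- The embedding of the curve as the cubic `Y²Z = X³ + aX²Z + bXZ² + cZ³`. -/
def weierstrassModel (h2 : (2 : F) ≠ 0) (hΔ : cubicDisc 1 a b c ≠ 0) :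
    PlaneModel F (CurvePt a b c) where
  C u := u 2 ^ 2 * u 0 - (u 1 ^ 3 + a * u 1 ^ 2 * u 0 + b * u 1 * u 0 ^ 2 + c * u 0 ^ 3)
  g u := ![u 2 ^ 2 - a * u 1 ^ 2 - 2 * b * u 1 * u 0 - 3 * c * u 0 ^ 2,
    -(3 * u 1 ^ 2 + 2 * a * u 1 * u 0 + b * u 0 ^ 2), 2 * u 2 * u 0]
  expand u v s t := by
    simp only [vec3_dotProduct]
    simp
    ring
  smooth u hu hC hg := by
    have e0 := congrFun hg 0
    have e1 := congrFun hg 1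
    have e2 := congrFun hg 2
    simp at e0 e1 e2
    by_cases h0 : u 0 = 0
    · rw [h0] at hC e0
      have h1 : u 1 = 0 := by
        have : u 1 ^ 3 = 0 := by linear_combination -hC
        simpa using this
      rw [h1] at e0
      have h3 : u 2 = 0 := by
        have : u 2 ^ 2 = 0 := by linear_combination e0
        simpa using this
      exact hu (eq_zero_iff_coords.2 ⟨h0, h1, h3⟩)
    · have h3 : u 2 = 0 := by
        rcases e2 with (h | h) | h
        · exact absurd h h2
        · exact h
        · exact absurd h h0
      rw [h3] at hC
      obtain ⟨x, hx⟩ : ∃ x, u 1 = x * u 0 := ⟨_, (div_mul_cancel₀ _ h0).symm⟩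
      rw [hx] at hC e1
      have hr : x ^ 3 + a * x ^ 2 + b * x + c = 0 := by
        apply mul_left_cancel₀ (pow_ne_zero 3 h0)
        linear_combination -hC
      refine deriv_ne_zero_of_root hΔ hr ?_
      apply mul_left_cancel₀ (pow_ne_zero 2 h0)
      linear_combination -e1
  noline l hl := by
    by_cases h : l 2 = 0
    · by_cases h1 : l 1 = 0
      · refine ⟨![0, 1, 0], ?_, ?_⟩
        · rw [vec3_dotProduct]; simp [h1]
        · simp
      · have key : ∀ y : F, l ⬝ᵥ ![-l 1, l 0, y] = 0 := by
          intro y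
          rw [vec3_dotProduct]; simp [h]; ring
        by_contra hcon
        push Not at hcon
        have e0 := hcon _ (key 0)
        have e1 := hcon _ (key 1)
        simp at e0 e1
        exact h1 (by linear_combination e0 - e1)
    · refine ⟨![0, 1, -l 1 / l 2], ?_, ?_⟩
      · rw [vec3_dotProduct]; simp; field_simp; ring
      · simp
  pt := planePt
  pt_ne P h := by
    rcases P with _ | s
    · have := congrFun h 2
      simp [planePt] at this
    · have := congrFun h 0
      simp [planePt] at this
  C_pt P := by
    rcases P with _ | ⟨s, hs⟩
    · simp [planePt]
    · simp only [planePt]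
      simp
      linear_combination hs
  inj P Q k h := by
    rcases P with _ | ⟨⟨x, y⟩, hs⟩ <;> rcases Q with _ | ⟨⟨x', y'⟩, hs'⟩
    · rfl
    · have e0 := congrFun h 0
      have e2 := congrFun h 2
      simp [planePt] at e0 e2
      rw [← e0] at e2
      simp at e2
    · have e0 := congrFun h 0
      simp [planePt] at e0
    · have e0 := congrFun h 0
      have e1 := congrFun h 1
      have e2 := congrFun h 2
      simp [planePt] at e0 e1 e2
      rw [← e0, one_mul] at e1 e2
      subst e1 e2
      rfl
  surj u hu hC := by
    by_cases h0 : u 0 = 0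
    · rw [h0] at hC
      have h1 : u 1 = 0 := by
        have : u 1 ^ 3 = 0 := by linear_combination -hC
        simpa using this
      refine ⟨none, u 2, ?_⟩
      ext i
      fin_cases i <;> simp [planePt, h0, h1]
    · refine ⟨some ⟨(u 1 / u 0, u 2 / u 0), ?_⟩, u 0, ?_⟩
      · field_simp
        linear_combination hC
      · ext i
        fin_cases i <;> simp [planePt] <;> field_simp

/-- The coordinates `(1, x, (y + y₀) / (x - x₀))` of a point of the curve; the first point
`(x₀, y₀)` and the point at infinity are the simple poles of the last coordinate. -/
def slopePt (x₀ y₀ : F) : CurvePt a b c → Fin 3 → F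
  | none => ![0, 1, 0]
  | some s =>
    if s.1.1 = x₀ then
      if s.1.2 = y₀ then ![0, 0, 1]
      else ![1, x₀, -(3 * x₀ ^ 2 + 2 * a * x₀ + b) / (2 * y₀)]
    else ![1, s.1.1, (s.1.2 + y₀) / (s.1.1 - x₀)]

lemma eq_or_eq_neg_of_curve {x₀ y₀ y : F} (h : y₀ ^ 2 = x₀ ^ 3 + a * x₀ ^ 2 + b * x₀ + c)
    (h' : y ^ 2 = x₀ ^ 3 + a * x₀ ^ 2 + b * x₀ + c) : y = y₀ ∨ y = -y₀ :=
  sq_eq_sq_iff_eq_or_eq_neg.1 (h'.trans h.symm)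

/-- The embedding of the curve as a plane cubic by `1, x, (y + y₀) / (x - x₀)`. -/
def slopeModel (h2 : (2 : F) ≠ 0) (hΔ : cubicDisc 1 a b c ≠ 0) {x₀ y₀ : F} (hy₀ : y₀ ≠ 0)
    (h₀ : y₀ ^ 2 = x₀ ^ 3 + a * x₀ ^ 2 + b * x₀ + c) : PlaneModel F (CurvePt a b c) where
  C u := u 2 ^ 2 * u 1 - x₀ * u 2 ^ 2 * u 0 - 2 * y₀ * u 2 * u 0 ^ 2 - u 1 ^ 2 * u 0
    - (x₀ + a) * u 1 * u 0 ^ 2 - (x₀ ^ 2 + a * x₀ + b) * u 0 ^ 3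
  g u := ![-x₀ * u 2 ^ 2 - 4 * y₀ * u 2 * u 0 - u 1 ^ 2 - 2 * (x₀ + a) * u 1 * u 0
      - 3 * (x₀ ^ 2 + a * x₀ + b) * u 0 ^ 2,
    u 2 ^ 2 - 2 * u 1 * u 0 - (x₀ + a) * u 0 ^ 2,
    2 * u 2 * u 1 - 2 * x₀ * u 2 * u 0 - 2 * y₀ * u 0 ^ 2]
  expand u v s t := by
    simp only [vec3_dotProduct]
    simp
    ring
  smooth u hu hC hg := by
    have e0 := congrFun hg 0
    have e1 := congrFun hg 1
    have e2 := congrFun hg 2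
    simp at e0 e1 e2
    by_cases h0 : u 0 = 0
    · rw [h0] at e0 e1
      have h3 : u 2 = 0 := by
        have : u 2 ^ 2 = 0 := by linear_combination e1
        simpa using this
      rw [h3] at e0
      have h1 : u 1 = 0 := by
        have : u 1 ^ 2 = 0 := by linear_combination -e0
        simpa using this
      exact hu (eq_zero_iff_coords.2 ⟨h0, h1, h3⟩)
    · obtain ⟨x, hx⟩ : ∃ x, u 1 = x * u 0 := ⟨_, (div_mul_cancel₀ _ h0).symm⟩
      obtain ⟨m, hm⟩ : ∃ m, u 2 = m * u 0 := ⟨_, (div_mul_cancel₀ _ h0).symm⟩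
      rw [hx, hm] at hC e1 e2
      have d2 : m * (x - x₀) = y₀ := by
        apply mul_left_cancel₀ (mul_ne_zero h2 (pow_ne_zero 2 h0))
        linear_combination e2
      have d1 : m ^ 2 - 2 * x - (x₀ + a) = 0 := by
        apply mul_left_cancel₀ (pow_ne_zero 2 h0)
        linear_combination e1
      have dC : m ^ 2 * (x - x₀) - 2 * y₀ * m - x ^ 2 - (x₀ + a) * x
          - (x₀ ^ 2 + a * x₀ + b) = 0 := by
        apply mul_left_cancel₀ (pow_ne_zero 3 h0)
        linear_combination hC
      have hr : x ^ 3 + a * x ^ 2 + b * x + c = 0 := by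
        linear_combination (m * (x - x₀) - y₀) * d2 - (x - x₀) * dC - h₀
      refine deriv_ne_zero_of_root hΔ hr ?_
      linear_combination -dC - (x - x₀) * d1 + 2 * m * d2
  noline l hl := by
    by_cases h : l 2 = 0
    · by_cases h1 : l 1 = 0
      · refine ⟨![0, 1, 1], ?_, ?_⟩
        · rw [vec3_dotProduct]; simp [h1, h]
        · simp
      · have key : ∀ y : F, l ⬝ᵥ ![-l 1, l 0, y] = 0 := by
          intro y
          rw [vec3_dotProduct]; simp [h]; ring
        by_contra hcon
        push Not at hcon
        have e0 := hcon _ (key 1)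
        have e1 := hcon _ (key (-1))
        simp at e0 e1
        have e : (2 * 2) * (y₀ * l 1 ^ 2) = 0 := by linear_combination e1 - e0
        exact mul_ne_zero (mul_ne_zero h2 h2) (mul_ne_zero hy₀ (pow_ne_zero 2 h1)) e
    · by_cases h1 : l 1 = 0
      · have key : ∀ x : F, l ⬝ᵥ ![1, x, -l 0 / l 2] = 0 := by
          intro y
          rw [vec3_dotProduct]; simp [h1]; field_simp; ring
        by_contra hcon
        push Not at hcon
        have e0 := hcon _ (key 1)
        have e1 := hcon _ (key (-1))
        have e3 := hcon _ (key 0)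
        simp at e0 e1 e3
        exact h2 (by linear_combination 2 * e3 - e0 - e1)
      · refine ⟨![0, 1, -l 1 / l 2], ?_, ?_⟩
        · rw [vec3_dotProduct]; simp; field_simp; ring
        · simp [h, h1]
  pt := slopePt x₀ y₀
  pt_ne P h := by
    rcases P with _ | s
    · have := congrFun h 1
      simp [slopePt] at this
    · simp only [slopePt] at h
      split_ifs at h
      · have := congrFun h 2
        simp at this
      · have := congrFun h 0
        simp at this
      · have := congrFun h 0
        simp at this
  C_pt P := by
    rcases P with _ | ⟨⟨x, y⟩, hs⟩
    · simp [slopePt]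
    · simp only [slopePt]
      split_ifs with h1 h3
      · simp
      · simp
        field_simp
        ring
      · have hd : x - x₀ ≠ 0 := sub_ne_zero.2 h1
        simp
        field_simp
        dsimp only at hs
        linear_combination hs - h₀
  inj P Q k h := by
    rcases P with _ | ⟨⟨x, y⟩, hs⟩ <;> rcases Q with _ | ⟨⟨x', y'⟩, hs'⟩
    · rfl
    · have e0 := congrFun h 0
      have e1 := congrFun h 1
      simp only [slopePt] at e0 e1
      split_ifs at e0 e1
      · simp at e1
      · simp at e0 e1
        rw [← e0] at e1
        simp at e1
      · simp at e0 e1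
        rw [← e0] at e1
        simp at e1
    · have e0 := congrFun h 0
      have e2 := congrFun h 2
      simp only [slopePt] at e0 e2
      split_ifs at e0 e2
      · simp at e2
      · simp at e0
      · simp at e0
    · have e0 := congrFun h 0
      have e1 := congrFun h 1
      have e2 := congrFun h 2
      simp only [slopePt] at e0 e1 e2
      dsimp only at hs hs'
      have hS : ∀ {y}, y ^ 2 = x₀ ^ 3 + a * x₀ ^ 2 + b * x₀ + c → y ≠ y₀ → y = -y₀ :=
        fun h h' => (eq_or_eq_neg_of_curve h₀ h).resolve_left h'
      by_cases hx : x = x₀ <;> by_cases hx' : x' = x₀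
      · subst hx hx'
        by_cases hy : y = y₀ <;> by_cases hy' : y' = y₀
        · rw [Option.some_inj, Subtype.mk_eq_mk, hy, hy']
        · simp [hy, hy'] at e0 e2
          rw [← e0] at e2
          simp at e2
        · simp [hy, hy'] at e0
        · rw [Option.some_inj, Subtype.mk_eq_mk, hS hs hy, hS hs' hy']
      · by_cases hy : y = y₀
        · simp [hx, hx', hy] at e0 e2
          rw [← e0] at e2
          simp at e2
        · simp [hx, hx', hy] at e0 e1
          rw [← e0, one_mul] at e1
          exact absurd e1.symm hx'
      · by_cases hy : y' = y₀
        · simp [hx, hx', hy] at e0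
        · simp [hx, hx', hy] at e0 e1
          rw [← e0, one_mul] at e1
          exact absurd e1 hx
      · simp [hx, hx'] at e0 e1 e2
        rw [← e0, one_mul] at e1 e2
        subst e1
        rw [div_left_inj' (sub_ne_zero.2 hx)] at e2
        rw [Option.some_inj, Subtype.mk_eq_mk, add_right_cancel e2]
  surj u hu hC := by
    by_cases h0 : u 0 = 0
    · have hz : u 2 = 0 ∨ u 1 = 0 := by simpa [h0] using hC
      rcases hz with h | h
      · refine ⟨none, u 1, ?_⟩
        ext i
        fin_cases i <;> simp [slopePt, h0, h]
      · refine ⟨some ⟨(x₀, y₀), h₀⟩, u 2, ?_⟩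
        ext i
        fin_cases i <;> simp [slopePt, h0, h]
    · obtain ⟨x, hx⟩ : ∃ x, u 1 = u 0 * x := ⟨_, (mul_div_cancel₀ _ h0).symm⟩
      obtain ⟨m, hm⟩ : ∃ m, u 2 = u 0 * m := ⟨_, (mul_div_cancel₀ _ h0).symm⟩
      rw [hx, hm] at hC
      have dC : m ^ 2 * (x - x₀) - 2 * y₀ * m - x ^ 2 - (x₀ + a) * x
          - (x₀ ^ 2 + a * x₀ + b) = 0 := by
        apply mul_left_cancel₀ (pow_ne_zero 3 h0)
        linear_combination hC
      have hneg : -y₀ ≠ y₀ := fun h => mul_ne_zero h2 hy₀ (by linear_combination -h)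
      by_cases hd : x = x₀
      · refine ⟨some ⟨(x₀, -y₀), by rw [neg_sq]; exact h₀⟩, u 0, ?_⟩
        have hm' : m = -(3 * x₀ ^ 2 + 2 * a * x₀ + b) / (2 * y₀) := by
          rw [eq_div_iff (mul_ne_zero h2 hy₀), ← hd]
          rw [hd] at dC ⊢
          linear_combination -dC
        ext i
        fin_cases i <;> simp [slopePt, hneg, hx, hm, hd, hm']
      · have hd' := sub_ne_zero.2 hd
        refine ⟨some ⟨(x, m * (x - x₀) - y₀), ?_⟩, u 0, ?_⟩
        · dsimp only
          linear_combination (x - x₀) * dC + h₀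
        · ext i
          fin_cases i <;> simp [slopePt, hd, hx, hm, mul_div_assoc, div_self hd']

end Models

section Covering
open Matrix

variable {F : Type} [Field F] [Fintype F] [DecidableEq F] {a b c : F}

/-- The image of a point of the curve under `(1 : x : y : x² : xy : y²)`. -/
def conicPt : CurvePt a b c → Fin 6 → F
  | none => ![0, 0, 0, 0, 0, 1]
  | some s => ![1, s.1.1, s.1.2, s.1.1 ^ 2, s.1.1 * s.1.2, s.1.2 ^ 2]

variable (a b c) in
/-- Some conic orthogonal to `Q` meets the curve in six points. -/
def IsCovered (Q : Fin 6 → F) : Prop :=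
  ∃ k : Fin 6 → F, k ≠ 0 ∧ k ⬝ᵥ Q = 0 ∧
    (Finset.univ.filter fun P : CurvePt a b c => k ⬝ᵥ conicPt P = 0).card = 6

lemma dotProduct_six (k Q : Fin 6 → F) : k ⬝ᵥ Q
    = k 0 * Q 0 + k 1 * Q 1 + k 2 * Q 2 + k 3 * Q 3 + k 4 * Q 4 + k 5 * Q 5 := by
  simp [dotProduct, Fin.sum_univ_six]

lemma dotProduct_mulVec_three (l m : Fin 3 → F) (β : Matrix (Fin 3) (Fin 3) F) : l ⬝ᵥ β *ᵥ m
    = l 0 * (β 0 0 * m 0 + β 0 1 * m 1 + β 0 2 * m 2)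
      + l 1 * (β 1 0 * m 0 + β 1 1 * m 1 + β 1 2 * m 2)
      + l 2 * (β 2 0 * m 0 + β 2 1 * m 1 + β 2 2 * m 2) := by
  simp [dotProduct, mulVec, Fin.sum_univ_three]

lemma hasse_curvePt (hodd : Odd (Fintype.card F)) (hΔ : cubicDisc 1 a b c ≠ 0) :
    ((Fintype.card F : ℤ) + 1 - Fintype.card (CurvePt a b c)) ^ 2 ≤ 4 * Fintype.card F := by
  have := hasse_bound hodd hΔ
  rwa [Fintype.card_option, add_comm (Fintype.card {s : F × F // _})]

lemma card_curvePt (hq : 121 ≤ Fintype.card F) (hodd : Odd (Fintype.card F))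
    (hΔ : cubicDisc 1 a b c ≠ 0) : 100 ≤ Fintype.card (CurvePt a b c) :=
  hasse_lower hq (hasse_curvePt hodd hΔ)

lemma isCovered_of_secants (hG : 100 ≤ Fintype.card (CurvePt a b c))
    {M M' : PlaneModel F (CurvePt a b c)} {l m : Fin 3 → F} (hl : l ∈ M.secants)
    (hm : m ∈ M'.secants) (hd : Disjoint (M.zeros l) (M'.zeros m)) {k Q : Fin 6 → F}
    (hk : ∀ P : CurvePt a b c, k ⬝ᵥ conicPt P = 0 ↔ l ⬝ᵥ M.pt P = 0 ∨ m ⬝ᵥ M'.pt P = 0)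
    (hQ : k ⬝ᵥ Q = 0) : IsCovered a b c Q := by
  have hcard : (Finset.univ.filter fun P : CurvePt a b c => k ⬝ᵥ conicPt P = 0).card = 6 := by
    have : (Finset.univ.filter fun P : CurvePt a b c => k ⬝ᵥ conicPt P = 0)
        = M.zeros l ∪ M'.zeros m := by
      ext P
      simp [hk, PlaneModel.mem_zeros]
    rw [this, Finset.card_union_of_disjoint hd, (PlaneModel.mem_secants.1 hl).2,
      (PlaneModel.mem_secants.1 hm).2]
  refine ⟨k, ?_, hQ, hcard⟩
  rintro rfl
  simp at hcard
  rw [Fintype.card_option] at hG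
  omega

variable (h2 : (2 : F) ≠ 0) (hΔ : cubicDisc 1 a b c ≠ 0)

lemma isCovered_of_plane (hG : 100 ≤ Fintype.card (CurvePt a b c))
    {l m : Fin 3 → F} (hl : l ∈ (weierstrassModel h2 hΔ).secants)
    (hm : m ∈ (weierstrassModel h2 hΔ).secants)
    (hd : Disjoint ((weierstrassModel h2 hΔ).zeros l) ((weierstrassModel h2 hΔ).zeros m))
    {Q : Fin 6 → F}
    (hQ : Q 0 * (l 0 * m 0) + Q 1 * (l 0 * m 1 + l 1 * m 0) + Q 2 * (l 0 * m 2 + l 2 * m 0)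
      + Q 3 * (l 1 * m 1) + Q 4 * (l 1 * m 2 + l 2 * m 1) + Q 5 * (l 2 * m 2) = 0) :
    IsCovered a b c Q := by
  refine isCovered_of_secants hG hl hm hd (k := ![l 0 * m 0, l 0 * m 1 + l 1 * m 0,
    l 0 * m 2 + l 2 * m 0, l 1 * m 1, l 1 * m 2 + l 2 * m 1, l 2 * m 2]) ?_ ?_
  · intro P
    rw [← mul_eq_zero]
    apply Eq.congr_left
    rw [dotProduct_six, vec3_dotProduct, vec3_dotProduct]
    rcases P with _ | s
    · simp [conicPt, weierstrassModel, planePt]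
    · simp [conicPt, weierstrassModel, planePt]
      ring
  · rw [dotProduct_six]
    simp
    linear_combination hQ

/-- The bilinear form induced by `Q` on pairs of sections of the two slope embeddings attached to
`(x₀, y₀)` and `(x₀, -y₀)`, through multiplication by `x - x₀`. -/
def slopeForm (a b c x₀ y₀ : F) (Q : Fin 6 → F) : Matrix (Fin 3) (Fin 3) F :=
  !![Q 1 - x₀ * Q 0, Q 3 - x₀ * Q 1, Q 2 - y₀ * Q 0;
    Q 3 - x₀ * Q 1, Q 5 - (x₀ + a) * Q 3 - b * Q 1 - c * Q 0, Q 4 - y₀ * Q 1;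
    Q 2 + y₀ * Q 0, Q 4 + y₀ * Q 1, Q 3 + (x₀ + a) * Q 1 + (x₀ ^ 2 + a * x₀ + b) * Q 0]

lemma neg_curve {x₀ y₀ : F} (h₀ : y₀ ^ 2 = x₀ ^ 3 + a * x₀ ^ 2 + b * x₀ + c) :
    (-y₀) ^ 2 = x₀ ^ 3 + a * x₀ ^ 2 + b * x₀ + c := by
  rw [neg_sq, h₀]

lemma isCovered_of_slope (hG : 100 ≤ Fintype.card (CurvePt a b c)) {x₀ y₀ : F} (hy₀ : y₀ ≠ 0)
    (h₀ : y₀ ^ 2 = x₀ ^ 3 + a * x₀ ^ 2 + b * x₀ + c)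
    {l m : Fin 3 → F} (hl : l ∈ (slopeModel h2 hΔ hy₀ h₀).secants)
    (hm : m ∈ (slopeModel h2 hΔ (neg_ne_zero.2 hy₀) (neg_curve h₀)).secants)
    (hd : Disjoint ((slopeModel h2 hΔ hy₀ h₀).zeros l)
      ((slopeModel h2 hΔ (neg_ne_zero.2 hy₀) (neg_curve h₀)).zeros m))
    {Q : Fin 6 → F} (hQ : l ⬝ᵥ slopeForm a b c x₀ y₀ Q *ᵥ m = 0) :
    IsCovered a b c Q := by
  refine isCovered_of_secants hG hl hm hd (k := ![-x₀ * (l 0 * m 0) - c * (l 1 * m 1)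
      - y₀ * (l 0 * m 2) + y₀ * (l 2 * m 0) + (x₀ ^ 2 + a * x₀ + b) * (l 2 * m 2),
    l 0 * m 0 - x₀ * (l 0 * m 1 + l 1 * m 0) - b * (l 1 * m 1) - y₀ * (l 1 * m 2)
      + y₀ * (l 2 * m 1) + (x₀ + a) * (l 2 * m 2),
    l 0 * m 2 + l 2 * m 0, l 0 * m 1 + l 1 * m 0 - (x₀ + a) * (l 1 * m 1) + l 2 * m 2,
    l 1 * m 2 + l 2 * m 1, l 1 * m 1]) ?_ ?_
  · intro P
    rw [← mul_eq_zero, dotProduct_six, vec3_dotProduct, vec3_dotProduct]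
    have hneg : -y₀ ≠ y₀ := fun h => mul_ne_zero h2 hy₀ (by linear_combination -h)
    rcases P with _ | ⟨⟨x, y⟩, hs⟩
    · simp [conicPt, slopeModel, slopePt]
    · dsimp only at hs
      by_cases hx : x = x₀
      · subst hx
        rcases eq_or_eq_neg_of_curve h₀ hs with rfl | rfl
        · rw [← mul_right_inj' (mul_ne_zero h2 hy₀) (b := _ * _), mul_zero]
          apply Eq.congr_left
          simp [conicPt, slopeModel, slopePt, hneg.symm]
          field_simp
          linear_combination l 1 * m 1 * hs
        · rw [← mul_right_inj' (mul_ne_zero h2 (neg_ne_zero.2 hy₀)) (b := _ * _), mul_zero]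
          apply Eq.congr_left
          simp [conicPt, slopeModel, slopePt, hneg]
          field_simp
          linear_combination l 1 * m 1 * hs
      · have hd := sub_ne_zero.2 hx
        rw [← mul_right_inj' hd (b := _ * _), mul_zero]
        apply Eq.congr_left
        simp [conicPt, slopeModel, slopePt, hx]
        field_simp
        linear_combination l 1 * m 1 * (x - x₀) * hs + l 2 * m 2 * (h₀ - hs)
  · rw [dotProduct_six]
    rw [dotProduct_mulVec_three] at hQ
    simp [slopeForm] at hQ ⊢
    linear_combination hQ

lemma exists_slope_point (h2 : (2 : F) ≠ 0) (hΔ : cubicDisc 1 a b c ≠ 0)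
    (hG : 100 ≤ Fintype.card (CurvePt a b c)) (r : F) :
    ∃ x₀ y₀ : F, x₀ ≠ r ∧ y₀ ≠ 0 ∧ y₀ ^ 2 = x₀ ^ 3 + a * x₀ ^ 2 + b * x₀ + c := by
  set M := weierstrassModel h2 hΔ with hM
  have h1 : (M.zeros ![0, 0, 1]).card ≤ 3 := PlaneModel.card_zeros_le
    (fun h => by simpa using congrFun h 2)
  have h3 : (M.zeros ![-r, 1, 0]).card ≤ 3 := PlaneModel.card_zeros_le
    (fun h => by simpa using congrFun h 1)
  have h4 := Finset.card_union_le (M.zeros ![0, 0, 1]) (M.zeros ![-r, 1, 0])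
  obtain ⟨P, hP⟩ : ∃ P, P ∉ M.zeros ![0, 0, 1] ∪ M.zeros ![-r, 1, 0] := by
    by_contra hcon
    push Not at hcon
    have := Finset.eq_univ_iff_forall.2 hcon
    rw [this, Finset.card_univ] at h4
    omega
  rw [Finset.mem_union, PlaneModel.mem_zeros, PlaneModel.mem_zeros, vec3_dotProduct,
    vec3_dotProduct] at hP
  push Not at hP
  rcases P with _ | ⟨⟨x, y⟩, hs⟩
  · simp [hM, weierstrassModel, planePt] at hP
  · simp [hM, weierstrassModel, planePt] at hP
    exact ⟨x, y, fun h => hP.2 (by rw [h]; ring), hP.1, hs⟩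

end Covering

section Hankel
open Matrix

variable {F : Type} [Field F]

/-- The Hankel matrix of the functional on `F[t] / (t³ + c₂t² + c₁t + c₀)` that sends
`1, t, t²` to `q₀, q₁, q₂`. -/
def hankel (c₂ c₁ c₀ q₀ q₁ q₂ : F) : Matrix (Fin 3) (Fin 3) F :=
  !![q₀, q₁, q₂; q₁, q₂, -(c₂ * q₂ + c₁ * q₁ + c₀ * q₀);
    q₂, -(c₂ * q₂ + c₁ * q₁ + c₀ * q₀),
    c₂ * (c₂ * q₂ + c₁ * q₁ + c₀ * q₀) - c₁ * q₂ - c₀ * q₁]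

variable {c₂ c₁ c₀ q₀ q₁ q₂ : F}

lemma exists_root_of_det_hankel (h : (hankel c₂ c₁ c₀ q₀ q₁ q₂).det = 0)
    (hq : ¬(q₀ = 0 ∧ q₁ = 0 ∧ q₂ = 0)) : ∃ r, r ^ 3 + c₂ * r ^ 2 + c₁ * r + c₀ = 0 := by
  classical
  obtain ⟨w, hw, hHw⟩ := Matrix.exists_mulVec_eq_zero_iff.2 h
  have e0 := congrFun hHw 0
  have e1 := congrFun hHw 1
  have e2 := congrFun hHw 2
  simp [hankel, mulVec, dotProduct, Fin.sum_univ_three] at e0 e1 e2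
  by_cases h2 : w 2 = 0
  · rw [h2] at e0 e1 e2
    by_cases h1 : w 1 = 0
    · have h0 : w 0 ≠ 0 := fun h0 => hw (by ext i; fin_cases i <;> simp [h0, h1, h2])
      rw [h1] at e0 e1 e2
      refine absurd ⟨?_, ?_, ?_⟩ hq <;> apply mul_right_cancel₀ h0
      · linear_combination e0
      · linear_combination e1
      · linear_combination e2
    · obtain ⟨r, hr⟩ : ∃ r, w 0 = w 1 * -r := ⟨-(w 0 / w 1), by field_simp⟩
      rw [hr] at e0 e1 e2
      have f0 : q₁ = r * q₀ := by
        apply mul_left_cancel₀ h1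
        linear_combination e0
      have f1 : q₂ = r * q₁ := by
        apply mul_left_cancel₀ h1
        linear_combination e1
      have f2 : -(c₂ * q₂ + c₁ * q₁ + c₀ * q₀) = r * q₂ := by
        apply mul_left_cancel₀ h1
        linear_combination e2
      have h0 : q₀ ≠ 0 := by
        rintro rfl
        rw [mul_zero] at f0
        rw [f0, mul_zero] at f1
        exact hq ⟨rfl, f0, f1⟩
      refine ⟨r, ?_⟩
      apply mul_left_cancel₀ h0
      linear_combination -f2 - (r + c₂) * f1 - (r ^ 2 + c₂ * r + c₁) * f0
  · obtain ⟨A, hA⟩ : ∃ A, w 0 = w 2 * A := ⟨_, (mul_div_cancel₀ _ h2).symm⟩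
    obtain ⟨B, hB⟩ : ∃ B, w 1 = w 2 * B := ⟨_, (mul_div_cancel₀ _ h2).symm⟩
    rw [hA, hB] at e0 e1 e2
    have f0 : q₂ + B * q₁ + A * q₀ = 0 := by
      apply mul_left_cancel₀ h2
      linear_combination e0
    have f1 : -(c₂ * q₂ + c₁ * q₁ + c₀ * q₀) + B * q₂ + A * q₁ = 0 := by
      apply mul_left_cancel₀ h2
      linear_combination e1
    have f2 : c₂ * (c₂ * q₂ + c₁ * q₁ + c₀ * q₀) - c₁ * q₂ - c₀ * q₁
        - B * (c₂ * q₂ + c₁ * q₁ + c₀ * q₀) + A * q₂ = 0 := by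
      apply mul_left_cancel₀ h2
      linear_combination e2
    obtain ⟨s, hs⟩ : ∃ s, s = c₁ - A - (c₂ - B) * B := ⟨_, rfl⟩
    obtain ⟨t, ht⟩ : ∃ t, t = c₀ - (c₂ - B) * A := ⟨_, rfl⟩
    have k0 : s * q₁ + t * q₀ = 0 := by
      rw [hs, ht]
      linear_combination -f1 - (c₂ - B) * f0
    have k1 : s * q₂ + t * q₁ = 0 := by
      rw [hs, ht]
      linear_combination -f2 - (c₂ - B) * f1
    by_cases hs0 : s = 0
    · rw [hs0] at k0 k1 hs
      by_cases ht0 : t = 0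
      · rw [ht0] at ht
        exact ⟨-(c₂ - B), by linear_combination (c₂ - B) * hs - ht⟩
      · have hq0 : q₀ = 0 := by simpa [ht0] using k0
        have hq1 : q₁ = 0 := by simpa [ht0] using k1
        rw [hq0, hq1] at f0
        exact absurd ⟨hq0, hq1, by simpa using f0⟩ hq
    · obtain ⟨r, hr⟩ : ∃ r, t = s * -r := ⟨-(t / s), by field_simp⟩
      rw [hr] at k0 k1 ht
      have g0 : q₁ = r * q₀ := by
        apply mul_left_cancel₀ hs0
        linear_combination k0
      have g1 : q₂ = r * q₁ := by
        apply mul_left_cancel₀ hs0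
        linear_combination k1
      have h0 : q₀ ≠ 0 := by
        rintro rfl
        rw [mul_zero] at g0
        rw [g0, mul_zero] at g1
        exact hq ⟨rfl, g0, g1⟩
      have hg : r ^ 2 + B * r + A = 0 := by
        apply mul_left_cancel₀ h0
        linear_combination f0 - g1 - (r + B) * g0
      exact ⟨r, by linear_combination (r + (c₂ - B)) * hg - r * hs - ht⟩

lemma exists_root_of_rank_one (h : (hankel c₂ c₁ c₀ q₀ q₁ q₂).det = 0)
    (hq : ¬(q₀ = 0 ∧ q₁ = 0 ∧ q₂ = 0)) (h1 : q₀ * q₂ - q₁ * q₁ = 0) :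
    ∃ r, r ^ 3 + c₂ * r ^ 2 + c₁ * r + c₀ = 0 ∧ q₁ = q₀ * r ∧ q₂ = q₀ * r ^ 2 := by
  rw [hankel, det_fin_three] at h
  simp at h
  by_cases h0 : q₀ = 0
  · subst h0
    have hq1 : q₁ = 0 := by
      have : q₁ ^ 2 = 0 := by linear_combination -h1
      simpa using this
    subst hq1
    have : q₂ ^ 3 = 0 := by linear_combination -h
    exact absurd ⟨rfl, rfl, by simpa using this⟩ hq
  · obtain ⟨r, hr⟩ : ∃ r, q₁ = q₀ * r := ⟨_, (mul_div_cancel₀ _ h0).symm⟩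
    have hr2 : q₂ = q₀ * r ^ 2 := by
      apply mul_left_cancel₀ h0
      rw [hr] at h1
      linear_combination h1
    refine ⟨r, ?_, hr, hr2⟩
    subst hr hr2
    have : (r ^ 3 + c₂ * r ^ 2 + c₁ * r + c₀) ^ 2 = 0 := by
      apply mul_left_cancel₀ (pow_ne_zero 3 h0)
      linear_combination -h
    simpa using this

lemma det_hankel_triple (r : F) :
    (hankel (-3 * r) (3 * r ^ 2) (-r ^ 3) q₀ q₁ q₂).det = -(q₂ - 2 * r * q₁ + r ^ 2 * q₀) ^ 3 := by
  rw [hankel, det_fin_three]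
  simp
  ring

end Hankel

section Lines
open Matrix

variable {F : Type} [Field F] [Fintype F] [DecidableEq F] {a b c : F}

lemma PlaneModel.mem_secants_of_three {G : Type} [Fintype G] [DecidableEq G]
    {M : PlaneModel F G} {l : Fin 3 → F} (hl : l ≠ 0) {P Q R : G} (hPQ : P ≠ Q) (hPR : P ≠ R)
    (hQR : Q ≠ R) (hP : l ⬝ᵥ M.pt P = 0) (hQ : l ⬝ᵥ M.pt Q = 0) (hR : l ⬝ᵥ M.pt R = 0) :
    l ∈ M.secants :=
  PlaneModel.mem_secants.2 ⟨hl, le_antisymm (PlaneModel.card_zeros_le hl)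
    (Finset.two_lt_card.2 ⟨P, PlaneModel.mem_zeros.2 hP, Q, PlaneModel.mem_zeros.2 hQ, R,
      PlaneModel.mem_zeros.2 hR, hPQ, hPR, hQR⟩)⟩

theorem PlaneModel.exists_conjugate_secants_of_pencil {G : Type} [Fintype G] [DecidableEq G]
    {M M' : PlaneModel F G} (hodd : Odd (Fintype.card F))
    (hq : 121 ≤ Fintype.card F)
    (hN : ((Fintype.card F : ℤ) + 1 - Fintype.card G) ^ 2 ≤ 4 * Fintype.card F)
    {u v u' v' : Fin 3 → F} (huv : u ⨯₃ v ≠ 0) (huv' : u' ⨯₃ v' ≠ 0)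
    (h : u ⨯₃ v ∈ M.secants ∨ M.IsGood u v) (h' : u' ⨯₃ v' ∈ M'.secants ∨ M'.IsGood u' v')
    {α β γ δ : F} (hdet : α * δ - β * γ ≠ 0) :
    ∃ l ∈ M.secants, ∃ m ∈ M'.secants, Disjoint (M.zeros l) (M'.zeros m)
      ∧ (l ⬝ᵥ u) * (α * (m ⬝ᵥ u') + β * (m ⬝ᵥ v'))
        + (l ⬝ᵥ v) * (γ * (m ⬝ᵥ u') + δ * (m ⬝ᵥ v')) = 0 := by
  have hcr : (α • u' + β • v') ⨯₃ (γ • u' + δ • v') = (α * δ - β * γ) • (u' ⨯₃ v') := by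
    ext j
    fin_cases j <;> simp [cross_apply] <;> ring
  obtain ⟨l, hl, m, hm, hd, e⟩ := exists_conjugate_secants_of_rank_two hodd hq hN huv
    (smul_cross_ne_zero_iff huv' hdet) h (h'.imp
      (fun hs => by
        rw [hcr]
        refine PlaneModel.smul_mem_secants (c := (α * δ - β * γ)⁻¹) (inv_ne_zero hdet) ?_
        rwa [smul_smul, inv_mul_cancel₀ hdet, one_smul])
      (fun hg => hg.change (two_ne_zero_of_odd hodd) hdet))
  refine ⟨l, hl, m, hm, hd, ?_⟩
  simpa only [dotProduct_add, dotProduct_smul, smul_eq_mul] using e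

variable (h2 : (2 : F) ≠ 0) (hΔ : cubicDisc 1 a b c ≠ 0)

lemma tangent_isGood {s t ρ σ : F} (hρσ : ρ ≠ σ) (e2 : a - s ^ 2 = -(2 * ρ + σ))
    (e1 : b - 2 * s * t = ρ ^ 2 + 2 * ρ * σ) (e0 : c - t ^ 2 = -(ρ ^ 2 * σ)) :
    (weierstrassModel h2 hΔ).IsGood ![1, 0, t] ![0, 1, s] := by
  refine Or.inr ⟨![1, ρ, s * ρ + t], ![0, 1, s], ?_, ?_, ?_, ?_, ?_, ?_, ?_⟩
  · exact fun h => by simpa using congrFun h 0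
  · simp [weierstrassModel]
    linear_combination -ρ ^ 2 * e2 - ρ * e1 - e0
  · simp only [vec3_dotProduct, cross_apply]
    simp
  · simp only [vec3_dotProduct, cross_apply]
    simp
  · rw [vec3_dotProduct]
    simp [weierstrassModel]
    linear_combination -ρ ^ 2 * e2 - 2 * ρ * e1 - 3 * e0
  · rw [vec3_dotProduct]
    simp [weierstrassModel]
    linear_combination -2 * ρ * e2 - e1
  · rw [vec3_dotProduct]
    simp [weierstrassModel]
    intro h
    exact hρσ (by linear_combination -h - e2)

lemma secant_of_three_roots {s t r₁ r₂ r₃ : F} (h12 : r₁ ≠ r₂) (h13 : r₁ ≠ r₃) (h23 : r₂ ≠ r₃)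
    (e2 : a - s ^ 2 = -(r₁ + r₂ + r₃))
    (e1 : b - 2 * s * t = r₁ * r₂ + r₁ * r₃ + r₂ * r₃) (e0 : c - t ^ 2 = -(r₁ * r₂ * r₃)) :
    ![1, 0, t] ⨯₃ ![0, 1, s] ∈ (weierstrassModel h2 hΔ).secants := by
  have hr : ∀ r, (r - r₁) * (r - r₂) * (r - r₃) = 0 →
      (s * r + t) ^ 2 = r ^ 3 + a * r ^ 2 + b * r + c := by
    intro r hr
    linear_combination -hr - r ^ 2 * e2 - r * e1 - e0
  have hz : ∀ r (h : (s * r + t) ^ 2 = r ^ 3 + a * r ^ 2 + b * r + c),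
      (![1, 0, t] ⨯₃ ![0, 1, s]) ⬝ᵥ (weierstrassModel h2 hΔ).pt (some ⟨(r, s * r + t), h⟩) = 0 := by
    intro r h
    simp only [vec3_dotProduct, cross_apply]
    simp [weierstrassModel, planePt]
  have hne : ∀ r r' (h : (s * r + t) ^ 2 = r ^ 3 + a * r ^ 2 + b * r + c)
      (h' : (s * r' + t) ^ 2 = r' ^ 3 + a * r' ^ 2 + b * r' + c), r ≠ r' →
      (some ⟨(r, s * r + t), h⟩ : CurvePt a b c) ≠ some ⟨(r', s * r' + t), h'⟩ := by
    intro r r' h h' hrr hs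
    rw [Option.some_inj, Subtype.mk_eq_mk, Prod.mk.injEq] at hs
    exact hrr hs.1
  exact PlaneModel.mem_secants_of_three (fun h => by simpa [cross_apply] using congrFun h 2)
    (hne r₁ r₂ (hr r₁ (by ring)) (hr r₂ (by ring)) h12)
    (hne r₁ r₃ (hr r₁ (by ring)) (hr r₃ (by ring)) h13)
    (hne r₂ r₃ (hr r₂ (by ring)) (hr r₃ (by ring)) h23) (hz _ _) (hz _ _) (hz _ _)

lemma line_secant_or_isGood {s t r : F}
    (hr : r ^ 3 + (a - s ^ 2) * r ^ 2 + (b - 2 * s * t) * r + (c - t ^ 2) = 0) :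
    (![1, 0, t] ⨯₃ ![0, 1, s] ∈ (weierstrassModel h2 hΔ).secants ∨
      (weierstrassModel h2 hΔ).IsGood ![1, 0, t] ![0, 1, s]) ∨
    (a - s ^ 2 = -3 * r ∧ b - 2 * s * t = 3 * r ^ 2 ∧ c - t ^ 2 = -r ^ 3) := by
  obtain ⟨p, hp⟩ : ∃ p, a - s ^ 2 = p - r := ⟨a - s ^ 2 + r, by ring⟩
  obtain ⟨w, hw⟩ : ∃ w, b - 2 * s * t = w - r * p := ⟨b - 2 * s * t + r * p, by ring⟩
  have h0 : c - t ^ 2 = -r * w := by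
    rw [hp, hw] at hr
    linear_combination hr
  by_cases hD : IsSquare (p ^ 2 - 4 * w)
  · obtain ⟨e, he⟩ := hD
    obtain ⟨r₁, h₁⟩ : ∃ r₁, 2 * r₁ = -p + e := ⟨_, mul_div_cancel₀ _ h2⟩
    obtain ⟨r₂, h₂⟩ : ∃ r₂, 2 * r₂ = -p - e := ⟨_, mul_div_cancel₀ _ h2⟩
    have hs : p = -(r₁ + r₂) := by
      apply mul_left_cancel₀ h2
      linear_combination h₁ + h₂
    have hm : w = r₁ * r₂ := by
      apply mul_left_cancel₀ (mul_ne_zero h2 h2)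
      linear_combination -he - 2 * r₂ * h₁ - (-p + e) * h₂
    by_cases h12 : r₁ = r₂
    · subst h12
      by_cases h1 : r₁ = r
      · right
        subst h1
        refine ⟨?_, ?_, ?_⟩
        · linear_combination hp + hs
        · linear_combination hw + hm - r₁ * hs
        · linear_combination h0 - r₁ * hm
      · left; right
        refine tangent_isGood h2 hΔ h1 ?_ ?_ ?_
        · linear_combination hp + hs
        · linear_combination hw + hm - r * hs
        · linear_combination h0 - r * hm
    · by_cases h1 : r₁ = r
      · subst h1
        left; right
        refine tangent_isGood h2 hΔ h12 ?_ ?_ ?_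
        · linear_combination hp + hs
        · linear_combination hw + hm - r₁ * hs
        · linear_combination h0 - r₁ * hm
      · by_cases h3 : r₂ = r
        · subst h3
          left; right
          refine tangent_isGood h2 hΔ (Ne.symm h12) ?_ ?_ ?_
          · linear_combination hp + hs
          · linear_combination hw + hm - r₂ * hs
          · linear_combination h0 - r₂ * hm
        · left; left
          refine secant_of_three_roots h2 hΔ h12 h1 h3 ?_ ?_ ?_
          · linear_combination hp + hs
          · linear_combination hw + hm - r * hs
          · linear_combination h0 - r * hm
  · left; right; left
    have hne : r ^ 2 + p * r + w ≠ 0 := fun h => hD ⟨2 * r + p, by linear_combination -4 * h⟩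
    have hdisc : (weierstrassModel h2 hΔ).lineDisc ![1, 0, t] ![0, 1, s]
        = (p ^ 2 - 4 * w) * (r ^ 2 + p * r + w) ^ 2 := by
      rw [PlaneModel.lineDisc, vec3_dotProduct, vec3_dotProduct]
      have ha : a = s ^ 2 + (p - r) := by linear_combination hp
      have hb : b = 2 * s * t + (w - r * p) := by linear_combination hw
      have hc : c = t ^ 2 - r * w := by linear_combination h0
      simp only [weierstrassModel, cubicDisc]
      simp [ha, hb, hc]
      ring
    rw [hdisc]
    rintro ⟨e, he⟩
    refine hD ⟨e / (r ^ 2 + p * r + w), ?_⟩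
    rw [div_mul_div_comm, eq_div_iff (mul_ne_zero hne hne)]
    linear_combination he

end Lines

section SlopeLines
open Matrix

variable {F : Type} [Field F] [Fintype F] [DecidableEq F] {a b c : F}

lemma flex_slope_mul {x₀ y₀ s t r μ ν : F}
    (h₀ : y₀ ^ 2 = x₀ ^ 3 + a * x₀ ^ 2 + b * x₀ + c) (hxr : r - x₀ ≠ 0)
    (ha : a = s ^ 2 - 3 * r) (hb : b = 2 * s * t + 3 * r ^ 2) (hc : c = t ^ 2 - r ^ 3)
    (hμ : μ * (r - x₀) = s * r + t + y₀) (hν : ν * (r - x₀) = s * r + t - y₀) :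
    (r - x₀) * (μ * ν) = 2 * s * (s * r + t) - s ^ 2 * (r - x₀) + (r - x₀) ^ 2 := by
  apply mul_left_cancel₀ hxr
  subst ha hb hc
  linear_combination ν * (r - x₀) * hμ + (s * r + t + y₀) * hν - h₀

variable (h2 : (2 : F) ≠ 0) (hΔ : cubicDisc 1 a b c ≠ 0)

lemma flex_isGood {x₀ y₀ s t r μ m : F} (hy₀ : y₀ ≠ 0)
    (h₀ : y₀ ^ 2 = x₀ ^ 3 + a * x₀ ^ 2 + b * x₀ + c) (hxr : r - x₀ ≠ 0)
    (ha : a = s ^ 2 - 3 * r) (hb : b = 2 * s * t + 3 * r ^ 2) (hc : c = t ^ 2 - r ^ 3)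
    (hμ : μ * (r - x₀) = s * r + t + y₀) (hm : m * (r - x₀) = s - μ) :
    (slopeModel h2 hΔ hy₀ h₀).IsGood ![1, r, μ] ![0, 1, m] := by
  have hyR : s * r + t ≠ 0 := by
    intro h
    refine deriv_ne_zero_of_root hΔ (x := r) ?_ ?_
    · rw [ha, hb, hc]
      linear_combination (s * r + t) * h
    · rw [ha, hb]
      linear_combination 2 * s * h
  have hm0 : m ≠ 0 := by
    intro h
    have hy : y₀ = -(s * x₀ + t) := by
      rw [h] at hm
      linear_combination -hμ + (r - x₀) * hm
    have : (r - x₀) ^ 3 = 0 := by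
      rw [hy, ha, hb, hc] at h₀
      linear_combination h₀
    exact hxr (by simpa using this)
  obtain ⟨ν, hν⟩ : ∃ ν : F, ν * (r - x₀) = s * r + t - y₀ := ⟨_, div_mul_cancel₀ _ hxr⟩
  have hK := flex_slope_mul h₀ hxr ha hb hc hμ hν
  have hgv : μ ^ 2 - 2 * r - x₀ - a + 2 * m * (s * r + t) = 0 := by
    apply mul_left_cancel₀ hxr
    rw [ha]
    linear_combination μ * hμ + 2 * (s * r + t) * hm - hK + μ * hν
  have hCu : (slopeModel h2 hΔ hy₀ h₀).C ![1, r, μ] = 0 := by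
    simp [slopeModel]
    rw [ha, hb]
    linear_combination μ * hμ + hK - μ * hν
  refine Or.inr ⟨![1, r, μ], ![0, 1, m], ?_, hCu, ?_, ?_, ?_, ?_, ?_⟩
  · exact fun h => by simpa using congrFun h 0
  · simp only [vec3_dotProduct, cross_apply]
    simp
    ring
  · simp only [vec3_dotProduct, cross_apply]
    simp
  · exact PlaneModel.g_dot_self _ h2 hCu
  · rw [vec3_dotProduct]
    simp [slopeModel]
    linear_combination hgv + 2 * m * hμ
  · rw [vec3_dotProduct]
    simp [slopeModel]
    intro h
    refine mul_ne_zero (mul_ne_zero h2 hm0) hyR ?_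
    rw [ha] at hgv
    linear_combination (r - x₀) * h + hgv - (m * (r - x₀) + s + μ) * hm

lemma infinity_isGood {x₀ y₀ : F} (hy₀ : y₀ ≠ 0)
    (h₀ : y₀ ^ 2 = x₀ ^ 3 + a * x₀ ^ 2 + b * x₀ + c) :
    (slopeModel h2 hΔ hy₀ h₀).IsGood ![0, 1, 0] ![0, 0, 1] := by
  refine Or.inr ⟨![0, 1, 0], ![0, 0, 1], ?_, ?_, ?_, ?_, ?_, ?_, ?_⟩
  · exact fun h => by simpa using congrFun h 1
  all_goals simp [slopeModel, cross_apply]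

end SlopeLines

section Cases
open Matrix

variable {F : Type} [Field F] [Fintype F] [DecidableEq F] {a b c : F}

lemma isCovered_of_det_slopeForm (hq : 121 ≤ Fintype.card F) (hodd : Odd (Fintype.card F))
    (hΔ : cubicDisc 1 a b c ≠ 0) {x₀ y₀ : F} (hy₀ : y₀ ≠ 0)
    (h₀ : y₀ ^ 2 = x₀ ^ 3 + a * x₀ ^ 2 + b * x₀ + c) {Q : Fin 6 → F}
    (h : (slopeForm a b c x₀ y₀ Q).det ≠ 0) : IsCovered a b c Q := by
  have h2 := two_ne_zero_of_odd hodd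
  obtain ⟨l, hl, m, hm, hd, e⟩ := PlaneModel.exists_conjugate_secants h2 hq (hasse_curvePt hodd hΔ)
    (slopeModel h2 hΔ hy₀ h₀) (slopeModel h2 hΔ (neg_ne_zero.2 hy₀) (neg_curve h₀)) h
  exact isCovered_of_slope h2 hΔ (card_curvePt hq hodd hΔ) hy₀ h₀ hl hm hd e

lemma isCovered_of_nonsingular (hq : 121 ≤ Fintype.card F) (hodd : Odd (Fintype.card F))
    (hΔ : cubicDisc 1 a b c ≠ 0) {Q : Fin 6 → F}
    (h : (!![Q 0, Q 1, Q 2; Q 1, Q 3, Q 4; Q 2, Q 4, Q 5]).det ≠ 0) : IsCovered a b c Q := by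
  have h2 := two_ne_zero_of_odd hodd
  obtain ⟨l, hl, m, hm, hd, e⟩ := PlaneModel.exists_conjugate_secants h2 hq (hasse_curvePt hodd hΔ)
    (weierstrassModel h2 hΔ) (weierstrassModel h2 hΔ) h
  refine isCovered_of_plane h2 hΔ (card_curvePt hq hodd hΔ) hl hm hd ?_
  rw [dotProduct_mulVec_three] at e
  simp at e
  linear_combination e

lemma isCovered_of_flex (hq : 121 ≤ Fintype.card F) (hodd : Odd (Fintype.card F))
    (hΔ : cubicDisc 1 a b c ≠ 0) {s t r : F} {Q : Fin 6 → F} (e2 : Q 2 = t * Q 0 + s * Q 1)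
    (e4 : Q 4 = t * Q 1 + s * Q 3) (e5 : Q 5 = t * Q 2 + s * Q 4)
    (ha : a = s ^ 2 - 3 * r) (hb : b = 2 * s * t + 3 * r ^ 2) (hc : c = t ^ 2 - r ^ 3)
    (e3 : Q 3 = 2 * r * Q 1 - r ^ 2 * Q 0) (h : Q 1 - r * Q 0 ≠ 0) : IsCovered a b c Q := by
  have h2 := two_ne_zero_of_odd hodd
  have hG := card_curvePt hq hodd hΔ
  obtain ⟨x₀, y₀, hxr, hy₀, h₀⟩ := exists_slope_point h2 hΔ hG r
  have hd0 : r - x₀ ≠ 0 := sub_ne_zero.2 hxr.symm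
  obtain ⟨μ, hμ⟩ : ∃ μ : F, μ * (r - x₀) = s * r + t + y₀ := ⟨_, div_mul_cancel₀ _ hd0⟩
  obtain ⟨ν, hν⟩ : ∃ ν : F, ν * (r - x₀) = s * r + t - y₀ := ⟨_, div_mul_cancel₀ _ hd0⟩
  obtain ⟨m₁, hm₁⟩ : ∃ m₁ : F, m₁ * (r - x₀) = s - μ := ⟨_, div_mul_cancel₀ _ hd0⟩
  obtain ⟨m₂, hm₂⟩ : ∃ m₂ : F, m₂ * (r - x₀) = s - ν := ⟨_, div_mul_cancel₀ _ hd0⟩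
  have hK := flex_slope_mul h₀ hd0 ha hb hc hμ hν
  have hK' : s * (μ + ν) - μ * ν = s ^ 2 - (r - x₀) := by
    apply mul_left_cancel₀ hd0
    linear_combination s * hμ + s * hν - hK
  have hne : ∀ m n : F, ![1, r, m] ⨯₃ ![0, 1, n] ≠ 0 := fun m n h => by
    simpa [cross_apply] using congrFun h 2
  obtain ⟨l, hl, m, hm, hd, e⟩ := PlaneModel.exists_conjugate_secants_of_pencil hodd hq
    (hasse_curvePt hodd hΔ) (hne μ m₁) (hne ν m₂)
    (Or.inr (flex_isGood h2 hΔ hy₀ h₀ hd0 ha hb hc hμ hm₁))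
    (Or.inr (flex_isGood h2 hΔ (neg_ne_zero.2 hy₀) (neg_curve h₀) hd0 ha hb hc
      (by linear_combination hν) hm₂))
    (α := Q 1 - r * Q 0 + Q 0 * (r - x₀)) (β := (Q 1 - r * Q 0) * (r - x₀))
    (γ := (Q 1 - r * Q 0) * (r - x₀)) (δ := 0) (by
      rw [mul_zero, zero_sub, neg_ne_zero]
      exact mul_ne_zero (mul_ne_zero h hd0) (mul_ne_zero h hd0))
  refine isCovered_of_slope h2 hΔ hG hy₀ h₀ hl hm hd ?_
  rw [dotProduct_mulVec_three]
  simp only [vec3_dotProduct] at e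
  simp [slopeForm] at e ⊢
  rw [e2, e4] at e5
  rw [e5, e2, e4, e3, ha, hb, hc]
  linear_combination e - l 0 * m 2 * ((Q 1 - r * Q 0) * hm₂ + Q 0 * hν)
    - l 1 * m 2 * (r * ((Q 1 - r * Q 0) * hm₂ + Q 0 * hν) + (Q 1 - r * Q 0) * hν)
    - l 2 * m 0 * ((Q 1 - r * Q 0) * hm₁ + Q 0 * hμ)
    - l 2 * m 1 * (r * ((Q 1 - r * Q 0) * hm₁ + Q 0 * hμ) + (Q 1 - r * Q 0) * hμ)
    - l 2 * m 2 * (Q 0 * hK + (Q 1 - r * Q 0) * (μ * hm₂ + ν * hm₁ + hK'))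

end Cases

section SingularCases
open Matrix

variable {F : Type} [Field F] [Fintype F] [DecidableEq F] {a b c : F}

lemma eq_of_coords_six {Q R : Fin 6 → F} (h0 : Q 0 = R 0) (h1 : Q 1 = R 1) (h2 : Q 2 = R 2)
    (h3 : Q 3 = R 3) (h4 : Q 4 = R 4) (h5 : Q 5 = R 5) : Q = R := by
  ext i
  fin_cases i
  exacts [h0, h1, h2, h3, h4, h5]

lemma isCovered_of_affine_line (hq : 121 ≤ Fintype.card F) (hodd : Odd (Fintype.card F))
    (hΔ : cubicDisc 1 a b c ≠ 0) {Q : Fin 6 → F}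
    (hQ : ∀ (P : CurvePt a b c) (k : F), Q ≠ k • conicPt P) {s t : F}
    (e2 : Q 2 = t * Q 0 + s * Q 1) (e4 : Q 4 = t * Q 1 + s * Q 3)
    (e5 : Q 5 = t * Q 2 + s * Q 4) : IsCovered a b c Q := by
  have h2 := two_ne_zero_of_odd hodd
  have hG := card_curvePt hq hodd hΔ
  set H := hankel (a - s ^ 2) (b - 2 * s * t) (c - t ^ 2) (Q 0) (Q 1) (Q 3) with hH
  by_cases hdet : H.det = 0
  · have hne : ¬(Q 0 = 0 ∧ Q 1 = 0 ∧ Q 3 = 0) := by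
      rintro ⟨h0, h1, h3⟩
      refine hQ none 0 (eq_of_coords_six ?_ ?_ ?_ ?_ ?_ ?_) <;>
        simp [h0, h1, h3, e2, e4, e5]
    by_cases hr1 : Q 0 * Q 3 - Q 1 * Q 1 = 0
    · obtain ⟨r, hr, e1, e3⟩ := exists_root_of_rank_one hdet hne hr1
      refine absurd ?_ (hQ (some ⟨(r, s * r + t), by linear_combination -hr⟩) (Q 0))
      refine eq_of_coords_six ?_ ?_ ?_ ?_ ?_ ?_ <;> simp [conicPt]
      · exact e1
      · rw [e2, e1]; ring
      · exact e3
      · rw [e4, e1, e3]; ring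
      · rw [e5, e4, e2, e1, e3]; ring
    · obtain ⟨r, hr⟩ := exists_root_of_det_hankel hdet hne
      rcases line_secant_or_isGood h2 hΔ hr with h | ⟨ha, hb, hc⟩
      · have huv : ![1, 0, t] ⨯₃ ![0, 1, s] ≠ 0 := fun h => by
          simpa [cross_apply] using congrFun h 2
        obtain ⟨l, hl, m, hm, hd, e⟩ := PlaneModel.exists_conjugate_secants_of_pencil hodd hq
          (hasse_curvePt hodd hΔ) huv huv h h hr1
        refine isCovered_of_plane h2 hΔ hG hl hm hd ?_
        simp only [vec3_dotProduct] at e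
        simp at e
        rw [e5, e4, e2]
        linear_combination e
      · rw [hH, ha, hb, hc, det_hankel_triple, neg_eq_zero] at hdet
        have e3 : Q 3 = 2 * r * Q 1 - r ^ 2 * Q 0 := by
          have : Q 3 - 2 * r * Q 1 + r ^ 2 * Q 0 = 0 := by simpa using hdet
          linear_combination this
        refine isCovered_of_flex hq hodd hΔ e2 e4 e5 (r := r) (by linear_combination ha)
          (by linear_combination hb) (by linear_combination hc) e3 fun h => hr1 ?_
        rw [e3]
        linear_combination -(Q 1 - r * Q 0) * h
  · obtain ⟨x₀, y₀, -, hy₀, h₀⟩ := exists_slope_point h2 hΔ hG 0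
    refine isCovered_of_det_slopeForm hq hodd hΔ hy₀ h₀ fun h => hdet ?_
    rw [← h, hH, hankel, slopeForm, det_fin_three, det_fin_three]
    simp
    rw [e5, e4, e2]
    linear_combination -((Q 1 - x₀ * Q 0) * Q 1 ^ 2 - 2 * (Q 3 - x₀ * Q 1) * Q 0 * Q 1
      + (t * (t * Q 0 + s * Q 1) + s * (t * Q 1 + s * Q 3) - (x₀ + a) * Q 3 - b * Q 1 - c * Q 0)
        * Q 0 ^ 2) * h₀

lemma vertical_isGood (h2 : (2 : F) ≠ 0) (hΔ : cubicDisc 1 a b c ≠ 0) (r : F) :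
    ![1, r, 0] ⨯₃ ![0, 0, 1] ∈ (weierstrassModel h2 hΔ).secants ∨
      (weierstrassModel h2 hΔ).IsGood ![1, r, 0] ![0, 0, 1] := by
  by_cases h0 : r ^ 3 + a * r ^ 2 + b * r + c = 0
  · right; right
    refine ⟨![1, r, 0], ![0, 0, 1], ?_, ?_, ?_, ?_, ?_, ?_, ?_⟩
    · exact fun h => by simpa using congrFun h 0
    · simp [weierstrassModel]
      linear_combination -h0
    · simp only [vec3_dotProduct, cross_apply]
      simp
    · simp only [vec3_dotProduct, cross_apply]
      simp
    · rw [vec3_dotProduct]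
      simp [weierstrassModel]
      linear_combination -3 * h0
    · rw [vec3_dotProduct]
      simp [weierstrassModel]
    · rw [vec3_dotProduct]
      simp [weierstrassModel]
  · by_cases hs : IsSquare (r ^ 3 + a * r ^ 2 + b * r + c)
    · left
      obtain ⟨w, hw⟩ := hs
      have hw0 : w ≠ 0 := fun h => h0 (by rw [hw, h, mul_zero])
      have hz : ∀ y (h : y ^ 2 = r ^ 3 + a * r ^ 2 + b * r + c), (![1, r, 0] ⨯₃ ![0, 0, 1])
          ⬝ᵥ (weierstrassModel h2 hΔ).pt (some ⟨(r, y), h⟩) = 0 := by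
        intro y h
        simp only [vec3_dotProduct, cross_apply]
        simp [weierstrassModel, planePt]
      refine PlaneModel.mem_secants_of_three (P := none)
        (Q := some ⟨(r, w), by rw [hw, sq]⟩) (R := some ⟨(r, -w), by rw [hw, sq, neg_mul_neg]⟩)
        (fun h => by simpa [cross_apply] using congrFun h 1) (by simp) (by simp) ?_ ?_
        (hz _ _) (hz _ _)
      · rw [Ne, Option.some_inj, Subtype.mk_eq_mk, Prod.mk.injEq]
        rintro ⟨-, h⟩
        exact mul_ne_zero h2 hw0 (by linear_combination h)
      · simp only [vec3_dotProduct, cross_apply]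
        simp [weierstrassModel, planePt]
    · right; left
      have hdisc : (weierstrassModel h2 hΔ).lineDisc ![1, r, 0] ![0, 0, 1]
          = 2 ^ 2 * (r ^ 3 + a * r ^ 2 + b * r + c) := by
        rw [PlaneModel.lineDisc, vec3_dotProduct, vec3_dotProduct]
        simp [weierstrassModel, cubicDisc]
        ring
      rw [hdisc]
      rintro ⟨e, he⟩
      refine hs ⟨e / 2, ?_⟩
      rw [div_mul_div_comm, eq_div_iff (mul_ne_zero h2 h2)]
      linear_combination he

lemma isCovered_of_vertical_line (hq : 121 ≤ Fintype.card F) (hodd : Odd (Fintype.card F))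
    (hΔ : cubicDisc 1 a b c ≠ 0) {Q : Fin 6 → F}
    (hQ : ∀ (P : CurvePt a b c) (k : F), Q ≠ k • conicPt P) {r : F}
    (e1 : Q 1 = r * Q 0) (e3 : Q 3 = r * Q 1) (e4 : Q 4 = r * Q 2) : IsCovered a b c Q := by
  have h2 := two_ne_zero_of_odd hodd
  by_cases hdet : Q 0 * Q 5 - Q 2 * Q 2 = 0
  · by_cases h0 : Q 0 = 0
    · have h3 : Q 2 = 0 := by
        rw [h0] at hdet
        have : Q 2 * Q 2 = 0 := by linear_combination -hdet
        simpa using this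
      refine absurd ?_ (hQ none (Q 5))
      refine eq_of_coords_six ?_ ?_ ?_ ?_ ?_ ?_ <;> simp [conicPt, h0, h3, e1, e3, e4]
    · obtain ⟨t, ht⟩ : ∃ t, Q 2 = t * Q 0 := ⟨_, (div_mul_cancel₀ _ h0).symm⟩
      refine isCovered_of_affine_line hq hodd hΔ hQ (s := 0) (t := t) ?_ ?_ ?_
      · rw [ht]; ring
      · rw [e4, e1, ht]; ring
      · apply mul_left_cancel₀ h0
        rw [ht] at hdet ⊢
        linear_combination hdet
  · have huv : ![1, r, 0] ⨯₃ ![0, 0, 1] ≠ 0 := fun h => by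
      simpa [cross_apply] using congrFun h 1
    obtain ⟨l, hl, m, hm, hd, e⟩ := PlaneModel.exists_conjugate_secants_of_pencil hodd hq
      (hasse_curvePt hodd hΔ) huv huv (vertical_isGood h2 hΔ r) (vertical_isGood h2 hΔ r) hdet
    refine isCovered_of_plane h2 hΔ (card_curvePt hq hodd hΔ) hl hm hd ?_
    simp only [vec3_dotProduct] at e
    simp at e
    rw [e4, e3, e1]
    linear_combination e

lemma isCovered_of_line_at_infinity (hq : 121 ≤ Fintype.card F) (hodd : Odd (Fintype.card F))
    (hΔ : cubicDisc 1 a b c ≠ 0) {Q : Fin 6 → F}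
    (hQ : ∀ (P : CurvePt a b c) (k : F), Q ≠ k • conicPt P)
    (e0 : Q 0 = 0) (e1 : Q 1 = 0) (e2 : Q 2 = 0) : IsCovered a b c Q := by
  have h2 := two_ne_zero_of_odd hodd
  have hG := card_curvePt hq hodd hΔ
  obtain ⟨x₀, y₀, -, hy₀, h₀⟩ := exists_slope_point h2 hΔ hG 0
  by_cases h3 : Q 3 = 0
  · by_cases h4 : Q 4 = 0
    · refine absurd ?_ (hQ none (Q 5))
      refine eq_of_coords_six ?_ ?_ ?_ ?_ ?_ ?_ <;> simp [conicPt, e0, e1, e2, h3, h4]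
    · have huv : (![0, 1, 0] : Fin 3 → F) ⨯₃ ![0, 0, 1] ≠ 0 := fun h => by
        simpa [cross_apply] using congrFun h 0
      obtain ⟨l, hl, m, hm, hd, e⟩ := PlaneModel.exists_conjugate_secants_of_pencil hodd hq
        (hasse_curvePt hodd hΔ) huv huv (Or.inr (infinity_isGood h2 hΔ hy₀ h₀))
        (Or.inr (infinity_isGood h2 hΔ (neg_ne_zero.2 hy₀) (neg_curve h₀)))
        (α := Q 5) (β := Q 4) (γ := Q 4) (δ := 0) (by
          rw [mul_zero, zero_sub, neg_ne_zero]
          exact mul_ne_zero h4 h4)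
      refine isCovered_of_slope h2 hΔ hG hy₀ h₀ hl hm hd ?_
      rw [dotProduct_mulVec_three]
      simp only [vec3_dotProduct] at e
      simp [slopeForm, e0, e1, e2, h3] at e ⊢
      linear_combination e
  · refine isCovered_of_det_slopeForm hq hodd hΔ hy₀ h₀ fun h => h3 ?_
    rw [slopeForm, det_fin_three] at h
    simp [e0, e1, e2] at h
    exact h

/-- Every point off the curve lies on a hyperplane meeting the curve in six points. -/
theorem isCovered_of_not_mem (hq : 121 ≤ Fintype.card F) (hodd : Odd (Fintype.card F))
    (hΔ : cubicDisc 1 a b c ≠ 0) {Q : Fin 6 → F}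
    (hQ : ∀ (P : CurvePt a b c) (k : F), Q ≠ k • conicPt P) : IsCovered a b c Q := by
  by_cases hdet : (!![Q 0, Q 1, Q 2; Q 1, Q 3, Q 4; Q 2, Q 4, Q 5]).det = 0
  · obtain ⟨w, hw, hMw⟩ := Matrix.exists_mulVec_eq_zero_iff.2 hdet
    have f0 := congrFun hMw 0
    have f1 := congrFun hMw 1
    have f2 := congrFun hMw 2
    simp [mulVec, dotProduct, Fin.sum_univ_three] at f0 f1 f2
    by_cases h2 : w 2 = 0
    · rw [h2] at f0 f1 f2
      by_cases h1 : w 1 = 0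
      · have h0 : w 0 ≠ 0 := fun h0 => hw (eq_zero_iff_coords.2 ⟨h0, h1, h2⟩)
        rw [h1] at f0 f1 f2
        refine isCovered_of_line_at_infinity hq hodd hΔ hQ ?_ ?_ ?_ <;>
          apply mul_right_cancel₀ h0
        · linear_combination f0
        · linear_combination f1
        · linear_combination f2
      · refine isCovered_of_vertical_line hq hodd hΔ hQ (r := -(w 0 / w 1)) ?_ ?_ ?_ <;>
          field_simp
        · linear_combination f0
        · linear_combination f1
        · linear_combination f2
    · refine isCovered_of_affine_line hq hodd hΔ hQ (s := -(w 1 / w 2)) (t := -(w 0 / w 2))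
        ?_ ?_ ?_ <;> field_simp
      · linear_combination f0
      · linear_combination f1
      · linear_combination f2
  · exact isCovered_of_nonsingular hq hodd hΔ hdet

end SingularCases

section Arc
open Polynomial

variable {F : Type} [Field F]

lemma sq_sub_sq_mul_ne_zero {A B f : F[X]} (hf : Odd f.natDegree) (h : ¬(A = 0 ∧ B = 0)) :
    A ^ 2 - B ^ 2 * f ≠ 0 := by
  intro h0
  have hf0 : f ≠ 0 := by
    rintro rfl
    simp at hf
  have e : A ^ 2 = B ^ 2 * f := sub_eq_zero.1 h0
  by_cases hB : B = 0
  · exact h ⟨by simpa [hB] using e, hB⟩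
  · have := congrArg natDegree e
    rw [natDegree_pow, natDegree_mul (pow_ne_zero 2 hB) hf0, natDegree_pow] at this
    obtain ⟨j, hj⟩ := hf
    omega

variable [Fintype F] [DecidableEq F]

lemma card_zeros_le_natDegree_norm {A B f : F[X]} (hN : A ^ 2 - B ^ 2 * f ≠ 0) :
    (Finset.univ.filter fun s : F × F =>
      s.2 ^ 2 = f.eval s.1 ∧ A.eval s.1 + s.2 * B.eval s.1 = 0).card
      ≤ (A ^ 2 - B ^ 2 * f).natDegree := by
  set N := A ^ 2 - B ^ 2 * f with hNdef
  set Z := Finset.univ.filter fun s : F × F =>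
      s.2 ^ 2 = f.eval s.1 ∧ A.eval s.1 + s.2 * B.eval s.1 = 0 with hZ
  have hmem : ∀ s ∈ Z, s.2 ^ 2 = f.eval s.1 ∧ A.eval s.1 + s.2 * B.eval s.1 = 0 := fun s hs =>
    (Finset.mem_filter.1 hs).2
  have hroot : ∀ s ∈ Z, s.1 ∈ N.roots.toFinset := by
    intro s hs
    obtain ⟨h1, h2⟩ := hmem s hs
    rw [Multiset.mem_toFinset, mem_roots hN, IsRoot.def, hNdef]
    simp only [eval_sub, eval_mul, eval_pow]
    rw [← h1]
    linear_combination (A.eval s.1 - s.2 * B.eval s.1) * h2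
  have hfib : ∀ x ∈ N.roots.toFinset, (Z.filter fun s => s.1 = x).card ≤ N.roots.count x := by
    intro x hx
    rw [count_roots]
    by_cases hB : B.eval x = 0
    · by_cases hA : A.eval x = 0
      · calc (Z.filter fun s => s.1 = x).card ≤ 2 := by
              by_contra hcon
              obtain ⟨s, hs, t, ht, w, hw, hst, hsw, htw⟩ :=
                Finset.two_lt_card.1 (not_le.1 hcon)
              rw [Finset.mem_filter] at hs ht hw
              have e1 := (hmem s hs.1).1
              have e2 := (hmem t ht.1).1
              have e3 := (hmem w hw.1).1
              rw [hs.2] at e1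
              rw [ht.2, ← e1, sq_eq_sq_iff_eq_or_eq_neg] at e2
              rw [hw.2, ← e1, sq_eq_sq_iff_eq_or_eq_neg] at e3
              rcases e2 with e2 | e2
              · exact hst (Prod.ext (hs.2.trans ht.2.symm) e2.symm)
              · rcases e3 with e3 | e3
                · exact hsw (Prod.ext (hs.2.trans hw.2.symm) e3.symm)
                · exact htw (Prod.ext (ht.2.trans hw.2.symm) (e2.trans e3.symm))
          _ ≤ N.rootMultiplicity x := by
              rw [le_rootMultiplicity_iff hN]
              exact dvd_sub (pow_dvd_pow_of_dvd (dvd_iff_isRoot.2 hA) 2)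
                ((pow_dvd_pow_of_dvd (dvd_iff_isRoot.2 hB) 2).mul_right f)
      · have : Z.filter (fun s => s.1 = x) = ∅ := by
          rw [Finset.filter_eq_empty_iff]
          rintro s hs rfl
          have := (hmem s hs).2
          rw [hB] at this
          exact hA (by linear_combination this)
        rw [this]
        simp
    · calc (Z.filter fun s => s.1 = x).card ≤ 1 := by
            rw [Finset.card_le_one]
            intro s hs t ht
            rw [Finset.mem_filter] at hs ht
            have e1 := (hmem s hs.1).2
            have e2 := (hmem t ht.1).2
            rw [hs.2] at e1
            rw [ht.2] at e2
            refine Prod.ext (hs.2.trans ht.2.symm) (mul_right_cancel₀ hB ?_)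
            linear_combination e1 - e2
        _ ≤ N.rootMultiplicity x := by
            rw [Nat.one_le_iff_ne_zero, Ne, rootMultiplicity_eq_zero_iff]
            push Not
            exact ⟨(mem_roots hN).1 (Multiset.mem_toFinset.1 hx), hN⟩
  rw [Finset.card_eq_sum_card_fiberwise hroot]
  exact (Finset.sum_le_sum hfib).trans
    ((Multiset.toFinset_sum_count_eq _).le.trans (card_roots' _))

end Arc

section ConicZeros
open Matrix Polynomial

variable {F : Type} [Field F] [Fintype F] [DecidableEq F] {a b c : F}

/-- A conic meets the curve in at most six points. -/
theorem card_conicPt_zeros_le {k : Fin 6 → F} (hk : k ≠ 0) :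
    (Finset.univ.filter fun P : CurvePt a b c => k ⬝ᵥ conicPt P = 0).card ≤ 6 := by
  set f : F[X] := X ^ 3 + C a * X ^ 2 + C b * X + C c with hf
  set A : F[X] := C (k 0) + C (k 1) * X + C (k 3) * X ^ 2 + C (k 5) * f with hA
  set B : F[X] := C (k 2) + C (k 4) * X with hB
  have hfd : f.natDegree = 3 := by
    rw [hf]
    compute_degree!
  have hBd : B.natDegree ≤ 1 := by
    rw [hB]
    compute_degree
  have hAB : ¬(A = 0 ∧ B = 0) := by
    rintro ⟨h1, h2⟩
    have b0 := congrArg (fun p => coeff p 0) h2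
    have b1 := congrArg (fun p => coeff p 1) h2
    have a0 := congrArg (fun p => coeff p 0) h1
    have a1 := congrArg (fun p => coeff p 1) h1
    have a2 := congrArg (fun p => coeff p 2) h1
    have a3 := congrArg (fun p => coeff p 3) h1
    simp [hB, hA, hf, coeff_X, coeff_C] at a0 a1 a2 a3 b0 b1
    rw [a3] at a0 a1 a2
    simp at a0 a1 a2
    refine hk (eq_of_coords_six ?_ ?_ ?_ ?_ ?_ ?_) <;> simp [*]
  have hN := sq_sub_sq_mul_ne_zero (f := f) (by rw [hfd]; decide) hAB
  have hcard := card_zeros_le_natDegree_norm hN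
  set Z := Finset.univ.filter fun s : F × F =>
      s.2 ^ 2 = f.eval s.1 ∧ A.eval s.1 + s.2 * B.eval s.1 = 0 with hZ
  have hBf : (B ^ 2 * f).natDegree ≤ 5 := by
    refine natDegree_mul_le.trans ?_
    rw [hfd]
    have := natDegree_pow_le (p := B) (n := 2)
    omega
  have haff : (Finset.univ.filter fun s : {s : F × F // s.2 ^ 2 = s.1 ^ 3 + a * s.1 ^ 2
      + b * s.1 + c} => k ⬝ᵥ conicPt (some s : CurvePt a b c) = 0).card ≤ Z.card := by
    refine Finset.card_le_card_of_injOn Subtype.val ?_ Subtype.val_injective.injOn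
    rintro ⟨s, hs⟩ h
    have h := (Finset.mem_filter.1 h).2
    rw [dotProduct_six] at h
    simp [conicPt] at h
    refine Finset.mem_filter.2 ⟨Finset.mem_univ _, ?_, ?_⟩
    · simp [hf, hs]
    · simp [hA, hB, hf]
      linear_combination h - k 5 * hs
  set S := Finset.univ.filter fun s : {s : F × F // s.2 ^ 2 = s.1 ^ 3 + a * s.1 ^ 2
      + b * s.1 + c} => k ⬝ᵥ conicPt (some s : CurvePt a b c) = 0 with hS
  by_cases h5 : k 5 = 0
  · have hsub : (Finset.univ.filter fun P : CurvePt a b c => k ⬝ᵥ conicPt P = 0)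
        ⊆ Finset.insertNone S := by
      rintro (_ | s) hP
      · exact Finset.none_mem_insertNone
      · exact Finset.some_mem_insertNone.2
          (Finset.mem_filter.2 ⟨Finset.mem_univ _, (Finset.mem_filter.1 hP).2⟩)
    have hAd : A.natDegree ≤ 2 := by
      rw [hA, h5]
      simp only [map_zero, zero_mul, add_zero]
      compute_degree
    have hA2 : (A ^ 2).natDegree ≤ 5 := natDegree_pow_le.trans (by omega)
    have hle := Finset.card_le_card hsub
    rw [Finset.card_insertNone] at hle
    have := natDegree_sub_le_of_le hA2 hBf
    omega
  · have hsub : (Finset.univ.filter fun P : CurvePt a b c => k ⬝ᵥ conicPt P = 0)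
        ⊆ S.map Function.Embedding.some := by
      rintro (_ | s) hP
      · refine absurd ?_ h5
        have := (Finset.mem_filter.1 hP).2
        rw [dotProduct_six] at this
        simpa [conicPt] using this
      · exact Finset.mem_map_of_mem _
          (Finset.mem_filter.2 ⟨Finset.mem_univ _, (Finset.mem_filter.1 hP).2⟩)
    have hAd : A.natDegree ≤ 3 := by
      rw [hA, hf]
      compute_degree
    have hA2 : (A ^ 2).natDegree ≤ 6 := natDegree_pow_le.trans (by omega)
    have hle := Finset.card_le_card hsub
    rw [Finset.card_map] at hle
    have := natDegree_sub_le_of_le hA2 (hBf.trans (by norm_num : 5 ≤ 6))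
    omega

end ConicZeros

section OnCurve
open Matrix

variable {F : Type} [Field F] [Fintype F] [DecidableEq F] {a b c : F}

lemma exists_secant_through (hq : 121 ≤ Fintype.card F) (hodd : Odd (Fintype.card F))
    (h2 : (2 : F) ≠ 0) (hΔ : cubicDisc 1 a b c ≠ 0) (P : CurvePt a b c) :
    ∃ l ∈ (weierstrassModel h2 hΔ).secants, l ⬝ᵥ (weierstrassModel h2 hΔ).pt P = 0 := by
  set M := weierstrassModel h2 hΔ with hM
  have hG := card_curvePt hq hodd hΔ
  obtain ⟨k, hk, hkP⟩ : ∃ k : Fin 6 → F, k ≠ 0 ∧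
      ∀ R : CurvePt a b c, M.g (M.pt R) ⬝ᵥ M.pt P = k ⬝ᵥ conicPt R := by
    rcases P with _ | ⟨⟨x, y⟩, hs⟩
    · refine ⟨![0, 0, 2, 0, 0, 0], fun h => h2 (by simpa using congrFun h 2), ?_⟩
      rintro (_ | R) <;> rw [vec3_dotProduct, dotProduct_six] <;>
        simp [hM, weierstrassModel, planePt, conicPt]
    · refine ⟨![-3 * c - b * x, -2 * b - 2 * a * x, 2 * y, -a - 3 * x, 0, 1],
        fun h => by simpa using congrFun h 5, ?_⟩
      rintro (_ | R) <;> rw [vec3_dotProduct, dotProduct_six] <;>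
        simp [hM, weierstrassModel, planePt, conicPt]
      ring
  have hc1 := card_conicPt_zeros_le (a := a) (b := b) (c := c) hk
  set K := Finset.univ.filter fun R : CurvePt a b c => k ⬝ᵥ conicPt R = 0 with hK
  have hgP : M.g (M.pt P) ≠ 0 := M.smooth _ (M.pt_ne P) (M.C_pt P)
  have hc2 : (M.zeros (M.g (M.pt P))).card ≤ 3 := PlaneModel.card_zeros_le hgP
  have hc3 := Finset.card_union_le K (insert P (M.zeros (M.g (M.pt P))))
  have hc4 := Finset.card_insert_le P (M.zeros (M.g (M.pt P)))
  obtain ⟨R, hR⟩ : ∃ R, R ∉ K ∪ insert P (M.zeros (M.g (M.pt P))) := by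
    by_contra hcon
    push Not at hcon
    rw [Finset.eq_univ_iff_forall.2 hcon, Finset.card_univ] at hc3
    omega
  simp only [Finset.mem_union, Finset.mem_insert, not_or, hK, Finset.mem_filter,
    Finset.mem_univ, true_and, PlaneModel.mem_zeros] at hR
  obtain ⟨hRK, hRP, hRt⟩ := hR
  have hl : M.pt P ⨯₃ M.pt R ≠ 0 := PlaneModel.pt_cross_ne (Ne.symm hRP)
  have hlP : (M.pt P ⨯₃ M.pt R) ⬝ᵥ M.pt P = 0 := by
    rw [dotProduct_comm, dot_self_cross]
  have hlR : (M.pt P ⨯₃ M.pt R) ⬝ᵥ M.pt R = 0 := by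
    rw [dotProduct_comm, dot_cross_self]
  refine ⟨_, PlaneModel.mem_secants.2 ⟨hl, ?_⟩, hlP⟩
  have hsub : {P, R} ⊆ M.zeros (M.pt P ⨯₃ M.pt R) := by
    rw [Finset.insert_subset_iff, Finset.singleton_subset_iff]
    exact ⟨PlaneModel.mem_zeros.2 hlP, PlaneModel.mem_zeros.2 hlR⟩
  have hPR : ({P, R} : Finset (CurvePt a b c)).card = 2 := Finset.card_pair (Ne.symm hRP)
  have hle := Finset.card_le_card hsub
  have h3 : (M.zeros (M.pt P ⨯₃ M.pt R)).card ≤ 3 := PlaneModel.card_zeros_le hl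
  have hne : (M.zeros (M.pt P ⨯₃ M.pt R)).card ≠ 2 := by
    intro h
    have heq := Finset.eq_of_subset_of_card_le hsub (by rw [h, hPR])
    obtain ⟨T, hT, t, ht, e⟩ := PlaneModel.tangent_of_card_eq_two h2 hl h
    rw [← heq, Finset.mem_insert, Finset.mem_singleton] at hT
    rcases hT with rfl | rfl
    · rw [e, smul_dotProduct, smul_eq_mul, mul_eq_zero] at hlR
      exact hlR.elim ht hRt
    · rw [e, smul_dotProduct, smul_eq_mul, mul_eq_zero, hkP] at hlP
      exact hlP.elim ht hRK
  omega

/-- Every vector is orthogonal to a conic meeting the curve in six points. -/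
theorem isCovered (hq : 121 ≤ Fintype.card F) (hodd : Odd (Fintype.card F))
    (hΔ : cubicDisc 1 a b c ≠ 0) (Q : Fin 6 → F) : IsCovered a b c Q := by
  by_cases hQ : ∀ (P : CurvePt a b c) (k : F), Q ≠ k • conicPt P
  · exact isCovered_of_not_mem hq hodd hΔ hQ
  · push Not at hQ
    obtain ⟨P, k, rfl⟩ := hQ
    have h2 := two_ne_zero_of_odd hodd
    have hG := card_curvePt hq hodd hΔ
    obtain ⟨l, hl, hlP⟩ := exists_secant_through hq hodd h2 hΔ P
    obtain ⟨m, hm, hd⟩ := PlaneModel.exists_disjoint_secant (M := weierstrassModel h2 hΔ) h2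
      (by omega) _ (PlaneModel.mem_secants.1 hl).2.le
    refine isCovered_of_plane h2 hΔ hG hl hm hd ?_
    rw [vec3_dotProduct] at hlP
    rcases P with _ | ⟨⟨x, y⟩, hs⟩
    · simp [weierstrassModel, planePt] at hlP
      simp [conicPt, hlP]
    · simp [weierstrassModel, planePt] at hlP
      simp [conicPt]
      linear_combination k * (m 0 + m 1 * x + m 2 * y) * hlP

end OnCurve

section Transfer
open Matrix

variable {F : Type} [Field F] [Fintype F] [DecidableEq F]

/-- The coefficients of a conic after the substitution `y ↦ y + αx + β`. -/
def shiftConic (α β : F) (k : Fin 6 → F) : Fin 6 → F :=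
  ![k 0 + β * k 2 + β ^ 2 * k 5, k 1 + α * k 2 + β * k 4 + 2 * α * β * k 5, k 2 + 2 * β * k 5,
    k 3 + α * k 4 + α ^ 2 * k 5, k 4 + 2 * α * k 5, k 5]

/-- The transpose of `shiftConic`. -/
def shiftPoint (α β : F) (Q : Fin 6 → F) : Fin 6 → F :=
  ![Q 0, Q 1, Q 2 + α * Q 1 + β * Q 0, Q 3, Q 4 + β * Q 1 + α * Q 3,
    Q 5 + β ^ 2 * Q 0 + 2 * α * β * Q 1 + 2 * β * Q 2 + α ^ 2 * Q 3 + 2 * α * Q 4]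

lemma shiftConic_dotProduct (α β : F) (k Q : Fin 6 → F) :
    shiftConic α β k ⬝ᵥ Q = k ⬝ᵥ shiftPoint α β Q := by
  rw [dotProduct_six, dotProduct_six]
  simp [shiftConic, shiftPoint]
  ring

lemma shiftConic_neg (α β : F) (k : Fin 6 → F) : shiftConic α β (shiftConic (-α) (-β) k) = k := by
  apply eq_of_coords_six <;> simp [shiftConic] <;> ring

lemma shiftConic_ne_zero (α β : F) {k : Fin 6 → F} (hk : k ≠ 0) : shiftConic α β k ≠ 0 := by
  intro h
  apply hk
  have := shiftConic_neg (-α) (-β) k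
  rw [neg_neg, neg_neg, h] at this
  rw [← this]
  apply eq_of_coords_six <;> simp [shiftConic]

variable (W : WeierstrassCurve F) [W.IsElliptic]

lemma cubicDisc_ne_zero (h2 : (2 : F) ≠ 0) :
    cubicDisc 1 (W.a₂ + W.a₁ ^ 2 / 4) (W.a₄ + W.a₁ * W.a₃ / 2) (W.a₆ + W.a₃ ^ 2 / 4) ≠ 0 := by
  have h4 : (4 : F) ≠ 0 := by
    rw [show (4 : F) = 2 * 2 by norm_num]
    exact mul_ne_zero h2 h2
  intro h
  refine W.isUnit_Δ.ne_zero ?_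
  have : W.Δ = 16 * cubicDisc 1 (W.a₂ + W.a₁ ^ 2 / 4) (W.a₄ + W.a₁ * W.a₃ / 2)
      (W.a₆ + W.a₃ ^ 2 / 4) := by
    simp only [cubicDisc, WeierstrassCurve.Δ, WeierstrassCurve.b₂, WeierstrassCurve.b₄,
      WeierstrassCurve.b₆, WeierstrassCurve.b₈]
    obtain ⟨α, hα⟩ : ∃ α, W.a₁ = 2 * α := ⟨_, (mul_div_cancel₀ _ h2).symm⟩
    obtain ⟨β, hβ⟩ : ∃ β, W.a₃ = 2 * β := ⟨_, (mul_div_cancel₀ _ h2).symm⟩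
    have e1 : (2 * α) ^ 2 / 4 = α ^ 2 := by field_simp; ring
    have e2 : 2 * α * (2 * β) / 2 = 2 * α * β := by field_simp
    have e3 : (2 * β) ^ 2 / 4 = β ^ 2 := by field_simp; ring
    rw [hα, hβ, e1, e2, e3]
    ring
  rw [this, h, mul_zero]

/-- Completing the square identifies the points of a Weierstrass curve with those of a curve
`y² = x³ + ax² + bx + c`. -/
def pointEquiv (h2 : (2 : F) ≠ 0) : W.toAffine.Point ≃
    CurvePt (W.a₂ + W.a₁ ^ 2 / 4) (W.a₄ + W.a₁ * W.a₃ / 2) (W.a₆ + W.a₃ ^ 2 / 4) where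
  toFun
    | .zero => none
    | .some x y h => some ⟨(x, y + W.a₁ / 2 * x + W.a₃ / 2), by
        have h4 : (4 : F) ≠ 0 := by
          rw [show (4 : F) = 2 * 2 by norm_num]
          exact mul_ne_zero h2 h2
        have := (W.toAffine.equation_iff x y).1 h.1
        simp only
        field_simp
        linear_combination 16 * this⟩
  invFun
    | none => .zero
    | some ⟨(x, y), h⟩ => .some x (y - W.a₁ / 2 * x - W.a₃ / 2) (by
        rw [← WeierstrassCurve.Affine.equation_iff_nonsingular,
          WeierstrassCurve.Affine.equation_iff]
        have h4 : (4 : F) ≠ 0 := by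
          rw [show (4 : F) = 2 * 2 by norm_num]
          exact mul_ne_zero h2 h2
        simp only at h
        field_simp at h ⊢
        apply mul_left_cancel₀ h2
        linear_combination h)
  left_inv
    | .zero => rfl
    | .some x y h => by simp; ring
  right_inv
    | none => rfl
    | some ⟨(x, y), h⟩ => by simp; ring

lemma conicPt_pointEquiv (h2 : (2 : F) ≠ 0) (P : W.toAffine.Point) :
    conicPt (pointEquiv W h2 P) = shiftPoint (W.a₁ / 2) (W.a₃ / 2) (phiVec W 6 P) := by
  rcases P with _ | ⟨x, y, h⟩
  · apply eq_of_coords_six <;> simp [pointEquiv, conicPt, shiftPoint, phiVec]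
  · apply eq_of_coords_six <;> simp [pointEquiv, conicPt, shiftPoint, phiVec, psi] <;> ring

lemma conic_zeros_pointEquiv (h2 : (2 : F) ≠ 0) (k : Fin 6 → F) :
    {P : W.toAffine.Point | shiftConic (W.a₁ / 2) (W.a₃ / 2) k ⬝ᵥ phiVec W 6 P = 0}.ncard
      = (Finset.univ.filter fun P : CurvePt (W.a₂ + W.a₁ ^ 2 / 4) (W.a₄ + W.a₁ * W.a₃ / 2)
          (W.a₆ + W.a₃ ^ 2 / 4) => k ⬝ᵥ conicPt P = 0).card := by
  rw [← Set.ncard_coe_finset, ← Set.ncard_image_of_injective _ (pointEquiv W h2).injective]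
  congr 1
  ext P
  obtain ⟨P, rfl⟩ := (pointEquiv W h2).surjective P
  simp [shiftConic_dotProduct, conicPt_pointEquiv]

/-- At most six points of the curve lie on a given conic. -/
theorem ncard_conic_zeros_le (h2 : (2 : F) ≠ 0) {k : Fin 6 → F} (hk : k ≠ 0) :
    {P : W.toAffine.Point | k ⬝ᵥ phiVec W 6 P = 0}.ncard ≤ 6 := by
  have h := conic_zeros_pointEquiv W h2 (shiftConic (-(W.a₁ / 2)) (-(W.a₃ / 2)) k)
  rw [shiftConic_neg] at h
  rw [h]
  exact card_conicPt_zeros_le (shiftConic_ne_zero _ _ hk)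

/-- Every vector is orthogonal to a conic containing exactly six points of the curve. -/
theorem exists_conic_six_zeros (hq : 121 ≤ Fintype.card F) (hodd : Odd (Fintype.card F))
    (Q : Fin 6 → F) : ∃ k : Fin 6 → F, k ≠ 0 ∧ k ⬝ᵥ Q = 0 ∧
      {P : W.toAffine.Point | k ⬝ᵥ phiVec W 6 P = 0}.ncard = 6 := by
  have h2 := two_ne_zero_of_odd hodd
  obtain ⟨k, hk, hkQ, hc⟩ := isCovered hq hodd (cubicDisc_ne_zero W h2)
    (shiftPoint (W.a₁ / 2) (W.a₃ / 2) Q)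
  exact ⟨_, shiftConic_ne_zero _ _ hk, by rw [shiftConic_dotProduct, hkQ],
    by rw [conic_zeros_pointEquiv W h2, hc]⟩

lemma card_point (hq : 121 ≤ Fintype.card F) (hodd : Odd (Fintype.card F)) :
    100 ≤ Nat.card W.toAffine.Point := by
  have h2 := two_ne_zero_of_odd hodd
  rw [Nat.card_congr (pointEquiv W h2), Nat.card_eq_fintype_card]
  exact card_curvePt hq hodd (cubicDisc_ne_zero W h2)

end Transfer

section Projective
open Matrix

variable {F : Type} [Field F] [Fintype F] [DecidableEq F] (W : WeierstrassCurve F)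

lemma phiVec_smul_injective {P R : W.toAffine.Point} {u : F}
    (h : u • phiVec W 6 R = phiVec W 6 P) : P = R := by
  have e0 := congrFun h 0
  have e1 := congrFun h 1
  have e2 := congrFun h 2
  have e5 := congrFun h 5
  rcases P with _ | ⟨x, y, hP⟩ <;> rcases R with _ | ⟨x', y', hR⟩ <;>
    simp [phiVec, psi] at e0 e1 e2 e5
  · rfl
  · simp [e0] at e5
  · simp_all

lemma phiProj_injective (h6 : 0 < 6) : Function.Injective (phiProj W h6) := by
  intro P R h
  obtain ⟨u, hu⟩ := (Projectivization.mk_eq_mk_iff' F _ _ _ _).1 h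
  exact phiVec_smul_injective W hu

lemma onHyp_phiProj (h6 : 0 < 6) (k : Fin 6 → F) (P : W.toAffine.Point) :
    OnHyp k (phiProj W h6 P) ↔ k ⬝ᵥ phiVec W 6 P = 0 := by
  obtain ⟨u, hu⟩ := Projectivization.exists_smul_eq_mk_rep F (phiVec W 6 P) (phiVec_ne_zero W h6 P)
  change k ⬝ᵥ (phiProj W h6 P).rep = 0 ↔ _
  rw [phiProj, ← hu, dotProduct_smul]
  exact smul_eq_zero_iff_eq u

lemma ncard_onHyp (h6 : 0 < 6) (k : Fin 6 → F) :
    {p ∈ Set.range (phiProj W h6) | OnHyp k p}.ncard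
      = {P : W.toAffine.Point | k ⬝ᵥ phiVec W 6 P = 0}.ncard := by
  rw [← Set.ncard_image_of_injective _ (phiProj_injective W h6)]
  congr 1
  ext p
  constructor
  · rintro ⟨⟨P, rfl⟩, hP⟩
    exact ⟨P, (onHyp_phiProj W h6 k P).1 hP, rfl⟩
  · rintro ⟨P, hP, rfl⟩
    exact ⟨⟨P, rfl⟩, (onHyp_phiProj W h6 k P).2 hP⟩

end Projective

section Extension
open Matrix

variable {F : Type} [Field F] [Fintype F] [DecidableEq F]

lemma isCompleteArcSet_of_covering {k : ℕ} {S : Set (Projectivization F (Fin k → F))}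
    (hS : IsArcSet k S) (h : ∀ Q ∉ S, ∃ a : Fin k → F, a ≠ 0 ∧ OnHyp a Q ∧
      Set.ncard {p ∈ S | OnHyp a p} = k) : IsCompleteArcSet k S := by
  refine ⟨hS, fun T hT hST => Set.Subset.antisymm (fun Q hQT => ?_) hST⟩
  by_contra hQ
  obtain ⟨a, ha, haQ, hc⟩ := h Q hQ
  have hfin : {p ∈ T | OnHyp a p}.Finite := Set.toFinite _
  have hsub : insert Q {p ∈ S | OnHyp a p} ⊆ {p ∈ T | OnHyp a p} := by
    rintro p (rfl | hp)
    · exact ⟨hQT, haQ⟩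
    · exact ⟨hST hp.1, hp.2⟩
  have h1 := Set.ncard_le_ncard hsub hfin
  rw [Set.ncard_insert_of_notMem (fun hp => hQ hp.1), hc] at h1
  have := hT a ha
  omega

variable {W : WeierstrassCurve F} {n : ℕ} (e : Fin n ≃ W.toAffine.Point)

lemma mem_ellipticCode {k : ℕ} {x : Fin n → F} :
    x ∈ ellipticCode W k e ↔ ∃ a : Fin k → F, (fun j => a ⬝ᵥ phiVec W k (e j)) = x := by
  rw [ellipticCode, Submodule.mem_span_range_iff_exists_fun]
  refine exists_congr fun a => ?_
  apply Eq.congr_left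
  ext j
  simp [dotProduct]

lemma hammingNorm_codeword {k : ℕ} (a : Fin k → F) :
    hammingNorm (fun j => a ⬝ᵥ phiVec W k (e j))
      + {P : W.toAffine.Point | a ⬝ᵥ phiVec W k P = 0}.ncard = n := by
  have h : {P : W.toAffine.Point | a ⬝ᵥ phiVec W k P = 0}.ncard
      = (Finset.univ.filter fun j => a ⬝ᵥ phiVec W k (e j) = 0).card := by
    rw [← Set.ncard_coe_finset, ← Set.ncard_image_of_injective _ e.injective]
    congr 1
    ext P
    obtain ⟨j, rfl⟩ := e.surjective P
    simp
  rw [h, hammingNorm, add_comm, Finset.card_filter_add_card_filter_not, Finset.card_univ,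
    Fintype.card_fin]

lemma exists_extension_functional {k : ℕ} {C' : Submodule F (Fin (n + 1) → F)}
    (h : Submodule.map (LinearMap.funLeft F F (Fin.castAdd 1)) C' = ellipticCode W k e) :
    ∃ v : Fin k → F, ∀ a : Fin k → F, ∃ x ∈ C', x (Fin.last n) = a ⬝ᵥ v ∧
      ∀ j, x (Fin.castSucc j) = a ⬝ᵥ phiVec W k (e j) := by
  have hx : ∀ i : Fin k, ∃ x ∈ C', ∀ j, x (Fin.castSucc j) = phiVec W k (e j) i := by
    intro i
    have hi : (fun j => phiVec W k (e j) i) ∈ ellipticCode W k e :=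
      Submodule.subset_span ⟨i, rfl⟩
    rw [← h] at hi
    obtain ⟨x, hx, hxi⟩ := hi
    exact ⟨x, hx, fun j => congrFun hxi j⟩
  choose x hxC hx using hx
  refine ⟨fun i => x i (Fin.last n), fun a => ⟨∑ i, a i • x i,
    Submodule.sum_mem _ fun i _ => Submodule.smul_mem _ _ (hxC i), ?_, fun j => ?_⟩⟩
  · simp [dotProduct]
  · simp [dotProduct, hx]

lemma hammingNorm_le_of_last_eq_zero {x : Fin (n + 1) → F} (h : x (Fin.last n) = 0) :
    hammingNorm x ≤ hammingNorm (fun j => x (Fin.castSucc j)) := by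
  rw [hammingNorm, hammingNorm]
  refine (Finset.card_le_card (t := (Finset.univ.filter fun j => x (Fin.castSucc j) ≠ 0).map
    Fin.castSuccEmb) fun i hi => ?_).trans (Finset.card_map _).le
  have hi := (Finset.mem_filter.1 hi).2
  rcases Fin.eq_castSucc_or_eq_last i with ⟨j, rfl⟩ | rfl
  · exact Finset.mem_map_of_mem _ (Finset.mem_filter.2 ⟨Finset.mem_univ _, hi⟩)
  · exact absurd h hi

theorem not_isHExtendable [W.IsElliptic] (hq : 121 ≤ Fintype.card F)
    (hodd : Odd (Fintype.card F)) : ¬ IsHExtendable 1 (ellipticCode W 6 e) := by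
  rintro ⟨C', -, hd, hmap⟩
  have h2 := two_ne_zero_of_odd hodd
  have hn : 100 ≤ n := by
    rw [← Fintype.card_fin n, ← Nat.card_eq_fintype_card, Nat.card_congr e]
    exact card_point W hq hodd
  have hw : ∀ a : Fin 6 → F, {P : W.toAffine.Point | a ⬝ᵥ phiVec W 6 P = 0}.ncard = 6 →
      (fun j => a ⬝ᵥ phiVec W 6 (e j)) ≠ 0 := by
    intro a ha h0
    have := hammingNorm_codeword e a
    rw [ha, h0, hammingNorm_zero] at this
    omega
  have hlow : n - 6 ≤ minDist (ellipticCode W 6 e) := by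
    refine le_csInf ?_ ?_
    · obtain ⟨a, -, -, ha⟩ := exists_conic_six_zeros W hq hodd 0
      exact ⟨_, _, (mem_ellipticCode e).2 ⟨a, rfl⟩, hw a ha, rfl⟩
    · rintro d ⟨x, hx, hx0, rfl⟩
      obtain ⟨a, rfl⟩ := (mem_ellipticCode e).1 hx
      have ha : a ≠ 0 := by
        rintro rfl
        exact hx0 (by ext; simp)
      have h1 := hammingNorm_codeword e a
      have h3 := ncard_conic_zeros_le W h2 ha
      omega
  obtain ⟨v, hv⟩ := exists_extension_functional e hmap
  obtain ⟨a, -, hav, ha⟩ := exists_conic_six_zeros W hq hodd v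
  obtain ⟨x, hxC, hxl, hx⟩ := hv a
  have hx0 : x ≠ 0 := by
    rintro rfl
    exact hw a ha (funext fun j => (hx j).symm)
  have hup : minDist C' ≤ hammingNorm x := Nat.sInf_le ⟨x, hxC, hx0, rfl⟩
  have h1 := hammingNorm_le_of_last_eq_zero (hxl.trans hav)
  have h3 := hammingNorm_codeword e a
  simp only [hx] at h1
  omega

end Extension

/-- Let `q ≥ 121` be an odd prime power and `E/F_q` an elliptic curve with
`j(E) ≠ 0`. Then the `6`-elliptic code associated to `E` is non-extendable; equivalently
`φ₆(E(F_q))` is a complete `(n; 6, 4)`-set in `P⁵(F_q)`: through every point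
`Q ∈ P⁵(F_q) \ φ₆(E(F_q))` there is a hyperplane meeting `φ₆(E(F_q))` in `6` points. -/
theorem statement12 (hq : 121 ≤ Fintype.card F) (hodd : Odd (Fintype.card F))
    (W : WeierstrassCurve F) [W.IsElliptic] (hj : W.j ≠ 0) {n : ℕ}
    (hn : n = Nat.card W.toAffine.Point) (e : Fin n ≃ W.toAffine.Point) :
    ¬ IsHExtendable 1 (ellipticCode W 6 e) ∧
      IsCompleteArcSet 6 (Set.range (phiProj W (k := 6) (by norm_num))) ∧
      ∀ Q ∉ Set.range (phiProj W (k := 6) (by norm_num)),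
        ∃ a : Fin 6 → F, a ≠ 0 ∧ OnHyp a Q ∧
          Set.ncard {p ∈ Set.range (phiProj W (k := 6) (by norm_num)) | OnHyp a p} = 6 := by
  have hcov : ∀ Q ∉ Set.range (phiProj W (k := 6) (by norm_num)),
      ∃ a : Fin 6 → F, a ≠ 0 ∧ OnHyp a Q ∧
        Set.ncard {p ∈ Set.range (phiProj W (k := 6) (by norm_num)) | OnHyp a p} = 6 := by
    intro Q _
    obtain ⟨a, ha, haQ, hc⟩ := exists_conic_six_zeros W hq hodd Q.rep
    exact ⟨a, ha, haQ, (ncard_onHyp W _ a).trans hc⟩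
  refine ⟨not_isHExtendable e hq hodd, isCompleteArcSet_of_covering (fun a ha => ?_) hcov, hcov⟩
  rw [ncard_onHyp]
  exact ncard_conic_zeros_le W (two_ne_zero_of_odd hodd) ha

end NMDS
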